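/- arXiv:1410.1718 — 3 statements merged into one kernel-verified Lean document; each statement's English description precedes it below -/
import Mathlib

section
/- Let I = [a,b] be a nondegenerate compact real interval, let f : I → I be piecewise strictly monotone, and let n be a positive integer. Then there exists a Markov map g : I → I such that sup_{x ∈ I} |f(x) − g(x)| < 1/n and, for every k ≤ n and every open subinterval U ⊆ I on which f^k is continuous and monotone, the iterate g^k is continuous and monotone on U. -/
open Set
open Filter Topology

/-- `x` and `y` have the same position with respect to the set `A`. -/
def SamePos (A : Set ℝ) (x y : ℝ) : Prop := ∀ e ∈ A, (x < e ↔ y < e) ∧ (e < x ↔ e < y)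

lemma SamePos.symm {A : Set ℝ} {x y : ℝ} (h : SamePos A x y) : SamePos A y x :=
  fun e he => ⟨(h e he).1.symm, (h e he).2.symm⟩

lemma SamePos.trans {A : Set ℝ} {x y z : ℝ} (h : SamePos A x y) (h' : SamePos A y z) :
    SamePos A x z :=
  fun e he => ⟨(h e he).1.trans (h' e he).1, (h e he).2.trans (h' e he).2⟩

lemma SamePos.mono {A B : Set ℝ} (hAB : A ⊆ B) {x y : ℝ} (h : SamePos B x y) : SamePos A x y :=
  fun e he => h e (hAB he)

lemma SamePos.eq {A : Set ℝ} {x y : ℝ} (h : SamePos A x y) (hx : x ∈ A) : x = y := by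
  have h1 := h x hx
  rcases lt_trichotomy x y with h2 | h2 | h2
  · exact absurd (h1.2.2 h2) (lt_irrefl _)
  · exact h2
  · exact absurd (h1.1.2 h2) (lt_irrefl _)

lemma steps_lt {r : ℕ} {p : ℕ → ℝ} (hp : ∀ i < r, p i < p (i + 1)) :
    ∀ i j, i < j → j ≤ r → p i < p j := by
  intro i j hij
  induction j, hij using Nat.le_induction with
  | base => intro h; exact hp i (by omega)
  | succ j hj ih => intro h; exact (ih (by omega)).trans (hp j (by omega))

lemma steps_le {r : ℕ} {p : ℕ → ℝ} (hp : ∀ i < r, p i < p (i + 1)) :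
    ∀ i j, i ≤ j → j ≤ r → p i ≤ p j := by
  intro i j hij hj
  rcases hij.eq_or_lt with h | h
  · rw [h]
  · exact (steps_lt hp i j h hj).le

lemma find_gap {p : ℕ → ℝ} (x : ℝ) : ∀ r : ℕ, x ∈ Icc (p 0) (p r) → (∀ i ≤ r, x ≠ p i) →
    ∃ i < r, x ∈ Ioo (p i) (p (i + 1)) := by
  intro r
  induction r with
  | zero =>
    intro hx hne
    exact absurd (le_antisymm hx.2 hx.1) (hne 0 le_rfl)
  | succ r ih =>
    intro hx hne
    by_cases h : x ≤ p r
    · obtain ⟨i, hi, hh⟩ := ih ⟨hx.1, h⟩ (fun i hi => hne i (by omega))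
      exact ⟨i, by omega, hh⟩
    · exact ⟨r, by omega, not_le.1 h, lt_of_le_of_ne hx.2 (hne _ le_rfl)⟩

lemma exists_enum {S : Set ℝ} (hS : S.Finite) {a b : ℝ} (hab : a < b) (ha : a ∈ S) (hb : b ∈ S)
    (hsub : S ⊆ Icc a b) : ∃ (r : ℕ) (p : ℕ → ℝ), 0 < r ∧ p 0 = a ∧ p r = b ∧
      (∀ i < r, p i < p (i + 1)) ∧ (∀ x, x ∈ S ↔ ∃ i ≤ r, x = p i) := by
  classical
  obtain ⟨r, hr⟩ : ∃ r, hS.toFinset.card = r + 1 := by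
    apply Nat.exists_eq_succ_of_ne_zero
    exact Finset.card_ne_zero_of_mem (hS.mem_toFinset.2 ha)
  let emb := hS.toFinset.orderEmbOfFin hr
  let p : ℕ → ℝ := fun i => if h : i < r + 1 then emb ⟨i, h⟩ else 0
  have hpi : ∀ i (h : i < r + 1), p i = emb ⟨i, h⟩ := fun i h => dif_pos h
  have hmem : ∀ x, x ∈ S ↔ ∃ i ≤ r, x = p i := by
    intro x
    have h1 : x ∈ Set.range emb ↔ x ∈ S := by
      rw [Finset.range_orderEmbOfFin]; simp
    rw [← h1]
    constructor
    · rintro ⟨i, rfl⟩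
      exact ⟨i, by omega, (hpi i i.2).symm⟩
    · rintro ⟨i, hi, rfl⟩
      exact ⟨⟨i, by omega⟩, (hpi i (by omega)).symm⟩
  have hlt : ∀ i < r, p i < p (i + 1) := by
    intro i hi
    rw [hpi i (by omega), hpi (i+1) (by omega)]
    apply emb.strictMono
    simp
  have hle := steps_le hlt
  have h0 : p 0 = a := by
    apply le_antisymm
    · obtain ⟨i, hi, h⟩ := (hmem a).1 ha
      rw [h]; exact hle 0 i (by omega) hi
    · exact (hsub ((hmem _).2 ⟨0, by omega, rfl⟩)).1
  have h1 : p r = b := by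
    apply le_antisymm
    · exact (hsub ((hmem _).2 ⟨r, by omega, rfl⟩)).2
    · obtain ⟨i, hi, h⟩ := (hmem b).1 hb
      rw [h]; exact hle i r hi le_rfl
  refine ⟨r, p, ?_, h0, h1, hlt, hmem⟩
  rcases Nat.eq_zero_or_pos r with h | h
  · subst h; linarith
  · exact h

/-- Piecewise linear interpolation along a sequence. -/
lemma interp_seq (z w : ℕ → ℝ) : ∀ N : ℕ, (∀ i < N, z i < z (i + 1)) →
    (∀ i < N, w i ≤ w (i + 1)) → ∃ ψ : ℝ → ℝ, Continuous ψ ∧ Monotone ψ ∧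
      (∀ y, z N ≤ y → ψ y = w N) ∧
      (∀ i < N, ∀ y ∈ Icc (z i) (z (i + 1)),
        ψ y = w i + (w (i + 1) - w i) * ((y - z i) / (z (i + 1) - z i))) := by
  intro N
  induction N with
  | zero =>
    intro _ _
    exact ⟨fun _ => w 0, continuous_const, monotone_const, fun _ _ => rfl,
      fun i hi => absurd hi (by omega)⟩
  | succ N ih =>
    intro hz hw
    obtain ⟨ψ, hc, hm, h1, h2⟩ := ih (fun i hi => hz i (by omega)) (fun i hi => hw i (by omega))
    have hzN := hz N (by omega)
    have hwN := hw N (by omega)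
    have hd : 0 < z (N + 1) - z N := by linarith
    refine ⟨fun y => ψ y + (w (N + 1) - w N) *
      (max 0 (min 1 ((y - z N) / (z (N + 1) - z N)))), ?_, ?_, ?_, ?_⟩
    · fun_prop
    · intro x y hxy
      have : (x - z N) / (z (N + 1) - z N) ≤ (y - z N) / (z (N + 1) - z N) := by gcongr
      have h3 : max 0 (min 1 ((x - z N) / (z (N + 1) - z N))) ≤
        max 0 (min 1 ((y - z N) / (z (N + 1) - z N))) := by gcongr
      have := mul_le_mul_of_nonneg_left h3 (sub_nonneg.2 hwN)
      have := hm hxy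
      simp only
      linarith
    · intro y hy
      have : 1 ≤ (y - z N) / (z (N + 1) - z N) := by
        rw [le_div_iff₀ hd]; linarith
      simp only
      rw [h1 y (by linarith), min_eq_left this, max_eq_right zero_le_one]
      ring
    · intro i hi y hy
      rcases Nat.lt_succ_iff_lt_or_eq.1 hi with h | h
      · have hy2 : y ≤ z N := hy.2.trans
          (steps_le (r := N) (fun i hi => hz i (by omega)) (i+1) N (by omega) le_rfl)
        have : (y - z N) / (z (N + 1) - z N) ≤ 0 :=
          div_nonpos_of_nonpos_of_nonneg (by linarith) hd.le
        simp only
        rw [h2 i h y hy, min_eq_right (by linarith), max_eq_left this]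
        ring
      · subst h
        have e1 : 0 ≤ (y - z i) / (z (i + 1) - z i) := div_nonneg (by linarith [hy.1]) hd.le
        have e2 : (y - z i) / (z (i + 1) - z i) ≤ 1 := by
          rw [div_le_one hd]; linarith [hy.2]
        simp only
        rw [h1 y hy.1, min_eq_right e2, max_eq_right e1]

/-- Interpolation of a rounding map `ρ` along a finite set `Z`. -/
lemma interp_set {a b : ℝ} (hab : a < b) {E Z : Set ℝ} (hZ : Z.Finite) (hEZ : E ⊆ Z)
    (ha : a ∈ E) (hb : b ∈ E) (hsub : Z ⊆ Icc a b) (ρ : ℝ → ℝ) (hρ : MonotoneOn ρ (Icc a b))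
    (hρE : ∀ y ∈ Icc a b, SamePos E y (ρ y)) (δ : ℝ) (hδ : ∀ y ∈ Icc a b, |y - ρ y| ≤ δ) :
    ∃ ψ : ℝ → ℝ, Continuous ψ ∧ Monotone ψ ∧ (∀ z ∈ Z, ψ z = ρ z) ∧
      (∀ y ∈ Icc a b, SamePos E y (ψ y)) ∧ (∀ y ∈ Icc a b, |y - ψ y| ≤ δ) ∧
      (∀ J ⊆ Icc a b, IsPreconnected J → Disjoint J Z →
        StrictMonoOn ψ J ∨ ∃ c, ∀ x ∈ J, ψ x = c) := by
  obtain ⟨N, z, hN, z0, zN, hz, hmem⟩ := exists_enum hZ hab (hEZ ha) (hEZ hb) hsub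
  have hzI : ∀ i ≤ N, z i ∈ Icc a b := fun i hi => hsub ((hmem _).2 ⟨i, hi, rfl⟩)
  obtain ⟨ψ, hc, hm, h1, h2⟩ := interp_seq z (fun i => ρ (z i)) N hz
    (fun i hi => hρ (hzI _ hi.le) (hzI _ hi) (hz i hi).le)
  have hψZ : ∀ x ∈ Z, ψ x = ρ x := by
    intro x hx
    obtain ⟨i, hi, rfl⟩ := (hmem x).1 hx
    rcases hi.eq_or_lt with h | h
    · subst h; exact h1 _ le_rfl
    · rw [h2 i h (z i) ⟨le_rfl, (hz i h).le⟩]; simp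
  have hgap : ∀ y ∈ Icc a b, y ∉ Z → ∃ i < N, y ∈ Ioo (z i) (z (i + 1)) := by
    intro y hy hyZ
    apply find_gap y N (by rw [z0, zN]; exact hy)
    intro i hi h
    exact hyZ ((hmem y).2 ⟨i, hi, h⟩)
  refine ⟨ψ, hc, hm, hψZ, ?_, ?_, ?_⟩
  · intro y hy
    by_cases hyZ : y ∈ Z
    · rw [hψZ y hyZ]; exact hρE y hy
    obtain ⟨i, hi, hyi⟩ := hgap y hy hyZ
    have hd : 0 < z (i + 1) - z i := by linarith [hz i hi]
    have key := h2 i hi y ⟨hyi.1.le, hyi.2.le⟩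
    set s := (y - z i) / (z (i + 1) - z i) with hs
    have s0 : 0 < s := div_pos (by linarith [hyi.1]) hd
    have s1 : s < 1 := by rw [hs, div_lt_one hd]; linarith [hyi.2]
    have A : ∀ e ∈ E, e < y → e < ψ y := by
      intro e he hey
      have h3 : e ≤ z i := by
        obtain ⟨j, hj, rfl⟩ := (hmem e).1 (hEZ he)
        apply steps_le hz j i _ hi.le
        by_contra hcon
        have := steps_le hz (i+1) j (by omega) hj
        linarith [hyi.2]
      have h4 : e < ρ (z (i + 1)) := (hρE _ (hzI _ hi) e he).2.1 (by linarith)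
      have h5 : e ≤ ρ (z i) := by
        by_contra hcon
        have := (hρE _ (hzI _ hi.le) e he).1.2 (not_le.1 hcon)
        linarith
      have h6 : ψ y = (1 - s) * ρ (z i) + s * ρ (z (i + 1)) := by rw [key]; ring
      nlinarith
    have B : ∀ e ∈ E, y < e → ψ y < e := by
      intro e he hey
      have h3 : z (i + 1) ≤ e := by
        obtain ⟨j, hj, rfl⟩ := (hmem e).1 (hEZ he)
        apply steps_le hz (i+1) j _ hj
        by_contra hcon
        have := steps_le hz j i (by omega) hi.le
        linarith [hyi.1]
      have h4 : ρ (z i) < e := (hρE _ (hzI _ hi.le) e he).1.1 (by linarith)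
      have h5 : ρ (z (i + 1)) ≤ e := by
        by_contra hcon
        have := (hρE _ (hzI _ hi) e he).2.2 (not_le.1 hcon)
        linarith
      have h6 : ψ y = (1 - s) * ρ (z i) + s * ρ (z (i + 1)) := by rw [key]; ring
      nlinarith
    intro e he
    have hne : y ≠ e := fun h => hyZ (h ▸ hEZ he)
    constructor
    · refine ⟨B e he, fun h => ?_⟩
      by_contra hcon
      have := A e he (lt_of_le_of_ne (not_lt.1 hcon) hne.symm)
      linarith
    · refine ⟨A e he, fun h => ?_⟩
      by_contra hcon
      have := B e he (lt_of_le_of_ne (not_lt.1 hcon) hne)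
      linarith
  · intro y hy
    by_cases hyZ : y ∈ Z
    · rw [hψZ y hyZ]; exact hδ y hy
    obtain ⟨i, hi, hyi⟩ := hgap y hy hyZ
    have hd : 0 < z (i + 1) - z i := by linarith [hz i hi]
    have key := h2 i hi y ⟨hyi.1.le, hyi.2.le⟩
    set s := (y - z i) / (z (i + 1) - z i) with hs
    have s0 : 0 < s := div_pos (by linarith [hyi.1]) hd
    have s1 : s < 1 := by rw [hs, div_lt_one hd]; linarith [hyi.2]
    have hsy : y = (1 - s) * z i + s * z (i + 1) := by
      have : s * (z (i + 1) - z i) = y - z i := by rw [hs]; field_simp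
      linarith
    have h3 := abs_le.1 (hδ _ (hzI _ hi))
    have h4 := abs_le.1 (hδ _ (hzI _ hi.le))
    have h5 : y - ψ y = (1 - s) * (z i - ρ (z i)) + s * (z (i + 1) - ρ (z (i + 1))) := by
      rw [key]; linarith
    rw [h5, abs_le]
    constructor <;> nlinarith
  · intro J hJ hJc hJZ
    rcases J.eq_empty_or_nonempty with h | ⟨y, hy⟩
    · subst h; left; intro x hx; exact absurd hx (by simp)
    have hnot : ∀ x ∈ J, x ∉ Z := fun x hx => Set.disjoint_left.1 hJZ hx
    obtain ⟨i, hi, hyi⟩ := hgap y (hJ hy) (hnot y hy)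
    have hd : 0 < z (i + 1) - z i := by linarith [hz i hi]
    have hJi : ∀ x ∈ J, x ∈ Icc (z i) (z (i + 1)) := by
      intro x hx
      have hoc := hJc.ordConnected
      constructor
      · by_contra hcon
        exact hnot (z i) (hoc.out hx hy ⟨(not_le.1 hcon).le, hyi.1.le⟩) ((hmem _).2 ⟨i, hi.le, rfl⟩)
      · by_contra hcon
        exact hnot (z (i+1)) (hoc.out hy hx ⟨hyi.2.le, (not_le.1 hcon).le⟩)
          ((hmem _).2 ⟨i+1, hi, rfl⟩)
    have hw : ρ (z i) ≤ ρ (z (i + 1)) := hρ (hzI _ hi.le) (hzI _ hi) (hz i hi).le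
    rcases hw.eq_or_lt with h | h
    · right
      refine ⟨ρ (z i), fun x hx => ?_⟩
      rw [h2 i hi x (hJi x hx)]; simp [h]
    · left
      intro u hu v hv huv
      rw [h2 i hi u (hJi u hu), h2 i hi v (hJi v hv)]
      have : (u - z i) / (z (i + 1) - z i) < (v - z i) / (z (i + 1) - z i) := by gcongr
      have := mul_lt_mul_of_pos_left this (sub_pos.2 h)
      linarith

/-- The rounding map. -/
lemma exists_round {a b : ℝ} {E : Set ℝ} (hE : E.Finite) (ha : a ∈ E) (hb : b ∈ E)
    (δ : ℝ) (hδ : 0 < δ) :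
    ∃ ρ : ℝ → ℝ, MonotoneOn ρ (Icc a b) ∧ (∀ y ∈ Icc a b, SamePos E y (ρ y)) ∧
      (∀ y ∈ Icc a b, |y - ρ y| ≤ δ) ∧ (ρ '' Icc a b).Finite := by
  have hlo : ∀ y : ℝ, ∃ l, y ∈ Icc a b → (l ∈ E ∧ l ≤ y ∧ ∀ e ∈ E, e ≤ y → e ≤ l) := by
    intro y
    by_cases hy : y ∈ Icc a b
    · obtain ⟨l, hl, hmax⟩ := Set.exists_max_image (E ∩ Iic y) id (hE.inter_of_left _)
        ⟨a, ha, hy.1⟩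
      exact ⟨l, fun _ => ⟨hl.1, hl.2, fun e he hey => hmax e ⟨he, hey⟩⟩⟩
    · exact ⟨0, fun h => absurd h hy⟩
  have hhi : ∀ y : ℝ, ∃ l, y ∈ Icc a b → (l ∈ E ∧ y ≤ l ∧ ∀ e ∈ E, y ≤ e → l ≤ e) := by
    intro y
    by_cases hy : y ∈ Icc a b
    · obtain ⟨l, hl, hmin⟩ := Set.exists_min_image (E ∩ Ici y) id (hE.inter_of_left _)
        ⟨b, hb, hy.2⟩
      exact ⟨l, fun _ => ⟨hl.1, hl.2, fun e he hey => hmin e ⟨he, hey⟩⟩⟩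
    · exact ⟨0, fun h => absurd h hy⟩
  choose lo hlo using hlo
  choose hi hhi using hhi
  let L : ℝ → ℝ := fun y => max (lo y) (δ * ⌊y / δ⌋)
  let H : ℝ → ℝ := fun y => min (hi y) (δ * ⌈y / δ⌉)
  have hfl : ∀ y : ℝ, δ * ⌊y / δ⌋ ≤ y ∧ y - δ ≤ δ * ⌊y / δ⌋ := by
    intro y
    have h1 := Int.floor_le (y / δ)
    have h2 := (Int.lt_floor_add_one (y / δ)).le
    rw [le_div_iff₀ hδ] at h1
    rw [div_le_iff₀ hδ] at h2
    constructor <;> linarith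
  have hce : ∀ y : ℝ, y ≤ δ * ⌈y / δ⌉ ∧ δ * ⌈y / δ⌉ ≤ y + δ := by
    intro y
    have h1 := Int.le_ceil (y / δ)
    have h2 := (Int.ceil_lt_add_one (y / δ)).le
    rw [div_le_iff₀ hδ] at h1
    have h3 : δ * ⌈y / δ⌉ ≤ δ * (y / δ + 1) := by gcongr
    have h4 : δ * (y / δ + 1) = y + δ := by field_simp
    constructor <;> linarith
  have hL : ∀ y ∈ Icc a b, L y ≤ y ∧ y - δ ≤ L y := fun y hy =>
    ⟨max_le (hlo y hy).2.1 (hfl y).1, (hfl y).2.trans (le_max_right _ _)⟩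
  have hH : ∀ y ∈ Icc a b, y ≤ H y ∧ H y ≤ y + δ := fun y hy =>
    ⟨le_min (hhi y hy).2.1 (hce y).1, (min_le_right _ _).trans (hce y).2⟩
  refine ⟨fun y => (L y + H y) / 2, ?_, ?_, ?_, ?_⟩
  · intro x hx y hy hxy
    have h1 : L x ≤ L y := by
      have : x / δ ≤ y / δ := by gcongr
      apply max_le_max
      · exact (hlo y hy).2.2 _ (hlo x hx).1 ((hlo x hx).2.1.trans hxy)
      · gcongr
    have h2 : H x ≤ H y := by
      have : x / δ ≤ y / δ := by gcongr
      apply min_le_min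
      · exact (hhi x hx).2.2 _ (hhi y hy).1 (hxy.trans (hhi y hy).2.1)
      · gcongr
    simp only
    linarith
  · intro y hy e he
    have h1 := hL y hy
    have h2 := hH y hy
    have h3 : e ≤ y → e ≤ L y := fun h => ((hlo y hy).2.2 e he h).trans (le_max_left _ _)
    have h4 : y ≤ e → H y ≤ e := fun h => (min_le_left _ _).trans ((hhi y hy).2.2 e he h)
    simp only
    constructor
    · refine ⟨fun h => ?_, fun h => ?_⟩
      · have := h4 h.le; linarith
      · by_contra hcon
        have := h3 (not_lt.1 hcon); linarith
    · refine ⟨fun h => ?_, fun h => ?_⟩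
      · have := h3 h.le; linarith
      · by_contra hcon
        have := h4 (not_lt.1 hcon); linarith
  · intro y hy
    have h1 := hL y hy
    have h2 := hH y hy
    rw [abs_le]
    constructor <;> simp only <;> linarith
  · have fin1 : (E ∪ (fun k : ℤ => δ * (k : ℝ)) '' Icc ⌊a / δ⌋ ⌈b / δ⌉).Finite :=
      hE.union ((Set.finite_Icc _ _).image _)
    apply (Set.Finite.image2 (fun u v : ℝ => (u + v) / 2) fin1 fin1).subset
    rintro _ ⟨y, hy, rfl⟩
    have e1 : a / δ ≤ y / δ := by have := hy.1; gcongr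
    have e2 : y / δ ≤ b / δ := by have := hy.2; gcongr
    refine ⟨L y, ?_, H y, ?_, rfl⟩
    · rcases max_choice (lo y) (δ * (⌊y / δ⌋ : ℝ)) with h | h
      · left; simp only [L]; rw [h]; exact (hlo y hy).1
      · right; simp only [L]; rw [h]
        exact ⟨_, ⟨Int.floor_mono e1, (Int.floor_mono e2).trans (Int.floor_le_ceil _)⟩, rfl⟩
    · rcases min_choice (hi y) (δ * (⌈y / δ⌉ : ℝ)) with h | h
      · left; simp only [H]; rw [h]; exact (hhi y hy).1
      · right; simp only [H]; rw [h]
        exact ⟨_, ⟨(Int.floor_le_ceil _).trans (Int.ceil_mono e1), Int.ceil_mono e2⟩, rfl⟩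

/-- Piecewise strictly monotone self-maps of `[a,b]`. -/
structure PW (a b : ℝ) (f : ℝ → ℝ) (m : ℕ) (t : ℕ → ℝ) : Prop where
  hab : a < b
  hf : MapsTo f (Icc a b) (Icc a b)
  hm : 0 < m
  ht0 : t 0 = a
  htm : t m = b
  htlt : ∀ i < m, t i < t (i + 1)
  hlap : ∀ i < m, ContinuousOn f (Ioo (t i) (t (i + 1))) ∧
      (StrictMonoOn f (Ioo (t i) (t (i + 1))) ∨ StrictAntiOn f (Ioo (t i) (t (i + 1))))

/-- The breakpoints. -/
def TS (m : ℕ) (t : ℕ → ℝ) : Set ℝ := t '' Iic m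

/-- The filtration of essential points. -/
def ES (a b : ℝ) (f : ℝ → ℝ) (m : ℕ) (t : ℕ → ℝ) (n : ℕ) : ℕ → Set ℝ
  | 0 => ⋃ j ∈ Iic n, f^[j] '' TS m t
  | j + 1 => ES a b f m t n j ∪ {x ∈ Icc a b | f x ∈ ES a b f m t n j}

namespace PW

variable {a b : ℝ} {f : ℝ → ℝ} {m : ℕ} {t : ℕ → ℝ}

lemma T_sub (h : PW a b f m t) : TS m t ⊆ Icc a b := by
  rintro _ ⟨i, hi, rfl⟩
  have hi' : i ≤ m := hi
  constructor
  · rw [← h.ht0]; exact steps_le h.htlt 0 i (by omega) hi'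
  · rw [← h.htm]; exact steps_le h.htlt i m hi' le_rfl

lemma T_fin : (TS m t).Finite := (Set.finite_Iic m).image t

lemma a_mem (h : PW a b f m t) : a ∈ TS m t := ⟨0, Nat.zero_le _, h.ht0⟩

lemma b_mem (h : PW a b f m t) : b ∈ TS m t := ⟨m, le_refl m, h.htm⟩

lemma iter_mem (h : PW a b f m t) {x : ℝ} (hx : x ∈ Icc a b) (k : ℕ) : f^[k] x ∈ Icc a b :=
  h.hf.iterate k hx

lemma lap_sub (h : PW a b f m t) {i : ℕ} (hi : i < m) : Ioo (t i) (t (i + 1)) ⊆ Icc a b := by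
  intro x hx
  have h1 := h.T_sub ⟨i, hi.le, rfl⟩
  have h2 := h.T_sub ⟨i + 1, hi, rfl⟩
  exact ⟨h1.1.trans hx.1.le, hx.2.le.trans h2.2⟩

lemma lap_not_T (h : PW a b f m t) {i : ℕ} (hi : i < m) {x : ℝ}
    (hx : x ∈ Ioo (t i) (t (i + 1))) : x ∉ TS m t := by
  rintro ⟨j, hj, rfl⟩
  by_cases hji : j ≤ i
  · have := steps_le h.htlt j i hji hi.le
    linarith [hx.1]
  · have := steps_le h.htlt (i + 1) j (by omega) hj
    linarith [hx.2]

lemma find_lap (h : PW a b f m t) {x : ℝ} (hx : x ∈ Icc a b) (hT : x ∉ TS m t) :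
    ∃ i < m, x ∈ Ioo (t i) (t (i + 1)) := by
  apply find_gap x m (by rw [h.ht0, h.htm]; exact hx)
  intro i hi he
  exact hT ⟨i, hi, he.symm⟩

lemma contAt (h : PW a b f m t) {x : ℝ} (hx : x ∈ Icc a b) (hT : x ∉ TS m t) :
    ContinuousAt f x := by
  obtain ⟨i, hi, hxi⟩ := h.find_lap hx hT
  exact (h.hlap i hi).1.continuousAt (isOpen_Ioo.mem_nhds hxi)

lemma injOn (h : PW a b f m t) {i : ℕ} (hi : i < m) : InjOn f (Ioo (t i) (t (i + 1))) := by
  rcases (h.hlap i hi).2 with h1 | h1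
  · exact h1.injOn
  · exact h1.injOn

lemma preimage_fin (h : PW a b f m t) {A : Set ℝ} (hA : A.Finite) :
    {x ∈ Icc a b | f x ∈ A}.Finite := by
  have h1 : (⋃ i ∈ Iio m, {x ∈ Ioo (t i) (t (i + 1)) | f x ∈ A}).Finite := by
    apply (Set.finite_Iio m).biUnion
    intro i hi
    apply Set.Finite.of_finite_image (f := f)
    · apply hA.subset
      rintro _ ⟨x, hx, rfl⟩
      exact hx.2
    · exact (h.injOn hi).mono (fun x hx => hx.1)
  apply ((T_fin (m := m) (t := t)).union h1).subset
  intro x hx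
  by_cases hT : x ∈ TS m t
  · exact Or.inl hT
  · obtain ⟨i, hi, hxi⟩ := h.find_lap hx.1 hT
    right
    simp only [mem_iUnion]
    exact ⟨i, hi, hxi, hx.2⟩

lemma E_fin (h : PW a b f m t) (n j : ℕ) : (ES a b f m t n j).Finite := by
  induction j with
  | zero =>
    exact (Set.finite_Iic n).biUnion fun j _ => T_fin.image _
  | succ j ih => exact ih.union (h.preimage_fin ih)

lemma E_sub (h : PW a b f m t) (n j : ℕ) : ES a b f m t n j ⊆ Icc a b := by
  induction j with
  | zero =>
    intro x hx
    simp only [ES, mem_iUnion] at hx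
    obtain ⟨j, _, y, hy, rfl⟩ := hx
    exact h.iter_mem (h.T_sub hy) j
  | succ j ih => exact union_subset ih (fun x hx => hx.1)

lemma E_mono (n : ℕ) {i j : ℕ} (hij : i ≤ j) : ES a b f m t n i ⊆ ES a b f m t n j := by
  induction j, hij using Nat.le_induction with
  | base => exact subset_rfl
  | succ j _ ih => exact ih.trans subset_union_left

lemma orbit_mem {n j : ℕ} (hj : j ≤ n) {x : ℝ} (hx : x ∈ TS m t) (i : ℕ) :
    f^[j] x ∈ ES a b f m t n i := by
  apply E_mono n (Nat.zero_le i)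
  simp only [ES, mem_iUnion]
  exact ⟨j, hj, x, hx, rfl⟩

lemma T_E (n i : ℕ) : TS m t ⊆ ES a b f m t n i := fun x hx => by
  have := orbit_mem (a := a) (b := b) (f := f) (Nat.zero_le n) hx i
  simpa using this

lemma pre_E {n i : ℕ} {x : ℝ} (hx : x ∈ Icc a b) (hfx : f x ∈ ES a b f m t n i) :
    x ∈ ES a b f m t n (i + 1) := Or.inr ⟨hx, hfx⟩

lemma pre_iter (h : PW a b f m t) {n i : ℕ} : ∀ (j : ℕ) {x : ℝ}, x ∈ Icc a b →
    f^[j] x ∈ ES a b f m t n i → x ∈ ES a b f m t n (i + j) := by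
  intro j
  induction j with
  | zero => intro x _ hx; simpa using hx
  | succ j ih =>
    intro x hx hfx
    rw [Function.iterate_succ_apply] at hfx
    exact pre_E hx (ih (h.hf hx) hfx)

lemma step_aux (h : PW a b f m t) {n j : ℕ} {x y : ℝ} (hx : x ∈ Icc a b) (hy : y ∈ Icc a b)
    (hxy : x < y) (hp : SamePos (ES a b f m t n (j + 1)) x y) :
    SamePos (ES a b f m t n j) (f x) (f y) := by
  have hsub : Icc x y ⊆ Icc a b := Icc_subset_Icc hx.1 hy.2
  have hmiss : ∀ e ∈ Icc x y, e ∉ ES a b f m t n (j + 1) := by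
    intro e he heE
    have h1 := hp e heE
    rcases he.1.eq_or_lt with h2 | h2
    · subst h2; exact lt_irrefl _ (h1.2.2 hxy)
    · exact absurd (h1.1.1 h2) (not_lt.2 he.2)
  have hc : ContinuousOn f (uIcc x y) := by
    rw [uIcc_of_le hxy.le]
    intro z hz
    exact (h.contAt (hsub hz) (fun hT => hmiss z hz (T_E n _ hT))).continuousWithinAt
  have hiv := intermediate_value_uIcc hc
  have hno : ∀ e ∈ ES a b f m t n j, e ∉ uIcc (f x) (f y) := by
    intro e he hmem
    obtain ⟨z, hz, rfl⟩ := hiv hmem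
    rw [uIcc_of_le hxy.le] at hz
    exact hmiss z hz (pre_E (hsub hz) he)
  intro e he
  have := hno e he
  rw [mem_uIcc] at this
  push Not at this
  obtain ⟨h1, h2⟩ := this
  constructor
  · constructor
    · intro h3; by_contra h4
      exact absurd (h1 h3.le) (h4)
    · intro h3; by_contra h4
      exact absurd (h2 h3.le) (h4)
  · constructor
    · intro h3; by_contra h4
      exact absurd (h2 (not_lt.1 h4)) (not_lt.2 h3.le)
    · intro h3; by_contra h4
      exact absurd (h1 (not_lt.1 h4)) (not_lt.2 h3.le)

lemma step (h : PW a b f m t) {n j : ℕ} {x y : ℝ} (hx : x ∈ Icc a b) (hy : y ∈ Icc a b)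
    (hp : SamePos (ES a b f m t n (j + 1)) x y) :
    SamePos (ES a b f m t n j) (f x) (f y) := by
  rcases lt_trichotomy x y with h1 | h1 | h1
  · exact h.step_aux hx hy h1 hp
  · subst h1; exact fun e _ => ⟨Iff.rfl, Iff.rfl⟩
  · exact (h.step_aux hy hx h1 hp.symm).symm

lemma step_iter (h : PW a b f m t) {n : ℕ} {x y : ℝ} (hx : x ∈ Icc a b) (hy : y ∈ Icc a b) :
    ∀ (k j : ℕ), SamePos (ES a b f m t n (j + k)) x y →
    SamePos (ES a b f m t n j) (f^[k] x) (f^[k] y) := by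
  intro k
  induction k with
  | zero => intro j hp; simpa using hp
  | succ k ih =>
    intro j hp
    rw [Function.iterate_succ_apply', Function.iterate_succ_apply']
    apply h.step (h.iter_mem hx k) (h.iter_mem hy k)
    apply ih
    convert hp using 2
    omega

lemma lap_of_samePos {i : ℕ} (hi : i < m) {x y : ℝ} (hp : SamePos (TS m t) x y)
    (hx : x ∈ Ioo (t i) (t (i + 1))) : y ∈ Ioo (t i) (t (i + 1)) :=
  ⟨(hp _ ⟨i, hi.le, rfl⟩).2.1 hx.1, (hp _ ⟨i + 1, hi, rfl⟩).1.1 hx.2⟩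

end PW

/-- Directed points of `[a,b]`. -/
def Dir (a b x : ℝ) (l : Filter ℝ) : Prop :=
  (a ≤ x ∧ x < b ∧ l = 𝓝[>] x) ∨ (a < x ∧ x ≤ b ∧ l = 𝓝[<] x)

namespace Dir
variable {a b x : ℝ} {l : Filter ℝ}

lemma neBot (h : Dir a b x l) : l.NeBot := by
  rcases h with ⟨_, _, rfl⟩ | ⟨_, _, rfl⟩ <;> infer_instance

lemma le_nhds (h : Dir a b x l) : l ≤ 𝓝 x := by
  rcases h with ⟨_, _, rfl⟩ | ⟨_, _, rfl⟩ <;> exact nhdsWithin_le_nhds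

lemma mem (h : Dir a b x l) : x ∈ Icc a b := by
  rcases h with ⟨h1, h2, rfl⟩ | ⟨h1, h2, rfl⟩
  · exact ⟨h1, h2.le⟩
  · exact ⟨h1.le, h2⟩

lemma ev_mem (h : Dir a b x l) : ∀ᶠ z in l, z ∈ Icc a b := by
  rcases h with ⟨h1, h2, rfl⟩ | ⟨h1, h2, rfl⟩
  · filter_upwards [Ioo_mem_nhdsGT h2] with z hz
    exact ⟨h1.trans hz.1.le, hz.2.le⟩
  · filter_upwards [Ioo_mem_nhdsLT h1] with z hz
    exact ⟨hz.1.le, hz.2.le.trans h2⟩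

end Dir

namespace PW
variable {a b : ℝ} {f : ℝ → ℝ} {m : ℕ} {t : ℕ → ℝ}

/-- A right germ is eventually in one lap. -/
lemma lap_right (h : PW a b f m t) {x : ℝ} (h1 : a ≤ x) (h2 : x < b) :
    ∃ i < m, t i ≤ x ∧ x < t (i + 1) := by
  by_cases hT : x ∈ TS m t
  · obtain ⟨i, hi, rfl⟩ := hT
    have hi' : i ≤ m := hi
    have : i < m := by
      rcases hi'.eq_or_lt with h3 | h3
      · subst h3; rw [h.htm] at h2; exact absurd h2 (lt_irrefl _)
      · exact h3
    exact ⟨i, this, le_rfl, h.htlt i this⟩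
  · obtain ⟨i, hi, hx⟩ := h.find_lap ⟨h1, h2.le⟩ hT
    exact ⟨i, hi, hx.1.le, hx.2⟩

lemma lap_left (h : PW a b f m t) {x : ℝ} (h1 : a < x) (h2 : x ≤ b) :
    ∃ i < m, t i < x ∧ x ≤ t (i + 1) := by
  by_cases hT : x ∈ TS m t
  · obtain ⟨i, hi, rfl⟩ := hT
    have hi' : i ≤ m := hi
    obtain _ | i := i
    · rw [h.ht0] at h1; exact absurd h1 (lt_irrefl _)
    exact ⟨i, hi', h.htlt i hi', le_rfl⟩
  · obtain ⟨i, hi, hx⟩ := h.find_lap ⟨h1.le, h2⟩ hT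
    exact ⟨i, hi, hx.1, hx.2.le⟩

lemma lap_dir (h : PW a b f m t) {x : ℝ} {l : Filter ℝ} (hd : Dir a b x l) :
    ∃ i < m, ∀ᶠ z in l, z ∈ Ioo (t i) (t (i + 1)) := by
  rcases hd with ⟨h1, h2, rfl⟩ | ⟨h1, h2, rfl⟩
  · obtain ⟨i, hi, h3, h4⟩ := h.lap_right h1 h2
    refine ⟨i, hi, ?_⟩
    filter_upwards [Ioo_mem_nhdsGT h4] with z hz
    exact ⟨h3.trans_lt hz.1, hz.2⟩
  · obtain ⟨i, hi, h3, h4⟩ := h.lap_left h1 h2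
    refine ⟨i, hi, ?_⟩
    filter_upwards [Ioo_mem_nhdsLT h3] with z hz
    exact ⟨hz.1, hz.2.trans_le h4⟩

/-- An injective-type germ with a limit and a strict side is a directed germ. -/
lemma dir_gt (h : PW a b f m t) {x y : ℝ} {l : Filter ℝ} (hd : Dir a b x l)
    (ht : Tendsto f l (𝓝 y)) (hs : ∀ᶠ z in l, y < f z) :
    ∃ y l', Dir a b y l' ∧ Tendsto f l l' := by
  have := hd.neBot
  have hI : ∀ᶠ z in l, f z ∈ Icc a b := hd.ev_mem.mono (fun z hz => h.hf hz)
  have hy : y ∈ Icc a b := isClosed_Icc.mem_of_tendsto ht hI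
  obtain ⟨z, hz1, hz2⟩ := (hI.and hs).exists
  exact ⟨y, 𝓝[>] y, Or.inl ⟨hy.1, hz2.trans_le hz1.2, rfl⟩,
    tendsto_nhdsWithin_iff.2 ⟨ht, hs⟩⟩

lemma dir_lt (h : PW a b f m t) {x y : ℝ} {l : Filter ℝ} (hd : Dir a b x l)
    (ht : Tendsto f l (𝓝 y)) (hs : ∀ᶠ z in l, f z < y) :
    ∃ y l', Dir a b y l' ∧ Tendsto f l l' := by
  have := hd.neBot
  have hI : ∀ᶠ z in l, f z ∈ Icc a b := hd.ev_mem.mono (fun z hz => h.hf hz)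
  have hy : y ∈ Icc a b := isClosed_Icc.mem_of_tendsto ht hI
  obtain ⟨z, hz1, hz2⟩ := (hI.and hs).exists
  exact ⟨y, 𝓝[<] y, Or.inr ⟨hz1.1.trans_lt hz2, hy.2, rfl⟩,
    tendsto_nhdsWithin_iff.2 ⟨ht, hs⟩⟩

lemma dir_exists (h : PW a b f m t) {x : ℝ} {l : Filter ℝ} (hd : Dir a b x l) :
    ∃ y l', Dir a b y l' ∧ Tendsto f l l' := by
  have hd' := hd
  rcases hd with ⟨h1, h2, rfl⟩ | ⟨h1, h2, rfl⟩
  · obtain ⟨i, hi, h3, h4⟩ := h.lap_right h1 h2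
    have hsub : Ioo x (t (i + 1)) ⊆ Ioo (t i) (t (i + 1)) := Ioo_subset_Ioo_left h3
    have hbI : f '' Ioo x (t (i + 1)) ⊆ Icc a b := by
      rintro _ ⟨z, hz, rfl⟩; exact h.hf (h.lap_sub hi (hsub hz))
    have hbb : BddBelow (f '' Ioo x (t (i + 1))) := bddBelow_Icc.mono hbI
    have hba : BddAbove (f '' Ioo x (t (i + 1))) := bddAbove_Icc.mono hbI
    rcases (h.hlap i hi).2 with hm | hm
    · have hm' := hm.mono hsub
      refine h.dir_gt hd' (hm'.monotoneOn.tendsto_nhdsWithin_Ioo_right (nonempty_Ioo.2 h4) hbb) ?_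
      filter_upwards [Ioo_mem_nhdsGT h4] with z hz
      obtain ⟨u, hu⟩ := exists_between hz.1
      have hu' : u ∈ Ioo x (t (i + 1)) := ⟨hu.1, hu.2.trans hz.2⟩
      exact (csInf_le hbb ⟨u, hu', rfl⟩).trans_lt (hm' hu' hz hu.2)
    · have hm' := hm.mono hsub
      refine h.dir_lt hd' (hm'.antitoneOn.tendsto_nhdsWithin_Ioo_right (nonempty_Ioo.2 h4) hba) ?_
      filter_upwards [Ioo_mem_nhdsGT h4] with z hz
      obtain ⟨u, hu⟩ := exists_between hz.1
      have hu' : u ∈ Ioo x (t (i + 1)) := ⟨hu.1, hu.2.trans hz.2⟩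
      exact (hm' hu' hz hu.2).trans_le (le_csSup hba ⟨u, hu', rfl⟩)
  · obtain ⟨i, hi, h3, h4⟩ := h.lap_left h1 h2
    have hsub : Ioo (t i) x ⊆ Ioo (t i) (t (i + 1)) := Ioo_subset_Ioo_right h4
    have hbI : f '' Ioo (t i) x ⊆ Icc a b := by
      rintro _ ⟨z, hz, rfl⟩; exact h.hf (h.lap_sub hi (hsub hz))
    have hbb : BddBelow (f '' Ioo (t i) x) := bddBelow_Icc.mono hbI
    have hba : BddAbove (f '' Ioo (t i) x) := bddAbove_Icc.mono hbI
    rcases (h.hlap i hi).2 with hm | hm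
    · have hm' := hm.mono hsub
      refine h.dir_lt hd' (hm'.monotoneOn.tendsto_nhdsWithin_Ioo_left (nonempty_Ioo.2 h3) hba) ?_
      filter_upwards [Ioo_mem_nhdsLT h3] with z hz
      obtain ⟨u, hu⟩ := exists_between hz.2
      have hu' : u ∈ Ioo (t i) x := ⟨hz.1.trans hu.1, hu.2⟩
      exact (hm' hz hu' hu.1).trans_le (le_csSup hba ⟨u, hu', rfl⟩)
    · have hm' := hm.mono hsub
      refine h.dir_gt hd' (hm'.antitoneOn.tendsto_nhdsWithin_Ioo_left (nonempty_Ioo.2 h3) hbb) ?_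
      filter_upwards [Ioo_mem_nhdsLT h3] with z hz
      obtain ⟨u, hu⟩ := exists_between hz.2
      have hu' : u ∈ Ioo (t i) x := ⟨hz.1.trans hu.1, hu.2⟩
      exact (csInf_le hbb ⟨u, hu', rfl⟩).trans_lt (hm' hz hu' hu.1)

lemma dir_iter (h : PW a b f m t) {x : ℝ} {l : Filter ℝ} (hd : Dir a b x l) (k : ℕ) :
    ∃ y l', Dir a b y l' ∧ Tendsto (f^[k]) l l' := by
  induction k with
  | zero => exact ⟨x, l, hd, tendsto_id⟩
  | succ k ih =>
    obtain ⟨y, l', hd', ht⟩ := ih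
    obtain ⟨y2, l2, hd2, ht2⟩ := h.dir_exists hd'
    refine ⟨y2, l2, hd2, ?_⟩
    rw [Function.iterate_succ']
    exact ht2.comp ht

end PW

/-- The properties of the approximating map that matter for the dynamics. -/
structure Approx (a b : ℝ) (f : ℝ → ℝ) (m : ℕ) (t : ℕ → ℝ) (n : ℕ) (g : ℝ → ℝ) : Prop where
  maps : MapsTo g (Icc a b) (Icc a b)
  pos : ∀ x ∈ Icc a b, SamePos (ES a b f m t n n) (f x) (g x)
  lap : ∀ i < m, ContinuousOn g (Ioo (t i) (t (i + 1))) ∧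
    ((StrictMonoOn f (Ioo (t i) (t (i + 1))) ∧ MonotoneOn g (Ioo (t i) (t (i + 1)))) ∨
     (StrictAntiOn f (Ioo (t i) (t (i + 1))) ∧ AntitoneOn g (Ioo (t i) (t (i + 1)))))
  lim : ∀ x l, Dir a b x l → ∀ e ∈ ES a b f m t n n, Tendsto f l (𝓝 e) → Tendsto g l (𝓝 e)

namespace Approx
variable {a b : ℝ} {f g : ℝ → ℝ} {m n : ℕ} {t : ℕ → ℝ}

lemma iter_pos (h : PW a b f m t) (H : Approx a b f m t n g) {x : ℝ} (hx : x ∈ Icc a b) :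
    ∀ k j, j + k = n → SamePos (ES a b f m t n j) (f^[k] x) (g^[k] x) := by
  intro k
  induction k with
  | zero => intro j _ e _; exact ⟨Iff.rfl, Iff.rfl⟩
  | succ k ih =>
    intro j hj
    rw [Function.iterate_succ_apply', Function.iterate_succ_apply']
    have hg : g^[k] x ∈ Icc a b := H.maps.iterate k hx
    have h1 := h.step (h.iter_mem hx k) hg (ih (j + 1) (by omega))
    exact h1.trans ((H.pos _ hg).mono (PW.E_mono n (by omega)))

lemma iter_pos' (h : PW a b f m t) (H : Approx a b f m t n g) {x : ℝ} (hx : x ∈ Icc a b)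
    {k : ℕ} (hk : k ≤ n) : SamePos (ES a b f m t n 0) (f^[k] x) (g^[k] x) :=
  (iter_pos h H hx k (n - k) (by omega)).mono (PW.E_mono n (Nat.zero_le _))

lemma mono_aux (H : Approx a b f m t n g) : ∀ (k : ℕ) (x y : ℝ),
    (∀ j < k, ∃ i < m, f^[j] x ∈ Ioo (t i) (t (i + 1)) ∧ f^[j] y ∈ Ioo (t i) (t (i + 1)) ∧
      g^[j] x ∈ Ioo (t i) (t (i + 1)) ∧ g^[j] y ∈ Ioo (t i) (t (i + 1))) →
    f^[k] x ≤ f^[k] y → g^[k] x ≤ g^[k] y := by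
  intro k
  induction k with
  | zero => intro x y _ h; exact h
  | succ k ih =>
    intro x y hj hle
    obtain ⟨i, hi, h1, h2, h3, h4⟩ := hj k (by omega)
    rw [Function.iterate_succ_apply', Function.iterate_succ_apply'] at hle ⊢
    rcases (H.lap i hi).2 with ⟨hf, hg⟩ | ⟨hf, hg⟩
    · exact hg h3 h4 (ih x y (fun j hjk => hj j (by omega)) ((hf.le_iff_le h1 h2).1 hle))
    · refine hg h4 h3 (ih y x (fun j hjk => ?_) ((hf.le_iff_ge h1 h2).1 hle))
      obtain ⟨i, hi, h1, h2, h3, h4⟩ := hj j (by omega)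
      exact ⟨i, hi, h2, h1, h4, h3⟩

lemma mono_pair (h : PW a b f m t) (H : Approx a b f m t n g) {x y : ℝ} (hx : x ∈ Icc a b)
    (hy : y ∈ Icc a b) (hp : SamePos (ES a b f m t n n) x y) (hxE : x ∉ ES a b f m t n n)
    {k : ℕ} (hk : k ≤ n) (hle : f^[k] x ≤ f^[k] y) : g^[k] x ≤ g^[k] y := by
  refine mono_aux H k x y (fun j hj => ?_) hle
  have hnT : f^[j] x ∉ TS m t := by
    intro hT
    have := h.pre_iter (n := n) (i := 0) j hx (PW.T_E n 0 hT)
    exact hxE (PW.E_mono n (by omega) this)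
  obtain ⟨i, hi, hxi⟩ := h.find_lap (h.iter_mem hx j) hnT
  have hT0 : TS m t ⊆ ES a b f m t n 0 := PW.T_E n 0
  have p1 : SamePos (TS m t) (f^[j] x) (f^[j] y) :=
    (h.step_iter hx hy j 0 (hp.mono (PW.E_mono n (by omega)))).mono hT0
  have p2 := (iter_pos' h H hx (k := j) (by omega)).mono hT0
  have p3 := (iter_pos' h H hy (k := j) (by omega)).mono hT0
  have hyi := PW.lap_of_samePos hi p1 hxi
  exact ⟨i, hi, hxi, hyi, PW.lap_of_samePos hi p2 hxi, PW.lap_of_samePos hi p3 hyi⟩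

lemma iter_lim (h : PW a b f m t) (H : Approx a b f m t n g) {x : ℝ} {l : Filter ℝ}
    (hd : Dir a b x l) : ∀ k j, j + k = n → ∀ e ∈ ES a b f m t n j,
    Tendsto (f^[k]) l (𝓝 e) → Tendsto (g^[k]) l (𝓝 e) := by
  have := hd.neBot
  intro k
  induction k with
  | zero => intro j _ e _ ht; exact ht
  | succ k ih =>
    intro j hj e he ht
    obtain ⟨y, l', hd', ht'⟩ := h.dir_iter hd k
    obtain ⟨y2, l2, hd2, ht2⟩ := h.dir_exists hd'
    have hye : Tendsto f l' (𝓝 e) := by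
      have h1 : Tendsto (f^[k+1]) l (𝓝 y2) := by
        rw [Function.iterate_succ']; exact (ht2.comp ht').mono_right hd2.le_nhds
      rw [tendsto_nhds_unique ht h1]
      exact ht2.mono_right hd2.le_nhds
    have := hd'.neBot
    have hyE : y ∈ ES a b f m t n (j + 1) := by
      by_cases hT : y ∈ TS m t
      · exact PW.T_E n _ hT
      · have h1 : Tendsto f l' (𝓝 (f y)) := (h.contAt hd'.mem hT).tendsto.mono_left hd'.le_nhds
        rw [tendsto_nhds_unique hye h1] at he
        exact PW.pre_E hd'.mem he
    have hgy : Tendsto (g^[k]) l (𝓝 y) := ih (j + 1) (by omega) y hyE (ht'.mono_right hd'.le_nhds)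
    have hgl : Tendsto (g^[k]) l l' := by
      have hpos : ∀ᶠ z in l, SamePos (ES a b f m t n (j + 1)) (f^[k] z) (g^[k] z) :=
        hd.ev_mem.mono (fun z hz => iter_pos h H hz k (j + 1) (by omega))
      rcases hd' with ⟨_, _, rfl⟩ | ⟨_, _, rfl⟩
      · refine tendsto_nhdsWithin_iff.2 ⟨hgy, ?_⟩
        filter_upwards [hpos, (tendsto_nhdsWithin_iff.1 ht').2] with z hz hz'
        exact (hz y hyE).2.1 hz'
      · refine tendsto_nhdsWithin_iff.2 ⟨hgy, ?_⟩
        filter_upwards [hpos, (tendsto_nhdsWithin_iff.1 ht').2] with z hz hz'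
        exact (hz y hyE).1.1 hz'
    rw [Function.iterate_succ']
    exact (H.lim y l' hd' e (PW.E_mono n (by omega) he) hye).comp hgl

lemma contAt_iter (h : PW a b f m t) (H : Approx a b f m t n g) {x : ℝ} (hx : x ∈ Ioo a b)
    {k : ℕ} (hk : k ≤ n) (hc : ContinuousAt (f^[k]) x) : ContinuousAt (g^[k]) x := by
  have hxI : x ∈ Icc a b := Ioo_subset_Icc_self hx
  by_cases hex : ∃ j < k, f^[j] x ∈ TS m t
  · obtain ⟨j, hj, hT⟩ := hex
    have he0 : f^[k] x ∈ ES a b f m t n 0 := by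
      have : f^[k] x = f^[k - j] (f^[j] x) := by
        rw [← Function.iterate_add_apply]; congr 2; omega
      rw [this]
      exact PW.orbit_mem (by omega) hT 0
    have heq : f^[k] x = g^[k] x := (iter_pos' h H hxI hk).eq he0
    have heE := PW.E_mono n (Nat.zero_le (n - k)) he0
    rw [continuousAt_iff_continuous_left'_right']
    constructor
    · have := iter_lim h H (l := 𝓝[<] x) (Or.inr ⟨hx.1, hx.2.le, rfl⟩) k (n - k) (by omega)
        _ heE (hc.tendsto.mono_left nhdsWithin_le_nhds)
      rw [heq] at this
      exact this
    · have := iter_lim h H (l := 𝓝[>] x) (Or.inl ⟨hx.1.le, hx.2, rfl⟩) k (n - k) (by omega)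
        _ heE (hc.tendsto.mono_left nhdsWithin_le_nhds)
      rw [heq] at this
      exact this
  · push Not at hex
    have : ∀ j ≤ k, ContinuousAt (g^[j]) x := by
      intro j
      induction j with
      | zero => intro _; exact continuousAt_id
      | succ j ih =>
        intro hj
        rw [Function.iterate_succ']
        refine ContinuousAt.comp ?_ (ih (by omega))
        obtain ⟨i, hi, hxi⟩ := h.find_lap (h.iter_mem hxI j) (hex j hj)
        have p := (iter_pos' h H hxI (k := j) (by omega)).mono (PW.T_E n 0)
        exact (H.lap i hi).1.continuousAt (isOpen_Ioo.mem_nhds (PW.lap_of_samePos hi p hxi))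
    exact this k le_rfl

end Approx

lemma mono_of_local {c d : ℝ} {h : ℝ → ℝ} (hc : ContinuousOn h (Ioo c d))
    (hl : ∀ y ∈ Ioo c d, ∃ y' > y, ∀ u v, y < u → u < v → v < y' → h u ≤ h v) :
    MonotoneOn h (Ioo c d) := by
  intro x hx z hz hxz
  have hsub : Icc x z ⊆ Ioo c d := fun w hw => ⟨hx.1.trans_le hw.1, hw.2.trans_lt hz.2⟩
  have hclosed : IsClosed ({w | h x ≤ h w} ∩ Icc x z) := by
    have := (hc.mono hsub).preimage_isClosed_of_isClosed isClosed_Icc (isClosed_Ici (a := h x))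
    rw [inter_comm]
    exact this
  have := hclosed.Icc_subset_of_forall_exists_gt (show x ∈ {w | h x ≤ h w} from le_refl (h x)) (by
    rintro y ⟨hy1, hy2⟩ w hw
    have hyI : y ∈ Ioo c d := hsub (Ico_subset_Icc_self hy2)
    obtain ⟨y', hy', hmono⟩ := hl y hyI
    have hw' : y < min w y' := lt_min hw hy'
    obtain ⟨v, hv1, hv2⟩ := exists_between hw'
    refine ⟨v, ?_, hv1, (hv2.le.trans (min_le_left _ _))⟩
    have hle : h y ≤ h v := by
      have ht : Tendsto h (𝓝[>] y) (𝓝 (h y)) :=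
        (hc.continuousAt (isOpen_Ioo.mem_nhds hyI)).tendsto.mono_left nhdsWithin_le_nhds
      refine le_of_tendsto ht ?_
      filter_upwards [Ioo_mem_nhdsGT hv1] with u hu
      exact hmono u v hu.1 hu.2 (hv2.trans_le (min_le_right _ _))
    exact le_trans (show h x ≤ h y from hy1) hle)
  exact this ⟨hxz, le_rfl⟩

lemma right_free {E : Set ℝ} (hE : E.Finite) {y d : ℝ} (hyd : y < d) :
    ∃ y' > y, y' ≤ d ∧ ∀ u ∈ Ioo y y', u ∉ E := by
  have h1 : (E \ {y})ᶜ ∈ 𝓝[>] y := nhdsWithin_le_nhds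
    ((hE.subset sdiff_subset).isClosed.isOpen_compl.mem_nhds (by simp))
  obtain ⟨y', hy', hsub⟩ := (mem_nhdsGT_iff_exists_Ioo_subset' hyd).1 h1
  refine ⟨min y' d, lt_min hy' hyd, min_le_right _ _, fun u hu huE => ?_⟩
  exact hsub ⟨hu.1, hu.2.trans_le (min_le_left _ _)⟩ ⟨huE, hu.1.ne'⟩

lemma Approx.final {a b : ℝ} {f g : ℝ → ℝ} {m n : ℕ} {t : ℕ → ℝ}
    (h : PW a b f m t) (H : Approx a b f m t n g) :
    ∀ k ≤ n, ∀ c d : ℝ, a ≤ c → c < d → d ≤ b →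
        ContinuousOn (f^[k]) (Ioo c d) →
        (MonotoneOn (f^[k]) (Ioo c d) ∨ AntitoneOn (f^[k]) (Ioo c d)) →
        ContinuousOn (g^[k]) (Ioo c d) ∧
          (MonotoneOn (g^[k]) (Ioo c d) ∨ AntitoneOn (g^[k]) (Ioo c d)) := by
  intro k hk c d hac hcd hdb hcont hmon
  have hg : ContinuousOn (g^[k]) (Ioo c d) := fun x hx =>
    (contAt_iter h H (x := x) ⟨hac.trans_lt hx.1, hx.2.trans_le hdb⟩ hk
      (hcont.continuousAt (isOpen_Ioo.mem_nhds hx))).continuousWithinAt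
  have key : ∀ y ∈ Ioo c d, ∃ y' > y, ∀ u v, y < u → u < v → v < y' →
      u ∈ Ioo c d ∧ v ∈ Ioo c d ∧ (f^[k] u ≤ f^[k] v → g^[k] u ≤ g^[k] v) ∧
      (f^[k] v ≤ f^[k] u → g^[k] v ≤ g^[k] u) := by
    intro y hy
    obtain ⟨y', hy', hy'd, hfree⟩ := right_free (h.E_fin n n) hy.2
    refine ⟨y', hy', fun u v hu huv hv => ?_⟩
    have hu' : u ∈ Ioo c d := ⟨hy.1.trans hu, by linarith⟩
    have hv' : v ∈ Ioo c d := ⟨by linarith [hy.1], by linarith⟩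
    have huI : u ∈ Icc a b := ⟨by linarith [hu'.1], by linarith [hu'.2]⟩
    have hvI : v ∈ Icc a b := ⟨by linarith [hv'.1], by linarith [hv'.2]⟩
    have huE := hfree u ⟨hu, huv.trans hv⟩
    have hvE := hfree v ⟨hu.trans huv, hv⟩
    have hp : SamePos (ES a b f m t n n) u v := by
      intro e he
      have hcase : e ≤ y ∨ y' ≤ e := by
        by_contra hcon
        push Not at hcon
        exact hfree e hcon he
      rcases hcase with h1 | h1
      · constructor <;> constructor <;> intro <;> linarith
      · constructor <;> constructor <;> intro <;> linarith
    exact ⟨hu', hv', mono_pair h H huI hvI hp huE hk, mono_pair h H hvI huI hp.symm hvE hk⟩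
  refine ⟨hg, ?_⟩
  rcases hmon with hm | hm
  · left
    refine mono_of_local hg (fun y hy => ?_)
    obtain ⟨y', hy', hh⟩ := key y hy
    refine ⟨y', hy', fun u v h1 h2 h3 => ?_⟩
    obtain ⟨hu, hv, h4, _⟩ := hh u v h1 h2 h3
    exact h4 (hm hu hv h2.le)
  · right
    have : MonotoneOn (fun x => - g^[k] x) (Ioo c d) := by
      refine mono_of_local hg.neg (fun y hy => ?_)
      obtain ⟨y', hy', hh⟩ := key y hy
      refine ⟨y', hy', fun u v h1 h2 h3 => ?_⟩
      obtain ⟨hu, hv, _, h4⟩ := hh u v h1 h2 h3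
      exact neg_le_neg (h4 (hm hu hv h2.le))
    intro u hu v hv huv
    exact neg_le_neg_iff.1 (this hu hv huv)

lemma PW.lap_unique {a b : ℝ} {f : ℝ → ℝ} {m : ℕ} {t : ℕ → ℝ} (h : PW a b f m t) {i j : ℕ}
    (hi : i < m) (hj : j < m) {x : ℝ} (hxi : x ∈ Ioo (t i) (t (i + 1)))
    (hxj : x ∈ Ioo (t j) (t (j + 1))) : i = j := by
  rcases lt_trichotomy i j with h1 | h1 | h1
  · have := steps_le h.htlt (i + 1) j h1 hj.le
    linarith [hxi.2, hxj.1]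
  · exact h1
  · have := steps_le h.htlt (j + 1) i h1 hi.le
    linarith [hxj.2, hxi.1]

/-- for a piecewise strictly monotone `f : I → I` and a positive integer `n`
there is a Markov map `g : I → I` with `sup_{x ∈ I} |f x − g x| < 1/n` such that for every
`k ≤ n` and every open subinterval `U ⊆ I` on which `f^[k]` is continuous and monotone,
the iterate `g^[k]` is continuous and monotone on `U`. -/
theorem stmt_6 {a b : ℝ} (hab : a < b) (f : ℝ → ℝ) (n : ℕ) (hn : 0 < n)
    (hf : MapsTo f (Icc a b) (Icc a b))
    (m : ℕ) (t : ℕ → ℝ) (hm : 0 < m)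
    (ht0 : t 0 = a) (htm : t m = b)
    (htlt : ∀ i < m, t i < t (i + 1))
    (hlap : ∀ i < m, ContinuousOn f (Ioo (t i) (t (i + 1))) ∧
      (StrictMonoOn f (Ioo (t i) (t (i + 1))) ∨ StrictAntiOn f (Ioo (t i) (t (i + 1))))) :
    ∃ g : ℝ → ℝ, MapsTo g (Icc a b) (Icc a b) ∧
      -- `g` is a Markov map: there is a finite invariant set
      -- `P = {a = p_0 < ⋯ < p_r = b}` with `g(P) ⊆ P`, and on each open interval
      -- between consecutive points of `P` the map `g` is either continuous and
      -- strictly monotone or constant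
      (∃ (r : ℕ) (p : ℕ → ℝ), 0 < r ∧ p 0 = a ∧ p r = b ∧
        (∀ i < r, p i < p (i + 1)) ∧
        (∀ i ≤ r, ∃ j ≤ r, g (p i) = p j) ∧
        ∀ i < r,
          (ContinuousOn g (Ioo (p i) (p (i + 1))) ∧
            (StrictMonoOn g (Ioo (p i) (p (i + 1))) ∨
              StrictAntiOn g (Ioo (p i) (p (i + 1))))) ∨
          (∃ c : ℝ, ∀ x ∈ Ioo (p i) (p (i + 1)), g x = c)) ∧
      -- `sup_{x ∈ I} |f x − g x| < 1/n`
      (∃ δ : ℝ, δ < 1 / n ∧ ∀ x ∈ Icc a b, |f x - g x| ≤ δ) ∧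
      -- `g^[k]` is continuous and monotone on every open subinterval on which
      -- `f^[k]` is continuous and monotone, for `k ≤ n`
      (∀ k ≤ n, ∀ c d : ℝ, a ≤ c → c < d → d ≤ b →
        ContinuousOn (f^[k]) (Ioo c d) →
        (MonotoneOn (f^[k]) (Ioo c d) ∨ AntitoneOn (f^[k]) (Ioo c d)) →
        ContinuousOn (g^[k]) (Ioo c d) ∧
          (MonotoneOn (g^[k]) (Ioo c d) ∨ AntitoneOn (g^[k]) (Ioo c d))) := by
  classical
  have h : PW a b f m t := ⟨hab, hf, hm, ht0, htm, htlt, hlap⟩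
  set E := ES a b f m t n n with hE
  have hEfin : E.Finite := h.E_fin n n
  have hEI : E ⊆ Icc a b := h.E_sub n n
  have hTE : TS m t ⊆ E := PW.T_E n n
  have haE : a ∈ E := hTE h.a_mem
  have hbE : b ∈ E := hTE h.b_mem
  have hn' : (0 : ℝ) < n := Nat.cast_pos.2 hn
  have hδ : (0 : ℝ) < 1 / n / 2 := by positivity
  obtain ⟨ρ, hρm, hρE, hρδ, hρfin⟩ := exists_round hEfin haE hbE (1 / n / 2) hδ
  have hρa : ρ a = a := ((hρE a ⟨le_rfl, hab.le⟩).eq haE).symm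
  have hρb : ρ b = b := ((hρE b ⟨hab.le, le_rfl⟩).eq hbE).symm
  have hρI : MapsTo ρ (Icc a b) (Icc a b) := by
    intro y hy
    constructor
    · rw [← hρa]; exact hρm ⟨le_rfl, hab.le⟩ hy hy.1
    · rw [← hρb]; exact hρm hy ⟨hab.le, le_rfl⟩ hy.2
  set P : Set ℝ := (E ∪ {x ∈ Icc a b | f x ∈ E}) ∪ ρ '' Icc a b with hP
  have hPfin : P.Finite := (hEfin.union (h.preimage_fin hEfin)).union hρfin
  have hEP : E ⊆ P := fun x hx => Or.inl (Or.inl hx)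
  have hPI : P ⊆ Icc a b := by
    rintro x ((hx | hx) | ⟨y, hy, rfl⟩)
    · exact hEI hx
    · exact hx.1
    · exact hρI hy
  let Z : ℕ → Set ℝ := fun i => E ∪ f '' (P ∩ Ioo (t i) (t (i + 1)))
  have hψ : ∀ i : ℕ, ∃ ψ : ℝ → ℝ, Continuous ψ ∧ Monotone ψ ∧ (∀ z ∈ Z i, ψ z = ρ z) ∧
      (∀ y ∈ Icc a b, SamePos E y (ψ y)) ∧ (∀ y ∈ Icc a b, |y - ψ y| ≤ 1 / n / 2) ∧
      (∀ J ⊆ Icc a b, IsPreconnected J → Disjoint J (Z i) →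
        StrictMonoOn ψ J ∨ ∃ c, ∀ x ∈ J, ψ x = c) := by
    intro i
    apply interp_set hab _ subset_union_left haE hbE _ ρ hρm hρE _ hρδ
    · exact hEfin.union ((hPfin.subset inter_subset_left).image f)
    · apply union_subset hEI
      rintro _ ⟨x, hx, rfl⟩
      exact hf (hPI hx.1)
  choose ψ hψc hψm hψZ hψE hψδ hψJ using hψ
  have hidx : ∀ x : ℝ, ∃ i, x ∈ Icc a b → x ∉ TS m t → i < m ∧ x ∈ Ioo (t i) (t (i + 1)) := by
    intro x
    by_cases hx : x ∈ Icc a b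
    · by_cases hT : x ∈ TS m t
      · exact ⟨0, fun _ hh => absurd hT hh⟩
      · obtain ⟨i, hi, hxi⟩ := h.find_lap hx hT
        exact ⟨i, fun _ _ => ⟨hi, hxi⟩⟩
    · exact ⟨0, fun hh => absurd hh hx⟩
  choose idx hidx using hidx
  let g : ℝ → ℝ := fun x => if x ∈ TS m t then ρ (f x) else ψ (idx x) (f x)
  have hgT : ∀ x ∈ TS m t, g x = ρ (f x) := fun x hx => if_pos hx
  have hgL : ∀ i < m, ∀ x ∈ Ioo (t i) (t (i + 1)), g x = ψ i (f x) := by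
    intro i hi x hx
    have hT := h.lap_not_T hi hx
    obtain ⟨h1, h2⟩ := hidx x (h.lap_sub hi hx) hT
    have : idx x = i := h.lap_unique h1 hi h2 hx
    simp only [g]
    rw [if_neg hT, this]
  have hψa : ∀ i, ψ i a = a := fun i => by rw [hψZ i a (Or.inl haE), hρa]
  have hψb : ∀ i, ψ i b = b := fun i => by rw [hψZ i b (Or.inl hbE), hρb]
  have hgI : MapsTo g (Icc a b) (Icc a b) := by
    intro x hx
    by_cases hT : x ∈ TS m t
    · rw [hgT x hT]; exact hρI (hf hx)
    · obtain ⟨i, hi, hxi⟩ := h.find_lap hx hT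
      rw [hgL i hi x hxi]
      constructor
      · rw [← hψa i]; exact hψm i (hf hx).1
      · rw [← hψb i]; exact hψm i (hf hx).2
  have H : Approx a b f m t n g := by
    refine ⟨hgI, ?_, ?_, ?_⟩
    · intro x hx
      by_cases hT : x ∈ TS m t
      · rw [hgT x hT]; exact hρE _ (hf hx)
      · obtain ⟨i, hi, hxi⟩ := h.find_lap hx hT
        rw [hgL i hi x hxi]
        exact hψE i _ (hf hx)
    · intro i hi
      refine ⟨((hψc i).comp_continuousOn (hlap i hi).1).congr (hgL i hi), ?_⟩
      rcases (hlap i hi).2 with h1 | h1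
      · left
        refine ⟨h1, fun u hu v hv huv => ?_⟩
        rw [hgL i hi u hu, hgL i hi v hv]
        exact hψm i (h1.monotoneOn hu hv huv)
      · right
        refine ⟨h1, fun u hu v hv huv => ?_⟩
        rw [hgL i hi u hu, hgL i hi v hv]
        exact hψm i (h1.antitoneOn hu hv huv)
    · intro x l hd e he ht
      obtain ⟨i, hi, hev⟩ := h.lap_dir hd
      have h1 : Tendsto (fun z => ψ i (f z)) l (𝓝 (ψ i e)) := ((hψc i).tendsto e).comp ht
      have h2 : ψ i e = e := ((hψE i e (hEI he)).eq he).symm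
      rw [h2] at h1
      exact h1.congr' (hev.mono (fun z hz => (hgL i hi z hz).symm))
  refine ⟨g, hgI, ?_, ⟨1 / n / 2, by linarith, ?_⟩, H.final h⟩
  · obtain ⟨r, p, hr, p0, pr, hplt, hmem⟩ := exists_enum hPfin hab (hEP haE) (hEP hbE) hPI
    have hpP : ∀ i ≤ r, p i ∈ P := fun i hi => (hmem _).2 ⟨i, hi, rfl⟩
    refine ⟨r, p, hr, p0, pr, hplt, ?_, ?_⟩
    · intro i hi
      have hpi := hpP i hi
      have hgρ : g (p i) = ρ (f (p i)) := by
        by_cases hT : p i ∈ TS m t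
        · exact hgT _ hT
        · obtain ⟨j, hj, hxj⟩ := h.find_lap (hPI hpi) hT
          rw [hgL j hj _ hxj]
          exact hψZ j _ (Or.inr ⟨p i, ⟨hpi, hxj⟩, rfl⟩)
      rw [hgρ]
      exact (hmem _).1 (Or.inr ⟨_, hf (hPI hpi), rfl⟩)
    · intro i hi
      have hmiss : ∀ x ∈ Ioo (p i) (p (i + 1)), x ∉ P := by
        intro x hx hxP
        obtain ⟨j, hj, rfl⟩ := (hmem x).1 hxP
        by_cases hji : j ≤ i
        · have := steps_le hplt j i hji hi.le
          linarith [hx.1]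
        · have := steps_le hplt (i + 1) j (by omega) hj
          linarith [hx.2]
      have hgI' : Ioo (p i) (p (i + 1)) ⊆ Icc a b := fun x hx =>
        ⟨(hPI (hpP i hi.le)).1.trans hx.1.le, hx.2.le.trans (hPI (hpP (i + 1) hi)).2⟩
      obtain ⟨y, hy⟩ := exists_between (hplt i hi)
      have hyT : y ∉ TS m t := fun hT => hmiss y hy (hEP (hTE hT))
      obtain ⟨j, hj, hyj⟩ := h.find_lap (hgI' hy) hyT
      have hsub : Ioo (p i) (p (i + 1)) ⊆ Ioo (t j) (t (j + 1)) := by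
        apply Ioo_subset_Ioo
        · by_contra hcon
          exact hmiss (t j) ⟨not_le.1 hcon, hyj.1.trans hy.2⟩ (hEP (hTE ⟨j, hj.le, rfl⟩))
        · by_contra hcon
          exact hmiss (t (j + 1)) ⟨hy.1.trans hyj.2, not_le.1 hcon⟩ (hEP (hTE ⟨j + 1, hj, rfl⟩))
      have hfc := (hlap j hj).1.mono hsub
      have hg' : ∀ x ∈ Ioo (p i) (p (i + 1)), g x = ψ j (f x) := fun x hx =>
        hgL j hj x (hsub hx)
      have hJ := hψJ j (f '' Ioo (p i) (p (i + 1))) (by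
          rintro _ ⟨x, hx, rfl⟩; exact hf (hgI' hx))
        (isPreconnected_Ioo.image f hfc) (by
          rw [Set.disjoint_left]
          rintro _ ⟨x, hx, rfl⟩ (hxE | ⟨q, hq, hqx⟩)
          · exact hmiss x hx (Or.inl (Or.inr ⟨hgI' hx, hxE⟩))
          · have := h.injOn hj hq.2 (hsub hx) hqx
            exact hmiss x hx (this ▸ hq.1))
      rcases hJ with hJ | ⟨c, hJ⟩
      · left
        refine ⟨(H.lap j hj).1.mono hsub, ?_⟩
        rcases (hlap j hj).2 with h1 | h1
        · left
          intro u hu v hv huv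
          rw [hg' u hu, hg' v hv]
          exact hJ ⟨u, hu, rfl⟩ ⟨v, hv, rfl⟩ (h1 (hsub hu) (hsub hv) huv)
        · right
          intro u hu v hv huv
          rw [hg' u hu, hg' v hv]
          exact hJ ⟨v, hv, rfl⟩ ⟨u, hu, rfl⟩ (h1 (hsub hu) (hsub hv) huv)
      · right
        exact ⟨c, fun x hx => by rw [hg' x hx]; exact hJ _ ⟨x, hx, rfl⟩⟩
  · intro x hx
    by_cases hT : x ∈ TS m t
    · rw [hgT x hT]; exact hρδ _ (hf hx)
    · obtain ⟨i, hi, hxi⟩ := h.find_lap hx hT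
      rw [hgL i hi x hxi]
      exact hψδ i _ (hf hx)
end

section
/- Let I = [a,b] be a nondegenerate compact real interval and let f : I → I be piecewise monotone and transitive (some point of I has dense forward orbit), and assume that (1/n)·log c_n(f) converges as n → ∞ to log β with β > 1. Then there exists an increasing homeomorphism ψ : I → [0,1] such that the conjugate map g = ψ ∘ f ∘ ψ⁻¹ : [0,1] → [0,1] has constant slope β. -/
open Set

/-- `lapCount f a b n` is the least number `k` of pieces in a partition
`a = u_0 < u_1 < ⋯ < u_k = b` such that the `n`-th iterate `f^[n]` is continuous and
monotone on each open interval `(u_{j-1}, u_j)`; i.e. the number of laps `c_n(f)`. -/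
noncomputable def lapCount (f : ℝ → ℝ) (a b : ℝ) (n : ℕ) : ℕ :=
  sInf {k : ℕ | 0 < k ∧ ∃ u : ℕ → ℝ, u 0 = a ∧ u k = b ∧
    (∀ j < k, u j < u (j + 1)) ∧
    ∀ j < k, ContinuousOn (f^[n]) (Ioo (u j) (u (j + 1))) ∧
      (MonotoneOn (f^[n]) (Ioo (u j) (u (j + 1))) ∨
        AntitoneOn (f^[n]) (Ioo (u j) (u (j + 1))))}

structure PM (a b : ℝ) (f : ℝ → ℝ) (m : ℕ) (t : ℕ → ℝ) : Prop where
  hab : a < b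
  hf : MapsTo f (Icc a b) (Icc a b)
  hm : 0 < m
  ht0 : t 0 = a
  htm : t m = b
  htlt : ∀ i < m, t i < t (i + 1)
  hlap : ∀ i < m, ContinuousOn f (Ioo (t i) (t (i + 1))) ∧
      (MonotoneOn f (Ioo (t i) (t (i + 1))) ∨ AntitoneOn f (Ioo (t i) (t (i + 1))))
  htrans : ∃ x₀ ∈ Icc a b, Icc a b ⊆ closure (Set.range fun n : ℕ => f^[n] x₀)

/-- The finite set of partition points. -/
noncomputable def PP (m : ℕ) (t : ℕ → ℝ) : Finset ℝ := Finset.image t (Finset.range (m + 1))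

/-- Points of `I` that hit the partition at time `n`. -/
def AA (a b : ℝ) (f : ℝ → ℝ) (m : ℕ) (t : ℕ → ℝ) (n : ℕ) : Set ℝ :=
  {x | x ∈ Icc a b ∧ f^[n] x ∈ PP m t}

/-- Points of `I` that hit the partition before time `n`. -/
def BB (a b : ℝ) (f : ℝ → ℝ) (m : ℕ) (t : ℕ → ℝ) (n : ℕ) : Set ℝ :=
  {x | x ∈ Icc a b ∧ ∃ k < n, f^[k] x ∈ PP m t}

namespace PM

variable {a b : ℝ} {f : ℝ → ℝ} {m : ℕ} {t : ℕ → ℝ}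

lemma mem_PP {x : ℝ} : x ∈ PP m t ↔ ∃ i ≤ m, t i = x := by
  simp [PP]

lemma tmono (h : PM a b f m t) {i j : ℕ} (hij : i ≤ j) (hj : j ≤ m) : t i ≤ t j := by
  induction j, hij using Nat.le_induction with
  | base => exact le_rfl
  | succ k hk ih => exact (ih (by omega)).trans (h.htlt k (by omega)).le

lemma tmem (h : PM a b f m t) {i : ℕ} (hi : i ≤ m) : t i ∈ Icc a b := by
  constructor
  · rw [← h.ht0]; exact h.tmono (Nat.zero_le _) hi
  · rw [← h.htm]; exact h.tmono hi le_rfl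

lemma lap_sub (h : PM a b f m t) {i : ℕ} (hi : i < m) : Ioo (t i) (t (i + 1)) ⊆ Icc a b := by
  intro x hx
  exact ⟨(h.tmem hi.le).1.trans hx.1.le, hx.2.le.trans (h.tmem (show i + 1 ≤ m from hi)).2⟩

lemma PP_sub (h : PM a b f m t) {x : ℝ} (hx : x ∈ PP m t) : x ∈ Icc a b := by
  obtain ⟨i, hi, rfl⟩ := mem_PP.1 hx
  exact h.tmem hi

lemma a_mem (h : PM a b f m t) : a ∈ PP m t := mem_PP.2 ⟨0, Nat.zero_le _, h.ht0⟩
lemma b_mem (h : PM a b f m t) : b ∈ PP m t := mem_PP.2 ⟨m, le_rfl, h.htm⟩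

lemma exists_lap (h : PM a b f m t) {x : ℝ} (hx : x ∈ Icc a b) (hP : x ∉ PP m t) :
    ∃ i < m, x ∈ Ioo (t i) (t (i + 1)) := by
  classical
  have hxb : x < b := lt_of_le_of_ne hx.2 (fun e => hP (e ▸ h.b_mem))
  have hex : ∃ j, j ≤ m ∧ x < t j := ⟨m, le_rfl, by rw [h.htm]; exact hxb⟩
  have h1 := Nat.find_spec hex
  have h2 := fun k => Nat.find_min hex (m := k)
  set j := Nat.find hex
  rcases Nat.eq_zero_or_pos j with h0 | h0
  · rw [h0, h.ht0] at h1; exact absurd h1.2 (not_lt.2 hx.1)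
  · obtain ⟨i, hi⟩ : ∃ i, j = i + 1 := ⟨j - 1, by omega⟩
    rw [hi] at h1 h2
    refine ⟨i, h1.1, ?_, h1.2⟩
    have := h2 i (by omega)
    push Not at this
    have h3 := this (by omega)
    exact lt_of_le_of_ne h3 (fun e => hP (mem_PP.2 ⟨i, by omega, e⟩))

lemma exists_lap_set (h : PM a b f m t) {C : Set ℝ} (hC : C.OrdConnected) (hI : C ⊆ Icc a b)
    (hP : ∀ x ∈ C, x ∉ PP m t) (hne : C.Nonempty) : ∃ i < m, C ⊆ Ioo (t i) (t (i + 1)) := by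
  obtain ⟨c, hc⟩ := hne
  obtain ⟨i, hi, hci⟩ := h.exists_lap (hI hc) (hP c hc)
  refine ⟨i, hi, fun y hy => ?_⟩
  by_contra hcon
  rw [mem_Ioo, not_and_or, not_lt, not_lt] at hcon
  rcases hcon with h1 | h1
  · exact hP (t i) (hC.out hy hc ⟨h1, hci.1.le⟩) (mem_PP.2 ⟨i, hi.le, rfl⟩)
  · exact hP (t (i+1)) (hC.out hc hy ⟨hci.2.le, h1⟩) (mem_PP.2 ⟨i+1, hi, rfl⟩)

lemma iter_mem (h : PM a b f m t) {x : ℝ} (hx : x ∈ Icc a b) (n : ℕ) : f^[n] x ∈ Icc a b :=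
  h.hf.iterate n hx

lemma orbit (h : PM a b f m t) : ∃ x₀ ∈ Icc a b, (Function.Injective fun n : ℕ => f^[n] x₀) ∧
    (∀ n, f^[n] x₀ ∉ PP m t) ∧ ∀ u v, a ≤ u → u < v → v ≤ b → ∀ N, ∃ n ≥ N, f^[n] x₀ ∈ Ioo u v := by
  obtain ⟨x₀, hx₀, hd⟩ := h.htrans
  have hinj : Function.Injective fun n : ℕ => f^[n] x₀ := by
    have key : ∀ i j, i < j → f^[i] x₀ ≠ f^[j] x₀ := by
      intro i j hij heq
      have hsub : (Set.range fun n : ℕ => f^[n] x₀) ⊆ (fun n : ℕ => f^[n] x₀) '' Set.Iio j := by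
        rintro _ ⟨n, rfl⟩
        induction n using Nat.strong_induction_on with
        | _ n ih =>
          by_cases hn : n < j
          · exact ⟨n, hn, rfl⟩
          · have : f^[n] x₀ = f^[n - j + i] x₀ := by
              have e1 : n = (n - j) + j := by omega
              conv_lhs => rw [e1]
              rw [Function.iterate_add_apply, Function.iterate_add_apply, heq]
            have h2 := ih (n - j + i) (by omega)
            simp only at h2 ⊢
            rw [this]; exact h2
      have hfin : (Set.range fun n : ℕ => f^[n] x₀).Finite :=
        ((Set.finite_Iio j).image _).subset hsub
      rw [hfin.isClosed.closure_eq] at hd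
      exact Set.Icc_infinite h.hab (hfin.subset hd)
    intro i j hij
    by_contra hne
    rcases lt_or_gt_of_ne hne with h1 | h1
    · exact key i j h1 hij
    · exact key j i h1 hij.symm
  have hdense : ∀ u v, a ≤ u → u < v → v ≤ b → ∀ N, ∃ n ≥ N, f^[n] x₀ ∈ Ioo u v := by
    intro u v hu huv hv N
    have hfin : ((fun n : ℕ => f^[n] x₀) '' Set.Iio N).Finite := (Set.finite_Iio N).image _
    have hopen : IsOpen (Ioo u v ∩ ((fun n : ℕ => f^[n] x₀) '' Set.Iio N)ᶜ) :=
      isOpen_Ioo.inter hfin.isClosed.isOpen_compl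
    obtain ⟨y, hy1, hy2⟩ := (Set.Ioo_infinite huv).sdiff hfin |>.nonempty
    have hyc : y ∈ closure (Set.range fun n : ℕ => f^[n] x₀) :=
      hd ⟨hu.trans hy1.1.le, hy1.2.le.trans hv⟩
    obtain ⟨_, hz, n, rfl⟩ := mem_closure_iff.1 hyc _ hopen ⟨hy1, hy2⟩
    refine ⟨n, ?_, hz.1⟩
    by_contra hn
    exact hz.2 ⟨n, by simpa using hn, rfl⟩
  have hfin : {n : ℕ | f^[n] x₀ ∈ PP m t}.Finite :=
    Set.Finite.preimage (s := (PP m t : Set ℝ)) hinj.injOn (Finset.finite_toSet _)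
  obtain ⟨M, hM⟩ := hfin.bddAbove
  refine ⟨f^[M + 1] x₀, h.iter_mem hx₀ _, ?_, ?_, ?_⟩
  · intro i j hij
    simp only [← Function.iterate_add_apply] at hij
    have := hinj hij
    omega
  · intro n hn
    rw [← Function.iterate_add_apply] at hn
    have := hM hn
    omega
  · intro u v hu huv hv N
    obtain ⟨n, hn, hn'⟩ := hdense u v hu huv hv (N + (M + 1))
    refine ⟨n - (M + 1), by omega, ?_⟩
    rw [← Function.iterate_add_apply]
    rwa [show n - (M+1) + (M + 1) = n by omega]

lemma nonconst (h : PM a b f m t) (n : ℕ) {u v : ℝ} (hu : a ≤ u) (huv : u < v) (hv : v ≤ b)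
    (hc : ∀ x ∈ Icc u v, ∀ y ∈ Icc u v, f^[n] x = f^[n] y) : False := by
  obtain ⟨x₀, -, hinj, -, hd⟩ := h.orbit
  obtain ⟨i, -, hi⟩ := hd u v hu huv hv 0
  obtain ⟨j, hj, hj'⟩ := hd u v hu huv hv (i + 1)
  have := hc _ (Ioo_subset_Icc_self hi) _ (Ioo_subset_Icc_self hj')
  rw [← Function.iterate_add_apply, ← Function.iterate_add_apply] at this
  have := hinj this
  omega

lemma injOn_of_mono (h : PM a b f m t) (n : ℕ) {C : Set ℝ} (hC : C.OrdConnected)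
    (hI : C ⊆ Icc a b) (hmono : MonotoneOn (f^[n]) C ∨ AntitoneOn (f^[n]) C) :
    InjOn (f^[n]) C := by
  have key : ∀ u ∈ C, ∀ v ∈ C, u < v → f^[n] u ≠ f^[n] v := by
    intro u hu v hv huv heq
    have hval : ∀ x ∈ Icc u v, f^[n] x = f^[n] u := by
      intro x hx
      have hxC := hC.out hu hv hx
      rcases hmono with hm | hm
      · exact le_antisymm ((hm hxC hv hx.2).trans heq.ge) (hm hu hxC hx.1)
      · exact le_antisymm (hm hu hxC hx.1) (heq.le.trans (hm hxC hv hx.2))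
    exact h.nonconst n (hI hu).1 huv (hI hv).2 (fun x hx y hy => (hval x hx).trans (hval y hy).symm)
  intro u hu v hv heq
  by_contra hne
  rcases lt_or_gt_of_ne hne with h1 | h1
  · exact key u hu v hv h1 heq
  · exact key v hv u hu h1 heq.symm

lemma lap_inj (h : PM a b f m t) {i : ℕ} (hi : i < m) : InjOn f (Ioo (t i) (t (i + 1))) :=
  h.injOn_of_mono 1 ordConnected_Ioo (h.lap_sub hi) (h.hlap i hi).2

lemma finite_pre (h : PM a b f m t) {Q : Set ℝ} (hQ : Q.Finite) :
    {x | x ∈ Icc a b ∧ f x ∈ Q}.Finite := by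
  have : {x | x ∈ Icc a b ∧ f x ∈ Q} ⊆ (PP m t : Set ℝ) ∪
      ⋃ i ∈ Set.Iio m, (Ioo (t i) (t (i + 1)) ∩ f ⁻¹' Q) := by
    rintro x ⟨hx, hxQ⟩
    by_cases hP : x ∈ PP m t
    · exact Or.inl hP
    · obtain ⟨i, hi, hxi⟩ := h.exists_lap hx hP
      exact Or.inr (Set.mem_biUnion (show i ∈ Set.Iio m from hi) ⟨hxi, hxQ⟩)
  refine Set.Finite.subset ((Finset.finite_toSet _).union ((Set.finite_Iio m).biUnion ?_)) this
  intro i hi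
  refine Set.Finite.of_finite_image (f := f) (hQ.subset ?_) ((h.lap_inj hi).mono inter_subset_left)
  rintro _ ⟨x, hx, rfl⟩
  exact hx.2

lemma AA_finite (h : PM a b f m t) (n : ℕ) : (AA a b f m t n).Finite := by
  induction n with
  | zero => exact (Finset.finite_toSet (PP m t)).subset (fun x hx => hx.2)
  | succ n ih =>
    refine (h.finite_pre ih).subset ?_
    rintro x ⟨hx, hx2⟩
    exact ⟨hx, h.hf hx, hx2⟩

lemma BB_eq (n : ℕ) : BB a b f m t n = ⋃ k ∈ Set.Iio n, AA a b f m t k := by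
  ext x; simp [BB, AA]

lemma BB_finite (h : PM a b f m t) (n : ℕ) : (BB a b f m t n).Finite := by
  rw [BB_eq]
  exact (Set.finite_Iio n).biUnion (fun k _ => h.AA_finite k)

lemma cont_mono (h : PM a b f m t) (n : ℕ) {C : Set ℝ} (hC : C.OrdConnected)
    (hI : C ⊆ Icc a b) (hB : ∀ x ∈ C, x ∉ BB a b f m t n) :
    ContinuousOn (f^[n]) C ∧ (MonotoneOn (f^[n]) C ∨ AntitoneOn (f^[n]) C) := by
  induction n with
  | zero => exact ⟨continuousOn_id, Or.inl monotoneOn_id⟩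
  | succ n ih =>
    rcases C.eq_empty_or_nonempty with rfl | hne
    · exact ⟨continuousOn_empty _, Or.inl (fun x hx => absurd hx (notMem_empty x))⟩
    obtain ⟨hc, hm⟩ := ih (fun x hx hx' => hB x hx ⟨hx'.1, by
      obtain ⟨k, hk, hk'⟩ := hx'.2; exact ⟨k, by omega, hk'⟩⟩)
    have hord : (f^[n] '' C).OrdConnected :=
      (hC.isPreconnected.image _ hc).ordConnected
    obtain ⟨i, hi, hsub⟩ := h.exists_lap_set hord
      (by rintro _ ⟨x, hx, rfl⟩; exact h.iter_mem (hI hx) n)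
      (by rintro _ ⟨x, hx, rfl⟩ hP; exact hB x hx ⟨hI hx, n, by omega, hP⟩) (hne.image _)
    have hmaps : MapsTo (f^[n]) C (Ioo (t i) (t (i + 1))) := fun x hx => hsub ⟨x, hx, rfl⟩
    rw [Function.iterate_succ']
    refine ⟨(h.hlap i hi).1.comp hc hmaps, ?_⟩
    rcases hm with hm | hm <;> rcases (h.hlap i hi).2 with h2 | h2
    · exact Or.inl fun x hx y hy hxy => h2 (hmaps hx) (hmaps hy) (hm hx hy hxy)
    · exact Or.inr fun x hx y hy hxy => h2 (hmaps hx) (hmaps hy) (hm hx hy hxy)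
    · exact Or.inr fun x hx y hy hxy => h2 (hmaps hy) (hmaps hx) (hm hx hy hxy)
    · exact Or.inl fun x hx y hy hxy => h2 (hmaps hy) (hmaps hx) (hm hx hy hxy)

/-- One more than the number of points in `BB`. -/
noncomputable def pc (a b : ℝ) (f : ℝ → ℝ) (m : ℕ) (t : ℕ → ℝ) (n : ℕ) : ℕ :=
  (BB a b f m t n).ncard + 1

lemma BB_add (h : PM a b f m t) (k n : ℕ) : BB a b f m t (k + n) ⊆
    BB a b f m t k ∪ {x | x ∈ Icc a b ∧ x ∉ BB a b f m t k ∧ f^[k] x ∈ BB a b f m t n} := by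
  rintro x ⟨hx, j, hj, hP⟩
  by_cases hk : x ∈ BB a b f m t k
  · exact Or.inl hk
  · refine Or.inr ⟨hx, hk, h.iter_mem hx k, j - k, ?_, ?_⟩
    · have : k ≤ j := by
        by_contra hlt
        exact hk ⟨hx, j, by omega, hP⟩
      omega
    · have : k ≤ j := by
        by_contra hlt
        exact hk ⟨hx, j, by omega, hP⟩
      rw [← Function.iterate_add_apply, Nat.sub_add_cancel this]
      exact hP

lemma pc_add (h : PM a b f m t) (k n : ℕ) :
    pc a b f m t (k + n) ≤ pc a b f m t k * pc a b f m t n := by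
  set E := {x | x ∈ Icc a b ∧ x ∉ BB a b f m t k ∧ f^[k] x ∈ BB a b f m t n} with hE
  have hBf := h.BB_finite k
  let T : Set (ℕ × ℝ) := (Set.Iio (pc a b f m t k)) ×ˢ (BB a b f m t n)
  have hTf : T.Finite := (Set.finite_Iio _).prod (h.BB_finite n)
  let φ : ℝ → ℕ × ℝ := fun x => ((BB a b f m t k ∩ Iio x).ncard, f^[k] x)
  have hmaps : MapsTo φ E T := by
    intro x hx
    refine ⟨?_, hx.2.2⟩
    exact Nat.lt_succ_of_le (Set.ncard_le_ncard inter_subset_left hBf)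
  have key : ∀ x ∈ E, ∀ y ∈ E, x < y → φ x ≠ φ y := by
    intro x hx y hy hxy heq
    have h1 : (BB a b f m t k ∩ Iio x).ncard = (BB a b f m t k ∩ Iio y).ncard :=
      congrArg Prod.fst heq
    have h2 : f^[k] x = f^[k] y := congrArg Prod.snd heq
    have h3 : BB a b f m t k ∩ Iio x = BB a b f m t k ∩ Iio y :=
      Set.eq_of_subset_of_ncard_le
        (fun z hz => ⟨hz.1, lt_trans hz.2 hxy⟩) h1.ge (hBf.subset inter_subset_left)
    have hI : Icc x y ⊆ Icc a b := Icc_subset_Icc hx.1.1 hy.1.2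
    have hB : ∀ z ∈ Icc x y, z ∉ BB a b f m t k := by
      intro z hz hzB
      rcases eq_or_lt_of_le hz.2 with e | e
      · exact hy.2.1 (e ▸ hzB)
      · have : z ∈ BB a b f m t k ∩ Iio x := by rw [h3]; exact ⟨hzB, e⟩
        exact absurd this.2 (not_lt.2 hz.1)
    have hinj := h.injOn_of_mono k ordConnected_Icc hI (h.cont_mono k ordConnected_Icc hI hB).2
    exact hxy.ne (hinj (left_mem_Icc.2 hxy.le) (right_mem_Icc.2 hxy.le) h2)
  have hinj : InjOn φ E := by
    intro x hx y hy heq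
    by_contra hne
    rcases lt_or_gt_of_ne hne with h1 | h1
    · exact key x hx y hy h1 heq
    · exact key y hy x hx h1 heq.symm
  have hEcard : E.ncard ≤ pc a b f m t k * (BB a b f m t n).ncard := by
    calc E.ncard ≤ T.ncard := Set.ncard_le_ncard_of_injOn φ hmaps hinj hTf
      _ = _ := by
        rw [Set.ncard_prod]; simp
  have hEf : E.Finite := Set.Finite.of_injOn hmaps hinj hTf
  have h4 : (BB a b f m t (k + n)).ncard ≤ (BB a b f m t k).ncard + E.ncard :=
    (Set.ncard_le_ncard (h.BB_add k n) (hBf.union hEf)).trans (Set.ncard_union_le _ _)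
  have h5 : pc a b f m t k = (BB a b f m t k).ncard + 1 := rfl
  have h6 : pc a b f m t n = (BB a b f m t n).ncard + 1 := rfl
  have h7 : pc a b f m t (k + n) = (BB a b f m t (k + n)).ncard + 1 := rfl
  rw [h7, h6]
  nlinarith

lemma pc_pos (n : ℕ) : (0 : ℝ) < pc a b f m t n := by
  unfold pc; positivity

lemma subadd (h : PM a b f m t) : Subadditive (fun n => Real.log (pc a b f m t n)) := by
  intro k n
  rw [← Real.log_mul (pc_pos k).ne' (pc_pos n).ne']
  refine Real.log_le_log (pc_pos _) ?_
  exact_mod_cast h.pc_add k n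

lemma exists_growth (h : PM a b f m t) : ∃ B : ℝ, 0 < B ∧
    Filter.Tendsto (fun n : ℕ => Real.log (pc a b f m t n) / n) Filter.atTop (nhds (Real.log B)) ∧
    ∀ n, B ^ n ≤ pc a b f m t n := by
  have hb : BddBelow (Set.range fun n : ℕ => Real.log (pc a b f m t n) / n) := by
    refine ⟨0, ?_⟩
    rintro _ ⟨n, rfl⟩
    refine div_nonneg (Real.log_nonneg ?_) (Nat.cast_nonneg _)
    exact_mod_cast Nat.le_add_left 1 _
  refine ⟨Real.exp h.subadd.lim, Real.exp_pos _, ?_, ?_⟩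
  · rw [Real.log_exp]; exact h.subadd.tendsto_lim hb
  · intro n
    rcases Nat.eq_zero_or_pos n with rfl | hn
    · simp [pc]
    · have := h.subadd.lim_le_div hb hn.ne'
      rw [le_div_iff₀ (by exact_mod_cast hn)] at this
      rw [← Real.exp_nat_mul, ← Real.le_log_iff_exp_le (pc_pos n)]
      linarith

lemma lap_set_mem (h : PM a b f m t) {n : ℕ} (hn : 0 < n) :
    (BB a b f m t n).ncard - 1 ∈ {k : ℕ | 0 < k ∧ ∃ u : ℕ → ℝ, u 0 = a ∧ u k = b ∧
    (∀ j < k, u j < u (j + 1)) ∧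
    ∀ j < k, ContinuousOn (f^[n]) (Ioo (u j) (u (j + 1))) ∧
      (MonotoneOn (f^[n]) (Ioo (u j) (u (j + 1))) ∨
        AntitoneOn (f^[n]) (Ioo (u j) (u (j + 1))))} := by
  classical
  set Q : Finset ℝ := (h.BB_finite n).toFinset with hQ
  have hQm : ∀ x, x ∈ Q ↔ x ∈ BB a b f m t n := fun x => by simp [hQ]
  have ha : a ∈ Q := (hQm a).2 ⟨left_mem_Icc.2 h.hab.le, 0, hn, h.a_mem⟩
  have hb : b ∈ Q := (hQm b).2 ⟨right_mem_Icc.2 h.hab.le, 0, hn, h.b_mem⟩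
  have hcard : (BB a b f m t n).ncard = Q.card := Set.ncard_eq_toFinset_card _ (h.BB_finite n)
  have h2 : 1 < Q.card := Finset.one_lt_card.2 ⟨a, ha, b, hb, h.hab.ne⟩
  obtain ⟨k, hk⟩ : ∃ k, Q.card = k + 1 := ⟨Q.card - 1, by omega⟩
  rw [hcard, hk, Nat.add_sub_cancel]
  let e := Q.orderEmbOfFin hk
  have heQ : ∀ i, e i ∈ Q := fun i => Finset.orderEmbOfFin_mem Q hk i
  have hsurj : ∀ x ∈ Q, ∃ i, e i = x := by
    intro x hx
    have : x ∈ Set.range e := by rw [Finset.range_orderEmbOfFin]; exact hx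
    exact this
  let u : ℕ → ℝ := fun j => e ⟨min j k, by omega⟩
  have hu : ∀ j (hj : j ≤ k), u j = e ⟨j, by omega⟩ := by
    intro j hj
    simp only [u]; congr 2; omega
  have hlt : ∀ j < k, u j < u (j + 1) := by
    intro j hj
    rw [hu j hj.le, hu (j+1) hj, e.lt_iff_lt]
    simp [Fin.lt_def]
  refine ⟨by omega, u, ?_, ?_, hlt, ?_⟩
  · obtain ⟨i, hi⟩ := hsurj a ha
    rw [hu 0 (Nat.zero_le _)]
    apply le_antisymm
    · refine le_trans ?_ hi.le
      rw [e.le_iff_le]; simp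
    · exact (((hQm _).1 (heQ _)).1).1
  · obtain ⟨i, hi⟩ := hsurj b hb
    rw [hu k le_rfl]
    apply le_antisymm
    · exact (((hQm _).1 (heQ _)).1).2
    · refine le_trans hi.ge ?_
      rw [e.le_iff_le, Fin.le_def]; have := i.2; simp only; omega
  · intro j hj
    refine h.cont_mono n ordConnected_Ioo ?_ ?_
    · intro x hx
      rw [hu j hj.le, hu (j+1) hj] at hx
      exact ⟨(((hQm _).1 (heQ _)).1).1.trans hx.1.le, hx.2.le.trans (((hQm _).1 (heQ _)).1).2⟩
    · intro x hx hxB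
      obtain ⟨i, hi⟩ := hsurj x ((hQm x).2 hxB)
      rw [hu j hj.le, hu (j+1) hj, ← hi, mem_Ioo, e.lt_iff_lt, e.lt_iff_lt, Fin.lt_def, Fin.lt_def] at hx
      simp only at hx
      omega

lemma lapCount_le (h : PM a b f m t) {n : ℕ} (hn : 0 < n) :
    lapCount f a b n ≤ pc a b f m t n := by
  have : lapCount f a b n ≤ (BB a b f m t n).ncard - 1 := Nat.sInf_le (h.lap_set_mem hn)
  unfold pc
  omega

/-- Number of points of `S` hitting the partition at time `n`. -/
noncomputable def wv (a b : ℝ) (f : ℝ → ℝ) (m : ℕ) (t : ℕ → ℝ) (n : ℕ) (S : Set ℝ) : ℝ :=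
  ((S ∩ AA a b f m t n).ncard : ℝ)

/-- Generating series. -/
noncomputable def LL (a b : ℝ) (f : ℝ → ℝ) (m : ℕ) (t : ℕ → ℝ) (s : ℝ) (S : Set ℝ) : ℝ :=
  ∑' n, wv a b f m t n S * s ^ n

lemma wv_nonneg (n : ℕ) (S : Set ℝ) : 0 ≤ wv a b f m t n S := Nat.cast_nonneg _

lemma wv_mono (h : PM a b f m t) (n : ℕ) {S T : Set ℝ} (hST : S ⊆ T) :
    wv a b f m t n S ≤ wv a b f m t n T := by
  unfold wv
  exact_mod_cast Set.ncard_le_ncard (inter_subset_inter_left _ hST)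
    ((h.AA_finite n).subset inter_subset_right)

lemma wv_union (h : PM a b f m t) (n : ℕ) {S T : Set ℝ} (hST : Disjoint S T) :
    wv a b f m t n (S ∪ T) = wv a b f m t n S + wv a b f m t n T := by
  unfold wv
  rw [union_inter_distrib_right, Set.ncard_union_eq
    (hST.mono inter_subset_left inter_subset_left)
    ((h.AA_finite n).subset inter_subset_right) ((h.AA_finite n).subset inter_subset_right)]
  push_cast; rfl

lemma wv_le (h : PM a b f m t) (n : ℕ) (S : Set ℝ) :
    wv a b f m t n S ≤ wv a b f m t n (Icc a b) := by
  have : S ∩ AA a b f m t n = (S ∩ Icc a b) ∩ AA a b f m t n := by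
    ext x; constructor
    · rintro ⟨h1, h2⟩; exact ⟨⟨h1, h2.1⟩, h2⟩
    · rintro ⟨h1, h2⟩; exact ⟨h1.1, h2⟩
  have h2 : wv a b f m t n S = wv a b f m t n (S ∩ Icc a b) := by
    unfold wv; rw [this]
  rw [h2]; exact h.wv_mono n inter_subset_right

lemma wv_I (n : ℕ) : wv a b f m t n (Icc a b) = (AA a b f m t n).ncard := by
  unfold wv
  rw [inter_eq_self_of_subset_right (fun x hx => hx.1)]

lemma wv_succ (h : PM a b f m t) (n : ℕ) {S : Set ℝ} (hS : S ⊆ Icc a b) (hinj : InjOn f S) :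
    wv a b f m t (n + 1) S = wv a b f m t n (f '' S) := by
  unfold wv
  have : f '' S ∩ AA a b f m t n = f '' (S ∩ AA a b f m t (n + 1)) := by
    ext y; constructor
    · rintro ⟨⟨x, hx, rfl⟩, hy⟩
      exact ⟨x, ⟨hx, hS hx, hy.2⟩, rfl⟩
    · rintro ⟨x, ⟨hx, hx2⟩, rfl⟩
      exact ⟨⟨x, hx, rfl⟩, h.hf (hS hx), hx2.2⟩
  rw [this, (hinj.mono inter_subset_left).ncard_image]

lemma wv_le_pc (h : PM a b f m t) (n : ℕ) (S : Set ℝ) :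
    wv a b f m t n S ≤ pc a b f m t (n + 1) := by
  refine (h.wv_le n S).trans ?_
  rw [wv_I]
  have : (AA a b f m t n).ncard ≤ (BB a b f m t (n + 1)).ncard :=
    Set.ncard_le_ncard (fun x hx => ⟨hx.1, n, by omega, hx.2⟩) (h.BB_finite _)
  unfold pc
  exact_mod_cast this.trans (Nat.le_succ _)

lemma pc_summable {B : ℝ} (hB : 0 < B)
    (ht : Filter.Tendsto (fun n : ℕ => Real.log (pc a b f m t n) / n) Filter.atTop
      (nhds (Real.log B))) {s : ℝ} (hs : 0 < s) (hsB : s < B⁻¹) :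
    Summable (fun n => (pc a b f m t n : ℝ) * s ^ n) := by
  have hlog : Real.log B < - Real.log s := by
    have := Real.log_lt_log hs hsB
    rw [Real.log_inv] at this
    linarith
  obtain ⟨c, hc1, hc2⟩ := exists_between hlog
  have hq : Real.exp c * s < 1 := by
    rw [← Real.exp_log hs, ← Real.exp_add, Real.exp_lt_one_iff]
    linarith
  have hgeo : Summable (fun n : ℕ => (Real.exp c * s) ^ n) :=
    summable_geometric_of_lt_one (by positivity) hq
  refine Summable.of_norm_bounded_eventually_nat hgeo ?_
  filter_upwards [ht.eventually (gt_mem_nhds hc1), Filter.eventually_gt_atTop 0] with n hn hn0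
  have hnpos : (0 : ℝ) < n := by exact_mod_cast hn0
  rw [Real.norm_of_nonneg (by positivity), mul_pow]
  refine mul_le_mul_of_nonneg_right ?_ (by positivity)
  rw [div_lt_iff₀ hnpos] at hn
  rw [← Real.exp_nat_mul, ← Real.log_le_iff_le_exp (pc_pos n)]
  linarith

lemma wv_summable (h : PM a b f m t) {B : ℝ} (hB : 0 < B)
    (ht : Filter.Tendsto (fun n : ℕ => Real.log (pc a b f m t n) / n) Filter.atTop
      (nhds (Real.log B))) {s : ℝ} (hs : 0 < s) (hsB : s < B⁻¹) (S : Set ℝ) :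
    Summable (fun n => wv a b f m t n S * s ^ n) := by
  have h1 := (summable_nat_add_iff 1).2 (pc_summable hB ht hs hsB)
  have h2 := h1.mul_left s⁻¹
  refine Summable.of_nonneg_of_le (fun n => mul_nonneg (wv_nonneg _ _) (by positivity)) ?_ h2
  intro n
  have : s⁻¹ * ((pc a b f m t (n + 1) : ℝ) * s ^ (n + 1)) = pc a b f m t (n + 1) * s ^ n := by
    rw [pow_succ]; field_simp
  rw [this]
  exact mul_le_mul_of_nonneg_right (h.wv_le_pc n S) (by positivity)

lemma not_summable (h : PM a b f m t) {B : ℝ} (hB : 1 < B)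
    (hpc : ∀ n, B ^ n ≤ pc a b f m t n) :
    ¬ Summable (fun n => wv a b f m t n (Icc a b) * (B⁻¹) ^ n) := by
  intro hsum
  have hB0 : 0 < B := by linarith
  have hR : B⁻¹ < 1 := inv_lt_one_of_one_lt₀ hB
  have hR0 : 0 < B⁻¹ := by positivity
  have hgeo : Summable (fun n : ℕ => (B⁻¹) ^ n) := summable_geometric_of_lt_one hR0.le hR
  have hprod := summable_norm_sum_mul_range_of_summable_norm
    (f := fun n => wv a b f m t n (Icc a b) * (B⁻¹) ^ n) (g := fun n : ℕ => (B⁻¹) ^ n)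
    hsum.norm hgeo.norm |>.of_norm
  have h0 := hprod.tendsto_atTop_zero
  have h1 := hgeo.tendsto_atTop_zero
  have h2 := h0.add h1
  rw [add_zero] at h2
  have h3 : ∀ n : ℕ, B ≤ ∑ k ∈ Finset.range (n + 1),
      wv a b f m t k (Icc a b) * (B⁻¹) ^ k * (B⁻¹) ^ (n - k) + (B⁻¹) ^ n := by
    intro n
    have e1 : ∑ k ∈ Finset.range (n + 1),
      wv a b f m t k (Icc a b) * (B⁻¹) ^ k * (B⁻¹) ^ (n - k) =
      (∑ k ∈ Finset.range (n + 1), wv a b f m t k (Icc a b)) * (B⁻¹) ^ n := by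
      rw [Finset.sum_mul]
      refine Finset.sum_congr rfl (fun k hk => ?_)
      rw [mul_assoc, ← pow_add]
      congr 2
      have := Finset.mem_range.1 hk
      omega
    have e2 : ∀ N : ℕ, ((BB a b f m t N).ncard : ℝ) ≤
        ∑ k ∈ Finset.range N, wv a b f m t k (Icc a b) := by
      intro N
      induction N with
      | zero =>
        have : BB a b f m t 0 = ∅ := by ext x; simp [BB]
        simp [this]
      | succ N ih =>
        rw [Finset.sum_range_succ, wv_I]
        have : BB a b f m t (N + 1) ⊆ BB a b f m t N ∪ AA a b f m t N := by
          rintro x ⟨hx, k, hk, hP⟩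
          rcases Nat.lt_succ_iff_lt_or_eq.1 hk with h4 | h4
          · exact Or.inl ⟨hx, k, h4, hP⟩
          · exact Or.inr ⟨hx, h4 ▸ hP⟩
        have h5 := (Set.ncard_le_ncard this ((h.BB_finite N).union (h.AA_finite N))).trans
          (Set.ncard_union_le _ _)
        have h6 : ((BB a b f m t (N + 1)).ncard : ℝ) ≤
          (BB a b f m t N).ncard + (AA a b f m t N).ncard := by exact_mod_cast h5
        linarith
    rw [e1]
    have e3 := e2 (n + 1)
    have e4 := hpc (n + 1)
    have e5 : (pc a b f m t (n + 1) : ℝ) = (BB a b f m t (n + 1)).ncard + 1 := by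
      unfold pc; push_cast; rfl
    have e6 : B ^ (n + 1) ≤ (∑ k ∈ Finset.range (n + 1), wv a b f m t k (Icc a b)) + 1 := by
      linarith
    have e7 : B ^ (n + 1) * (B⁻¹) ^ n = B := by
      rw [pow_succ, inv_pow]; field_simp
    calc B = B ^ (n + 1) * (B⁻¹) ^ n := e7.symm
      _ ≤ ((∑ k ∈ Finset.range (n + 1), wv a b f m t k (Icc a b)) + 1) * (B⁻¹) ^ n :=
        mul_le_mul_of_nonneg_right e6 (by positivity)
      _ = _ := by ring
  have := ge_of_tendsto' h2 h3
  linarith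

lemma LL_tendsto (h : PM a b f m t) {B : ℝ} (hB : 1 < B)
    (ht : Filter.Tendsto (fun n : ℕ => Real.log (pc a b f m t n) / n) Filter.atTop
      (nhds (Real.log B))) (hpc : ∀ n, B ^ n ≤ pc a b f m t n) :
    Filter.Tendsto (fun s => LL a b f m t s (Icc a b)) (nhdsWithin B⁻¹ (Iio B⁻¹)) Filter.atTop := by
  have hB0 : 0 < B := by linarith
  have hR0 : 0 < B⁻¹ := by positivity
  rw [Filter.tendsto_atTop]
  intro C
  have hns := h.not_summable hB hpc
  obtain ⟨N, hN⟩ : ∃ N, C < ∑ n ∈ Finset.range N, wv a b f m t n (Icc a b) * (B⁻¹) ^ n := by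
    by_contra hcon
    push Not at hcon
    exact hns (summable_of_sum_range_le
      (fun n => mul_nonneg (wv_nonneg _ _) (by positivity)) hcon)
  have hcont : Continuous (fun s : ℝ => ∑ n ∈ Finset.range N, wv a b f m t n (Icc a b) * s ^ n) := by
    fun_prop
  have hev : ∀ᶠ s in nhdsWithin B⁻¹ (Iio B⁻¹),
      C < ∑ n ∈ Finset.range N, wv a b f m t n (Icc a b) * s ^ n :=
    (hcont.continuousAt.eventually (lt_mem_nhds hN)).filter_mono nhdsWithin_le_nhds
  have hpos : ∀ᶠ s in nhdsWithin B⁻¹ (Iio B⁻¹), 0 < s :=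
    (lt_mem_nhds hR0).filter_mono nhdsWithin_le_nhds
  filter_upwards [hev, hpos, self_mem_nhdsWithin] with s h1 h2 h3
  refine h1.le.trans ?_
  exact (h.wv_summable hB0 ht h2 h3 (Icc a b)).sum_le_tsum _
    (fun n _ => mul_nonneg (wv_nonneg _ _) (by positivity))

/-- The finitely additive conformal measure. -/
lemma exists_measure (h : PM a b f m t) {B : ℝ} (hB : 1 < B)
    (ht : Filter.Tendsto (fun n : ℕ => Real.log (pc a b f m t n) / n) Filter.atTop
      (nhds (Real.log B))) (hpc : ∀ n, B ^ n ≤ pc a b f m t n) :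
    ∃ μ : Set ℝ → ℝ, (∀ S, 0 ≤ μ S) ∧ μ (Icc a b) = 1 ∧ (∀ S T, S ⊆ T → μ S ≤ μ T) ∧
      (∀ S T, Disjoint S T → μ (S ∪ T) = μ S + μ T) ∧
      ∀ S, S ⊆ Icc a b → InjOn f S → μ (f '' S) = B * μ S := by
  have hB0 : 0 < B := by linarith
  have hR0 : 0 < B⁻¹ := by positivity
  let U : Ultrafilter ℝ := Ultrafilter.of (nhdsWithin B⁻¹ (Iio B⁻¹))
  have hU : (U : Filter ℝ) ≤ nhdsWithin B⁻¹ (Iio B⁻¹) := Ultrafilter.of_le _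
  have hlim := (h.LL_tendsto hB ht hpc).mono_left hU
  have hpos : ∀ᶠ s in (U : Filter ℝ), 0 < s :=
    ((lt_mem_nhds hR0).filter_mono nhdsWithin_le_nhds).filter_mono hU
  have hlt : ∀ᶠ s in (U : Filter ℝ), s < B⁻¹ :=
    Filter.Eventually.filter_mono hU self_mem_nhdsWithin
  have hLpos : ∀ᶠ s in (U : Filter ℝ), 0 < LL a b f m t s (Icc a b) :=
    hlim.eventually (Filter.eventually_gt_atTop 0)
  have hUs : Filter.Tendsto (fun s : ℝ => s) (U : Filter ℝ) (nhds B⁻¹) :=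
    hU.trans nhdsWithin_le_nhds
  have hex : ∀ S : Set ℝ, ∃ l : ℝ, l ∈ Icc (0 : ℝ) 1 ∧
      Filter.Tendsto (fun s => LL a b f m t s S / LL a b f m t s (Icc a b)) (U : Filter ℝ)
        (nhds l) := by
    intro S
    have hmem : ∀ᶠ s in (U : Filter ℝ),
        LL a b f m t s S / LL a b f m t s (Icc a b) ∈ Icc (0 : ℝ) 1 := by
      filter_upwards [hpos, hlt, hLpos] with s h1 h2 h3
      constructor
      · exact div_nonneg (tsum_nonneg fun n => mul_nonneg (wv_nonneg _ _) (by positivity)) h3.le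
      · rw [div_le_one h3]
        exact (h.wv_summable hB0 ht h1 h2 S).tsum_le_tsum
          (fun n => mul_le_mul_of_nonneg_right (h.wv_le n S) (by positivity))
          (h.wv_summable hB0 ht h1 h2 _)
    exact isCompact_Icc.ultrafilter_le_nhds
      (U.map fun s => LL a b f m t s S / LL a b f m t s (Icc a b))
      (Filter.le_principal_iff.2 hmem)
  choose μ hμ1 hμ2 using hex
  refine ⟨μ, fun S => (hμ1 S).1, ?_, ?_, ?_, ?_⟩
  · refine tendsto_nhds_unique (hμ2 (Icc a b)) (tendsto_const_nhds.congr' ?_)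
    filter_upwards [hLpos] with s hs
    rw [div_self hs.ne']
  · intro S T hST
    refine le_of_tendsto_of_tendsto (hμ2 S) (hμ2 T) ?_
    filter_upwards [hpos, hlt, hLpos] with s h1 h2 h3
    refine div_le_div_of_nonneg_right ?_ h3.le
    exact (h.wv_summable hB0 ht h1 h2 S).tsum_le_tsum
          (fun n => mul_le_mul_of_nonneg_right (h.wv_mono n hST) (by positivity))
          (h.wv_summable hB0 ht h1 h2 _)
  · intro S T hST
    refine tendsto_nhds_unique (hμ2 (S ∪ T)) (((hμ2 S).add (hμ2 T)).congr' ?_)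
    filter_upwards [hpos, hlt, hLpos] with s h1 h2 h3
    rw [← add_div]
    congr 1
    unfold LL
    rw [← (h.wv_summable hB0 ht h1 h2 S).tsum_add (h.wv_summable hB0 ht h1 h2 T)]
    refine tsum_congr (fun n => ?_)
    rw [h.wv_union n hST, add_mul]
  · intro S hS hinj
    have key : μ S = B⁻¹ * μ (f '' S) := by
      have h0 : Filter.Tendsto (fun s => wv a b f m t 0 S / LL a b f m t s (Icc a b))
          (U : Filter ℝ) (nhds 0) := hlim.const_div_atTop _
      have h1 := h0.add (hUs.mul (hμ2 (f '' S)))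
      rw [zero_add] at h1
      refine tendsto_nhds_unique (hμ2 S) (h1.congr' ?_)
      filter_upwards [hpos, hlt, hLpos] with s h1 h2 h3
      rw [← mul_div_assoc, ← add_div]
      congr 1
      unfold LL
      rw [(h.wv_summable hB0 ht h1 h2 S).tsum_eq_zero_add, pow_zero, mul_one, ← tsum_mul_left]
      congr 1
      refine tsum_congr (fun n => ?_)
      rw [h.wv_succ n hS hinj]
      ring
    rw [key]; field_simp

end PM

/-- A finitely additive conformal probability. -/
structure CM (a b : ℝ) (f : ℝ → ℝ) (B : ℝ) (μ : Set ℝ → ℝ) : Prop where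
  hB : 1 < B
  nonneg : ∀ S, 0 ≤ μ S
  one : μ (Icc a b) = 1
  mono : ∀ S T, S ⊆ T → μ S ≤ μ T
  add : ∀ S T, Disjoint S T → μ (S ∪ T) = μ S + μ T
  conf : ∀ S, S ⊆ Icc a b → InjOn f S → μ (f '' S) = B * μ S

/-- One-sided germs and points. -/
def Germ (a b : ℝ) (F : Filter ℝ) : Prop :=
  (∃ x ∈ Ico a b, F = nhdsWithin x (Ioi x)) ∨ (∃ x ∈ Ioc a b, F = nhdsWithin x (Iio x)) ∨
    ∃ x ∈ Icc a b, F = pure x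

lemma germ_right {g : ℝ → ℝ} {x v : ℝ} (hxv : x < v) (hg : StrictMonoOn g (Ioo x v))
    (hb : BddBelow (g '' Ioo x v)) :
    ∃ y, Filter.Tendsto g (nhdsWithin x (Ioi x)) (nhdsWithin y (Ioi y)) := by
  refine ⟨sInf (g '' Ioo x v), ?_⟩
  rw [tendsto_nhdsWithin_iff]
  refine ⟨MonotoneOn.tendsto_nhdsWithin_Ioo_right (nonempty_Ioo.2 hxv) hg.monotoneOn hb, ?_⟩
  filter_upwards [Ioo_mem_nhdsGT hxv] with z hz
  obtain ⟨w, hw1, hw2⟩ := exists_between hz.1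
  have hw : w ∈ Ioo x v := ⟨hw1, hw2.trans hz.2⟩
  exact (csInf_le hb ⟨w, hw, rfl⟩).trans_lt (hg hw hz hw2)

lemma germ_left {g : ℝ → ℝ} {u x : ℝ} (hux : u < x) (hg : StrictMonoOn g (Ioo u x))
    (hb : BddAbove (g '' Ioo u x)) :
    ∃ y, Filter.Tendsto g (nhdsWithin x (Iio x)) (nhdsWithin y (Iio y)) := by
  refine ⟨sSup (g '' Ioo u x), ?_⟩
  rw [tendsto_nhdsWithin_iff]
  refine ⟨MonotoneOn.tendsto_nhdsWithin_Ioo_left (nonempty_Ioo.2 hux) hg.monotoneOn hb, ?_⟩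
  filter_upwards [Ioo_mem_nhdsLT hux] with z hz
  obtain ⟨w, hw1, hw2⟩ := exists_between hz.2
  have hw : w ∈ Ioo u x := ⟨hz.1.trans hw1, hw2⟩
  exact (hg hz hw hw1).trans_le (le_csSup hb ⟨w, hw, rfl⟩)

lemma germ_loc {a b : ℝ} {g : ℝ → ℝ} {F : Filter ℝ} [F.NeBot]
    (hF : ∀ᶠ x in F, g x ∈ Icc a b) {y : ℝ}
    (hy : Filter.Tendsto g F (nhdsWithin y (Ioi y)) ∨ Filter.Tendsto g F (nhdsWithin y (Iio y))) :
    ∃ F', Germ a b F' ∧ Filter.Tendsto g F F' := by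
  have hlim : Filter.Tendsto g F (nhds y) := by
    rcases hy with hy | hy <;> exact hy.mono_right nhdsWithin_le_nhds
  have hyI : y ∈ Icc a b := isClosed_Icc.mem_of_tendsto hlim hF
  rcases hy with hy | hy
  · refine ⟨_, Or.inl ⟨y, ⟨hyI.1, ?_⟩, rfl⟩, hy⟩
    obtain ⟨x, h1, h2⟩ := ((tendsto_nhdsWithin_iff.1 hy).2.and hF).exists
    exact lt_of_lt_of_le h1 h2.2
  · refine ⟨_, Or.inr (Or.inl ⟨y, ⟨?_, hyI.2⟩, rfl⟩), hy⟩
    obtain ⟨x, h1, h2⟩ := ((tendsto_nhdsWithin_iff.1 hy).2.and hF).exists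
    exact lt_of_le_of_lt h2.1 h1

namespace PM

variable {a b : ℝ} {f : ℝ → ℝ} {m : ℕ} {t : ℕ → ℝ}

lemma right_nbhd (h : PM a b f m t) {x : ℝ} (hx : x ∈ Ico a b) :
    ∃ v, x < v ∧ ∃ i < m, Ioo x v ⊆ Ioo (t i) (t (i + 1)) := by
  have hfin : ((PP m t : Set ℝ) \ {x}).Finite := (Finset.finite_toSet _).subset sdiff_subset
  have hopen : IsOpen ((PP m t : Set ℝ) \ {x})ᶜ := hfin.isClosed.isOpen_compl
  obtain ⟨ε, hε, hball⟩ := Metric.isOpen_iff.1 hopen x (by simp)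
  have hlt : x < min (x + ε) b := lt_min (by linarith) hx.2
  refine ⟨min (x + ε) b, hlt, ?_⟩
  refine h.exists_lap_set ordConnected_Ioo ?_ ?_ (nonempty_Ioo.2 hlt)
  · intro z hz
    exact ⟨hx.1.trans hz.1.le, hz.2.le.trans (min_le_right _ _)⟩
  · intro z hz hzP
    have hz2 : z < x + ε := hz.2.trans_le (min_le_left _ _)
    have : z ∈ Metric.ball x ε := by
      rw [Metric.mem_ball, Real.dist_eq, abs_of_pos (by linarith [hz.1])]; linarith
    exact hball this ⟨hzP, hz.1.ne'⟩

lemma left_nbhd (h : PM a b f m t) {x : ℝ} (hx : x ∈ Ioc a b) :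
    ∃ v, v < x ∧ ∃ i < m, Ioo v x ⊆ Ioo (t i) (t (i + 1)) := by
  have hfin : ((PP m t : Set ℝ) \ {x}).Finite := (Finset.finite_toSet _).subset sdiff_subset
  have hopen : IsOpen ((PP m t : Set ℝ) \ {x})ᶜ := hfin.isClosed.isOpen_compl
  obtain ⟨ε, hε, hball⟩ := Metric.isOpen_iff.1 hopen x (by simp)
  have hlt : max (x - ε) a < x := max_lt (by linarith) hx.1
  refine ⟨max (x - ε) a, hlt, ?_⟩
  refine h.exists_lap_set ordConnected_Ioo ?_ ?_ (nonempty_Ioo.2 hlt)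
  · intro z hz
    exact ⟨(le_max_right _ _).trans hz.1.le, hz.2.le.trans hx.2⟩
  · intro z hz hzP
    have hz2 : x - ε < z := (le_max_left _ _).trans_lt hz.1
    have : z ∈ Metric.ball x ε := by
      rw [Metric.mem_ball, Real.dist_eq, abs_of_neg (by linarith [hz.2])]; linarith
    exact hball this ⟨hzP, hz.2.ne⟩

lemma strict_of (h : PM a b f m t) {i : ℕ} (hi : i < m) {C : Set ℝ}
    (hC : C ⊆ Ioo (t i) (t (i + 1))) : StrictMonoOn f C ∨ StrictMonoOn (fun x => - f x) C := by
  have hinj := (h.lap_inj hi).mono hC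
  rcases (h.hlap i hi).2 with h2 | h2
  · left
    intro x hx y hy hxy
    exact lt_of_le_of_ne (h2 (hC hx) (hC hy) hxy.le) (fun e => hxy.ne (hinj hx hy e))
  · right
    intro x hx y hy hxy
    exact neg_lt_neg (lt_of_le_of_ne (h2 (hC hx) (hC hy) hxy.le) (fun e => hxy.ne' (hinj hy hx e)))

lemma germ_step (h : PM a b f m t) {F : Filter ℝ} (hF : Germ a b F) :
    (∃ F', Germ a b F' ∧ Filter.Tendsto f F F') ∧ ∃ S ∈ F, S ⊆ Icc a b ∧ InjOn f S := by
  have hneg1 : ∀ {G : Filter ℝ} {y : ℝ}, Filter.Tendsto (fun x => - f x) G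
      (nhdsWithin y (Ioi y)) → Filter.Tendsto f G (nhdsWithin (-y) (Iio (-y))) := by
    intro G y hG
    have := (tendsto_neg_nhdsGT (a := y)).comp hG
    simpa [Function.comp_def] using this
  have hneg2 : ∀ {G : Filter ℝ} {y : ℝ}, Filter.Tendsto (fun x => - f x) G
      (nhdsWithin y (Iio y)) → Filter.Tendsto f G (nhdsWithin (-y) (Ioi (-y))) := by
    intro G y hG
    have := (tendsto_neg_nhdsLT (a := y)).comp hG
    simpa [Function.comp_def] using this
  rcases hF with ⟨x, hx, rfl⟩ | ⟨x, hx, rfl⟩ | ⟨x, hx, rfl⟩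
  · obtain ⟨v, hv, i, hi, hsub⟩ := h.right_nbhd hx
    have hI : Ioo x v ⊆ Icc a b := hsub.trans (h.lap_sub hi)
    refine ⟨?_, Ioo x v, Ioo_mem_nhdsGT hv, hI, (h.lap_inj hi).mono hsub⟩
    have hev : ∀ᶠ z in nhdsWithin x (Ioi x), f z ∈ Icc a b := by
      filter_upwards [Ioo_mem_nhdsGT hv] with z hz using h.hf (hI hz)
    rcases h.strict_of hi hsub with h2 | h2
    · obtain ⟨y, hy⟩ := germ_right hv h2 ⟨a, by rintro _ ⟨z, hz, rfl⟩; exact (h.hf (hI hz)).1⟩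
      exact germ_loc hev (Or.inl hy)
    · obtain ⟨y, hy⟩ := germ_right hv h2
        ⟨-b, by rintro _ ⟨z, hz, rfl⟩; exact neg_le_neg (h.hf (hI hz)).2⟩
      exact germ_loc hev (Or.inr (hneg1 hy))
  · obtain ⟨v, hv, i, hi, hsub⟩ := h.left_nbhd hx
    have hI : Ioo v x ⊆ Icc a b := hsub.trans (h.lap_sub hi)
    refine ⟨?_, Ioo v x, Ioo_mem_nhdsLT hv, hI, (h.lap_inj hi).mono hsub⟩
    have hev : ∀ᶠ z in nhdsWithin x (Iio x), f z ∈ Icc a b := by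
      filter_upwards [Ioo_mem_nhdsLT hv] with z hz using h.hf (hI hz)
    rcases h.strict_of hi hsub with h2 | h2
    · obtain ⟨y, hy⟩ := germ_left hv h2 ⟨b, by rintro _ ⟨z, hz, rfl⟩; exact (h.hf (hI hz)).2⟩
      exact germ_loc hev (Or.inr hy)
    · obtain ⟨y, hy⟩ := germ_left hv h2
        ⟨-a, by rintro _ ⟨z, hz, rfl⟩; exact neg_le_neg (h.hf (hI hz)).1⟩
      exact germ_loc hev (Or.inl (hneg2 hy))
  · refine ⟨⟨pure (f x), Or.inr (Or.inr ⟨f x, h.hf hx, rfl⟩), ?_⟩, {x}, by simp, by simpa using hx,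
      injOn_singleton _ _⟩
    exact Filter.tendsto_pure_pure f x

variable {B : ℝ} {μ : Set ℝ → ℝ}

lemma germ_small (h : PM a b f m t) (c : CM a b f B μ) {F : Filter ℝ} (hF : Germ a b F)
    {ε : ℝ} (hε : 0 < ε) : ∃ S ∈ F, μ S < ε := by
  by_contra hcon
  push Not at hcon
  have hB0 : 0 < B := by linarith [c.hB]
  have key : ∀ n : ℕ, ∃ G, Germ a b G ∧ ∀ S ∈ G, B ^ n * ε ≤ μ S := by
    intro n
    induction n with
    | zero => exact ⟨F, hF, by simpa using hcon⟩
    | succ n ih =>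
      obtain ⟨G, hG, hG2⟩ := ih
      obtain ⟨⟨G', hG', hGG'⟩, S, hS, hSI, hinj⟩ := h.germ_step hG
      refine ⟨G', hG', fun T hT => ?_⟩
      have hmem : S ∩ f ⁻¹' T ∈ G := Filter.inter_mem hS (hGG' hT)
      have h1 := hG2 _ hmem
      have h2 := c.conf (S ∩ f ⁻¹' T) (inter_subset_left.trans hSI) (hinj.mono inter_subset_left)
      have h3 : μ (f '' (S ∩ f ⁻¹' T)) ≤ μ T :=
        c.mono _ _ (by rintro _ ⟨x, hx, rfl⟩; exact hx.2)
      calc B ^ (n + 1) * ε = B * (B ^ n * ε) := by ring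
        _ ≤ B * μ (S ∩ f ⁻¹' T) := mul_le_mul_of_nonneg_left h1 hB0.le
        _ ≤ μ T := by rw [← h2]; exact h3
  obtain ⟨n, hn⟩ := pow_unbounded_of_one_lt ε⁻¹ c.hB
  obtain ⟨G, hG, hG2⟩ := key n
  obtain ⟨-, S, hS, hSI, -⟩ := h.germ_step hG
  have h1 := (hG2 S hS).trans ((c.mono _ _ hSI).trans c.one.le)
  have h2 : 1 < B ^ n * ε := by
    rwa [inv_lt_iff_one_lt_mul₀ hε] at hn
  linarith

lemma single (h : PM a b f m t) (c : CM a b f B μ) {x : ℝ} (hx : x ∈ Icc a b) : μ {x} = 0 := by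
  apply le_antisymm _ (c.nonneg _)
  refine le_of_forall_pos_le_add (fun ε hε => ?_)
  obtain ⟨S, hS, hS2⟩ := h.germ_small c (Or.inr (Or.inr ⟨x, hx, rfl⟩)) hε
  have : μ {x} ≤ μ S := c.mono _ _ (by simpa using hS)
  linarith

/-- The conjugacy. -/
def psi (a : ℝ) (μ : Set ℝ → ℝ) (x : ℝ) : ℝ := μ (Icc a x)

lemma psi_a (h : PM a b f m t) (c : CM a b f B μ) : psi a μ a = 0 := by
  unfold psi
  rw [Icc_self]; exact h.single c (left_mem_Icc.2 h.hab.le)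

lemma psi_b (c : CM a b f B μ) : psi a μ b = 1 := c.one

lemma meas_Icc (h : PM a b f m t) (c : CM a b f B μ) {x y : ℝ} (hx : a ≤ x) (hxy : x ≤ y)
    (hy : y ≤ b) : μ (Icc x y) = psi a μ y - psi a μ x := by
  have h1 : μ (Icc a y) = μ (Icc a x) + μ (Ioc x y) := by
    rw [← c.add, Icc_union_Ioc_eq_Icc hx hxy]
    rw [Set.disjoint_left]; intro z hz hz2; exact absurd hz2.1 (not_lt.2 hz.2)
  have h2 : μ (Icc x y) = μ (Ioc x y) + μ {x} := by
    rw [← c.add, Ioc_union_left hxy]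
    simp
  rw [h.single c ⟨hx, hxy.trans hy⟩] at h2
  unfold psi
  linarith

lemma meas_Ioo (h : PM a b f m t) (c : CM a b f B μ) {x y : ℝ} (hx : a ≤ x) (hxy : x < y)
    (hy : y ≤ b) : μ (Ioo x y) = psi a μ y - psi a μ x := by
  rw [← h.meas_Icc c hx hxy.le hy]
  have h2 : μ (Icc x y) = μ (Ico x y) + μ {y} := by
    rw [← c.add, Ico_union_right hxy.le]
    simp
  have h3 : μ (Ico x y) = μ (Ioo x y) + μ {x} := by
    rw [← c.add, Ioo_union_left hxy]
    simp
  rw [h.single c ⟨hx, hxy.le.trans hy⟩] at h3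
  rw [h.single c ⟨hx.trans hxy.le, hy⟩] at h2
  linarith

lemma psi_mono (c : CM a b f B μ) : Monotone (psi a μ) :=
  fun x y hxy => c.mono _ _ (Icc_subset_Icc_right hxy)

lemma psi_cont (h : PM a b f m t) (c : CM a b f B μ) : ContinuousOn (psi a μ) (Icc a b) := by
  intro x hx
  rw [Metric.continuousWithinAt_iff]
  intro ε hε
  have hr : ∃ u > x, ∀ y ∈ Icc a b, x < y → y < u → psi a μ y - psi a μ x < ε := by
    rcases eq_or_lt_of_le hx.2 with e | e
    · exact ⟨x + 1, by linarith, fun y hy h1 _ => absurd hy.2 (not_le.2 (e ▸ h1))⟩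
    · obtain ⟨S, hS, hS2⟩ := h.germ_small c (Or.inl ⟨x, ⟨hx.1, e⟩, rfl⟩) hε
      obtain ⟨u, hu, hu2⟩ := mem_nhdsGT_iff_exists_Ioo_subset.1 hS
      refine ⟨u, hu, fun y hy h1 h2 => ?_⟩
      rw [← h.meas_Ioo c hx.1 h1 hy.2]
      exact (c.mono _ _ ((Ioo_subset_Ioo_right h2.le).trans hu2)).trans_lt hS2
  have hl : ∃ u < x, ∀ y ∈ Icc a b, y < x → u < y → psi a μ x - psi a μ y < ε := by
    rcases eq_or_lt_of_le hx.1 with e | e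
    · exact ⟨x - 1, by linarith, fun y hy h1 _ => absurd hy.1 (not_le.2 (e ▸ h1))⟩
    · obtain ⟨S, hS, hS2⟩ := h.germ_small c (Or.inr (Or.inl ⟨x, ⟨e, hx.2⟩, rfl⟩)) hε
      obtain ⟨u, hu, hu2⟩ := mem_nhdsLT_iff_exists_Ioo_subset.1 hS
      refine ⟨u, hu, fun y hy h1 h2 => ?_⟩
      rw [← h.meas_Ioo c hy.1 h1 hx.2]
      exact (c.mono _ _ ((Ioo_subset_Ioo_left h2.le).trans hu2)).trans_lt hS2
  obtain ⟨u, hu, hu2⟩ := hr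
  obtain ⟨v, hv, hv2⟩ := hl
  refine ⟨min (u - x) (x - v), lt_min (by linarith) (by linarith), fun y hy hd => ?_⟩
  rw [Real.dist_eq] at hd ⊢
  have hd1 := abs_lt.1 (hd.trans_le (min_le_left _ _))
  have hd2 := abs_lt.1 (hd.trans_le (min_le_right _ _))
  rcases lt_trichotomy x y with h1 | h1 | h1
  · rw [abs_of_nonneg (sub_nonneg.2 (psi_mono c h1.le))]
    exact hu2 y hy h1 (by linarith)
  · rw [h1]; simpa using hε
  · rw [abs_sub_comm, abs_of_nonneg (sub_nonneg.2 (psi_mono c h1.le))]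
    exact hv2 y hy h1 (by linarith)

lemma slope_le (h : PM a b f m t) (c : CM a b f B μ) {i : ℕ} (hi : i < m) {x y : ℝ}
    (hx : x ∈ Ioo (t i) (t (i + 1))) (hy : y ∈ Ioo (t i) (t (i + 1))) (hxy : x ≤ y) :
    |psi a μ (f x) - psi a μ (f y)| = B * |psi a μ x - psi a μ y| := by
  have hsub : Icc x y ⊆ Ioo (t i) (t (i + 1)) := ordConnected_Ioo.out hx hy
  have hxI := h.lap_sub hi hx
  have hyI := h.lap_sub hi hy
  have hconf := c.conf (Icc x y) (hsub.trans (h.lap_sub hi)) ((h.lap_inj hi).mono hsub)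
  rw [h.meas_Icc c hxI.1 hxy hyI.2] at hconf
  rw [abs_sub_comm (psi a μ x), abs_of_nonneg (sub_nonneg.2 (psi_mono c hxy)), ← hconf]
  have hcont := (h.hlap i hi).1.mono hsub
  rcases (h.hlap i hi).2 with h2 | h2
  · have him : f '' Icc x y = Icc (f x) (f y) := by
      apply Subset.antisymm
      · rintro _ ⟨z, hz, rfl⟩
        exact ⟨h2 hx (hsub hz) hz.1, h2 (hsub hz) hy hz.2⟩
      · exact intermediate_value_Icc hxy hcont
    have hle := h2 hx hy hxy
    rw [him, h.meas_Icc c (h.hf hxI).1 hle (h.hf hyI).2, abs_sub_comm,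
      abs_of_nonneg (sub_nonneg.2 (psi_mono c hle))]
  · have him : f '' Icc x y = Icc (f y) (f x) := by
      apply Subset.antisymm
      · rintro _ ⟨z, hz, rfl⟩
        exact ⟨h2 (hsub hz) hy hz.2, h2 hx (hsub hz) hz.1⟩
      · exact intermediate_value_Icc' hxy hcont
    have hle := h2 hx hy hxy
    rw [him, h.meas_Icc c (h.hf hyI).1 hle (h.hf hxI).2,
      abs_of_nonneg (sub_nonneg.2 (psi_mono c hle))]

lemma slope (h : PM a b f m t) (c : CM a b f B μ) {i : ℕ} (hi : i < m) {x y : ℝ}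
    (hx : x ∈ Ioo (t i) (t (i + 1))) (hy : y ∈ Ioo (t i) (t (i + 1))) :
    |psi a μ (f x) - psi a μ (f y)| = B * |psi a μ x - psi a μ y| := by
  rcases le_total x y with hxy | hxy
  · exact h.slope_le c hi hx hy hxy
  · rw [abs_sub_comm, abs_sub_comm (psi a μ x)]
    exact h.slope_le c hi hy hx hxy

lemma fin_range {y : ℕ → ℝ} {l : ℕ → ℕ} {M : ℕ} (hl : ∀ n, l n < M) {Y : Set ℝ} (hY : Y.Finite)
    (hinf : ∀ N, ∃ n ≥ N, y n ∈ Y)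
    (hdet : ∀ n k, y n = y k → (y n ∉ Y ∨ l n = l k) → y (n + 1) = y (k + 1)) :
    (Set.range y).Finite := by
  classical
  let st : ℕ → ℝ × ℕ := fun n => (y n, l n)
  have hQ : ((Y ×ˢ Set.Iio M) ∩ Set.range st).Finite :=
    (hY.prod (Set.finite_Iio M)).subset inter_subset_left
  have hch : ∀ q : ℝ × ℕ, ∃ n, q ∈ Set.range st → st n = q := by
    intro q
    by_cases hq : q ∈ Set.range st
    · obtain ⟨n, hn⟩ := hq; exact ⟨n, fun _ => hn⟩
    · exact ⟨0, fun hq' => absurd hq' hq⟩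
  choose τ hτ using hch
  obtain ⟨N, hN⟩ := (hQ.image τ).bddAbove
  obtain ⟨K, hK, hKY⟩ := hinf (N + 1)
  have hinv : ∀ n, ∃ k < K, y n = y k ∧ (y n ∉ Y ∨ l n = l k) := by
    intro n
    induction n with
    | zero => exact ⟨0, by omega, rfl, Or.inr rfl⟩
    | succ n ih =>
      obtain ⟨k, hk, h1, h2⟩ := ih
      have h3 := hdet n k h1 h2
      by_cases hy : y (n + 1) ∈ Y
      · have hr : st (n + 1) ∈ Set.range st := ⟨_, rfl⟩
        have h4 := hτ _ hr
        have h5 : τ (st (n + 1)) ≤ N :=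
          hN ⟨st (n + 1), ⟨⟨hy, hl (n + 1)⟩, hr⟩, rfl⟩
        exact ⟨τ (st (n + 1)), by omega, (congrArg Prod.fst h4).symm,
          Or.inr (congrArg Prod.snd h4).symm⟩
      · refine ⟨k + 1, ?_, h3, Or.inl hy⟩
        have : k + 1 ≠ K := by
          intro e
          rw [h3, e] at hy
          exact hy hKY
        omega
  refine ((Set.finite_Iio K).image y).subset ?_
  rintro _ ⟨n, rfl⟩
  obtain ⟨k, hk, h1, -⟩ := hinv n
  exact ⟨k, hk, h1.symm⟩

lemma psi_strict (h : PM a b f m t) (c : CM a b f B μ) : StrictMonoOn (psi a μ) (Icc a b) := by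
  intro p hp q hq hpq
  by_contra hcon
  have heq : psi a μ p = psi a μ q := le_antisymm (psi_mono c hpq.le) (not_lt.1 hcon)
  obtain ⟨x₀, hx₀, -, hP, hd⟩ := h.orbit
  have hlab : ∀ n, ∃ i, i < m ∧ f^[n] x₀ ∈ Ioo (t i) (t (i + 1)) := by
    intro n
    obtain ⟨i, hi, hi2⟩ := h.exists_lap (h.iter_mem hx₀ n) (hP n)
    exact ⟨i, hi, hi2⟩
  choose l hl hl2 using hlab
  set Y : Set ℝ := psi a μ '' (PP m t : Set ℝ) ∪ {psi a μ p} with hY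
  have hYf : Y.Finite := ((Finset.finite_toSet _).image _).union (finite_singleton _)
  have hfin : (Set.range fun n => psi a μ (f^[n] x₀)).Finite := by
    refine fin_range hl hYf ?_ ?_
    · intro N
      obtain ⟨n, hn, hn2⟩ := hd p q hp.1 hpq hq.2 N
      refine ⟨n, hn, Or.inr ?_⟩
      exact le_antisymm ((psi_mono c hn2.2.le).trans heq.ge) (psi_mono c hn2.1.le)
    · intro n k hnk hor
      have hsep : ∀ i j, l i < l j → psi a μ (f^[i] x₀) = psi a μ (f^[j] x₀) →
          psi a μ (f^[i] x₀) ∈ Y := by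
        intro i j hij he
        refine Or.inl ⟨t (l i + 1), PM.mem_PP.2 ⟨l i + 1, hl i, rfl⟩, ?_⟩
        have h1 : t (l i + 1) ≤ f^[j] x₀ := (h.tmono hij (hl j).le).trans (hl2 j).1.le
        exact le_antisymm ((psi_mono c h1).trans he.ge) (psi_mono c (hl2 i).2.le)
      have hlk : l n = l k := by
        rcases hor with h1 | h1
        · rcases lt_trichotomy (l n) (l k) with h2 | h2 | h2
          · exact absurd (hsep n k h2 hnk) h1
          · exact h2
          · exact absurd (hnk ▸ hsep k n h2 hnk.symm) h1
        · exact h1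
      have hs := h.slope c (hl n) (hl2 n) (hlk ▸ hl2 k)
      rw [hnk, sub_self, abs_zero, mul_zero, abs_eq_zero, sub_eq_zero] at hs
      simpa only [Function.iterate_succ_apply'] using hs
  set Fs := Set.range fun n => psi a μ (f^[n] x₀)
  obtain ⟨y, hy1, hy2⟩ := ((Set.Ioo_infinite (zero_lt_one (α := ℝ))).sdiff hfin).nonempty
  have hopen : IsOpen (Ioo (0 : ℝ) 1 ∩ Fsᶜ) := isOpen_Ioo.inter hfin.isClosed.isOpen_compl
  obtain ⟨ε, hε, hball⟩ := Metric.isOpen_iff.1 hopen y ⟨hy1, hy2⟩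
  have hin : ∀ z ∈ Icc y (y + ε / 2), z ∈ Ioo (0 : ℝ) 1 ∩ Fsᶜ := by
    intro z hz
    apply hball
    rw [Metric.mem_ball, Real.dist_eq, abs_of_nonneg (by linarith [hz.1])]
    linarith [hz.2]
  have hivt := intermediate_value_Icc h.hab.le (h.psi_cont c)
  rw [h.psi_a c, psi_b c] at hivt
  have hz1 := hin y ⟨le_rfl, by linarith⟩
  have hz2 := hin (y + ε / 2) ⟨by linarith, le_rfl⟩
  obtain ⟨u, hu, hu2⟩ := hivt (Ioo_subset_Icc_self hz1.1)
  obtain ⟨v, hv, hv2⟩ := hivt (Ioo_subset_Icc_self hz2.1)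
  have huv : u < v := by
    by_contra hle
    have := psi_mono c (not_lt.1 hle)
    linarith
  obtain ⟨n, -, hn⟩ := hd u v hu.1 huv hv.2 0
  refine (hin (psi a μ (f^[n] x₀)) ⟨?_, ?_⟩).2 ⟨n, rfl⟩
  · rw [← hu2]; exact psi_mono c hn.1.le
  · rw [← hv2]; exact psi_mono c hn.2.le

lemma conf_iter (h : PM a b f m t) (c : CM a b f B μ) (n : ℕ) : ∀ S, S ⊆ Icc a b →
    InjOn (f^[n]) S → μ (f^[n] '' S) = B ^ n * μ S := by
  induction n with
  | zero => intro S _ _; simp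
  | succ n ih =>
    intro S hS hinj
    rw [Function.iterate_succ] at hinj ⊢
    have h1 : InjOn f S := hinj.of_comp
    have h2 : InjOn (f^[n]) (f '' S) := by
      rintro _ ⟨x, hx, rfl⟩ _ ⟨y, hy, rfl⟩ he
      rw [hinj hx hy he]
    rw [image_comp, ih (f '' S) (by rintro _ ⟨x, hx, rfl⟩; exact h.hf (hS hx)) h2, c.conf S hS h1]
    ring

lemma le_lapCount (h : PM a b f m t) (c : CM a b f B μ) {n : ℕ} (hn : 0 < n) :
    B ^ n ≤ lapCount f a b n := by
  have hB0 : 0 < B := by linarith [c.hB]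
  obtain ⟨hk, u, hu0, huk, hult, hu⟩ := Nat.sInf_mem ⟨_, h.lap_set_mem hn⟩
  change 0 < lapCount f a b n at hk
  change u (lapCount f a b n) = b at huk
  change ∀ j < lapCount f a b n, _ at hult
  change ∀ j < lapCount f a b n, _ at hu
  set k := lapCount f a b n
  have humono : ∀ i j, i ≤ j → j ≤ k → u i ≤ u j := by
    intro i j hij
    induction j, hij using Nat.le_induction with
    | base => exact fun _ => le_rfl
    | succ j hj ih => exact fun hjk => (ih (by omega)).trans (hult j (by omega)).le
  have hbound : ∀ j ∈ Finset.range k, psi a μ (u (j + 1)) - psi a μ (u j) ≤ (B ^ n)⁻¹ := by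
    intro j hj
    have hj := Finset.mem_range.1 hj
    have h1 : a ≤ u j := hu0 ▸ humono 0 j (Nat.zero_le _) hj.le
    have h2 : u (j + 1) ≤ b := huk ▸ humono (j + 1) k hj le_rfl
    have hI : Ioo (u j) (u (j + 1)) ⊆ Icc a b :=
      fun z hz => ⟨h1.trans hz.1.le, hz.2.le.trans h2⟩
    rw [← h.meas_Ioo c h1 (hult j hj) h2]
    have h3 := h.conf_iter c n _ hI (h.injOn_of_mono n ordConnected_Ioo hI (hu j hj).2)
    have h4 : μ (f^[n] '' Ioo (u j) (u (j + 1))) ≤ 1 := by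
      rw [← c.one]
      exact c.mono _ _ (by rintro _ ⟨x, hx, rfl⟩; exact h.iter_mem (hI hx) n)
    rw [h3] at h4
    rw [← one_div, le_div_iff₀ (by positivity)]
    linarith
  have hsum := Finset.sum_le_sum hbound
  rw [Finset.sum_range_sub (fun j => psi a μ (u j)), huk, hu0, h.psi_a c, psi_b c] at hsum
  rw [Finset.sum_const, Finset.card_range, nsmul_eq_mul, sub_zero, ← div_eq_mul_inv,
    le_div_iff₀ (by positivity), one_mul] at hsum
  exact hsum

end PM

/-- Main Corollary: a transitive piecewise monotone map `f : I → I` with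
entropy `lim (1/n) log c_n(f) = log β`, `β > 1`, is conjugate via an increasing
homeomorphism `ψ : I → [0,1]` to a map `g = ψ ∘ f ∘ ψ⁻¹` of constant slope `β`. -/
theorem stmt_9 {a b : ℝ} (hab : a < b) (f : ℝ → ℝ) {β : ℝ} (hβ : 1 < β)
    (hf : MapsTo f (Icc a b) (Icc a b))
    (m : ℕ) (t : ℕ → ℝ) (hm : 0 < m)
    (ht0 : t 0 = a) (htm : t m = b)
    (htlt : ∀ i < m, t i < t (i + 1))
    (hlap : ∀ i < m, ContinuousOn f (Ioo (t i) (t (i + 1))) ∧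
      (MonotoneOn f (Ioo (t i) (t (i + 1))) ∨ AntitoneOn f (Ioo (t i) (t (i + 1)))))
    (htrans : ∃ x₀ ∈ Icc a b, Icc a b ⊆ closure (Set.range fun n : ℕ => f^[n] x₀))
    (hent : Filter.Tendsto (fun n : ℕ => Real.log (lapCount f a b n) / n)
      Filter.atTop (nhds (Real.log β))) :
    ∃ ψ g : ℝ → ℝ,
      -- `ψ` is an increasing homeomorphism of `I` onto `[0,1]`
      ContinuousOn ψ (Icc a b) ∧
      StrictMonoOn ψ (Icc a b) ∧
      BijOn ψ (Icc a b) (Icc 0 1) ∧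
      -- `g = ψ ∘ f ∘ ψ⁻¹` maps `[0,1]` into itself
      MapsTo g (Icc 0 1) (Icc 0 1) ∧
      (∀ x ∈ Icc a b, g (ψ x) = ψ (f x)) ∧
      -- `g` has constant slope `β`
      (∃ (r : ℕ) (s : ℕ → ℝ), 0 < r ∧ s 0 = 0 ∧ s r = 1 ∧
        (∀ j < r, s j < s (j + 1)) ∧
        ∀ j < r, ∀ u ∈ Ioo (s j) (s (j + 1)), ∀ v ∈ Ioo (s j) (s (j + 1)),
          |g u - g v| = β * |u - v|) := by
  have h : PM a b f m t := ⟨hab, hf, hm, ht0, htm, htlt, hlap, htrans⟩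
  obtain ⟨B, hB0, hBt, hBpc⟩ := h.exists_growth
  have hβB : β ≤ B := by
    rw [← Real.log_le_log_iff (by linarith) hB0]
    refine le_of_tendsto_of_tendsto hent hBt ?_
    filter_upwards [Filter.eventually_gt_atTop 0] with n hn
    refine div_le_div_of_nonneg_right ?_ (Nat.cast_nonneg _)
    rcases Nat.eq_zero_or_pos (lapCount f a b n) with h0 | h0
    · rw [h0, Nat.cast_zero, Real.log_zero]
      refine Real.log_nonneg ?_
      exact_mod_cast Nat.le_add_left 1 _
    · refine Real.log_le_log (by exact_mod_cast h0) ?_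
      exact_mod_cast h.lapCount_le hn
  have hB1 : 1 < B := by linarith
  obtain ⟨μ, hμ1, hμ2, hμ3, hμ4, hμ5⟩ := h.exists_measure hB1 hBt hBpc
  have c : CM a b f B μ := ⟨hB1, hμ1, hμ2, hμ3, hμ4, hμ5⟩
  have hBβ : B ≤ β := by
    rw [← Real.log_le_log_iff hB0 (by linarith)]
    refine ge_of_tendsto hent ?_
    filter_upwards [Filter.eventually_gt_atTop 0] with n hn
    rw [le_div_iff₀ (by exact_mod_cast hn), mul_comm, ← Real.log_pow]
    exact Real.log_le_log (by positivity) (h.le_lapCount c hn)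
  obtain rfl : B = β := le_antisymm hBβ hβB
  have hcont := h.psi_cont c
  have hstrict := h.psi_strict c
  have hmaps : MapsTo (PM.psi a μ) (Icc a b) (Icc 0 1) := by
    intro x hx
    rw [← h.psi_a c, ← PM.psi_b c]
    exact ⟨PM.psi_mono c hx.1, PM.psi_mono c hx.2⟩
  have hsurj : SurjOn (PM.psi a μ) (Icc a b) (Icc 0 1) := by
    have := intermediate_value_Icc hab.le hcont
    rwa [h.psi_a c, PM.psi_b c] at this
  have hinv : ∀ x ∈ Icc a b, Function.invFunOn (PM.psi a μ) (Icc a b) (PM.psi a μ x) = x :=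
    fun x hx => hstrict.injOn.leftInvOn_invFunOn hx
  have hg : ∀ x ∈ Icc a b, (fun y => PM.psi a μ (f (Function.invFunOn (PM.psi a μ) (Icc a b) y)))
      (PM.psi a μ x) = PM.psi a μ (f x) := by
    intro x hx
    simp only
    rw [hinv x hx]
  refine ⟨PM.psi a μ, fun y => PM.psi a μ (f (Function.invFunOn (PM.psi a μ) (Icc a b) y)),
    hcont, hstrict, ⟨hmaps, hstrict.injOn, hsurj⟩, ?_, hg, m, fun j => PM.psi a μ (t j), hm, ?_, ?_,
    ?_, ?_⟩
  · intro y hy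
    obtain ⟨x, hx, rfl⟩ := hsurj hy
    rw [hg x hx]
    exact hmaps (hf hx)
  · simp only [ht0]; exact h.psi_a c
  · simp only [htm]; exact PM.psi_b c
  · intro j hj
    exact hstrict (h.tmem hj.le) (h.tmem hj) (htlt j hj)
  · have hpre : ∀ j < m, ∀ u ∈ Ioo (PM.psi a μ (t j)) (PM.psi a μ (t (j + 1))),
        ∃ x ∈ Ioo (t j) (t (j + 1)), PM.psi a μ x = u := by
      intro j hj u hu
      obtain ⟨x, hx, rfl⟩ := hsurj
        ⟨(hmaps (h.tmem hj.le)).1.trans hu.1.le, hu.2.le.trans (hmaps (h.tmem hj)).2⟩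
      exact ⟨x, ⟨(hstrict.lt_iff_lt (h.tmem hj.le) hx).1 hu.1,
        (hstrict.lt_iff_lt hx (h.tmem hj)).1 hu.2⟩, rfl⟩
    intro j hj u hu v hv
    obtain ⟨x, hx, rfl⟩ := hpre j hj u hu
    obtain ⟨y, hy, rfl⟩ := hpre j hj v hv
    rw [hg x (h.lap_sub hj hx), hg y (h.lap_sub hj hy)]
    exact h.slope c hj hx hy
end

section
/- Let g : [0,1] → [0,1] be a continuous, transitive, piecewise monotone map of constant slope β (for some β > 0). Then g admits an ergodic g-invariant Borel probability measure μ on [0,1] which is equivalent to Lebesgue measure, i.e., μ and the Lebesgue measure on [0,1] are mutually absolutely continuous. -/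
open Set MeasureTheory Filter Topology
open scoped ENNReal

/-- `f` has slope `±β` on every interval in `[0,1]` whose interior avoids `S`. -/
def PW_s10 (S : Finset ℝ) (β : ℝ) (f : ℝ → ℝ) : Prop :=
  ∀ u v, 0 ≤ u → u ≤ v → v ≤ 1 → (∀ s ∈ S, s ∉ Ioo u v) → |f u - f v| = β * (v - u)

/-- splitting principle -/
lemma split_ind (S : Finset ℝ) (P : ℕ → ℝ → ℝ → Prop)
    (h0 : ∀ u v, 0 ≤ u → u ≤ v → v ≤ 1 → (∀ s ∈ S, s ∉ Ioo u v) → P 0 u v)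
    (hs : ∀ m n u w v, 0 ≤ u → u ≤ w → w ≤ v → v ≤ 1 → P m u w → P n w v → P (m + n + 1) u v) :
    ∀ N u v, 0 ≤ u → u ≤ v → v ≤ 1 → (S.filter (fun s => s ∈ Ioo u v)).card = N → P N u v := by
  intro N
  induction N using Nat.strong_induction_on with
  | _ N ih =>
    intro u v hu huv hv hN
    by_cases h : ∀ s ∈ S, s ∉ Ioo u v
    · have : N = 0 := by
        rw [← hN, Finset.card_eq_zero, Finset.filter_eq_empty_iff]
        intro s hs; exact h s hs
      subst this
      exact h0 u v hu huv hv h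
    · push Not at h
      obtain ⟨w, hwS, hw1, hw2⟩ := h
      have e : S.filter (fun s => s ∈ Ioo u v) =
          insert w ((S.filter (fun s => s ∈ Ioo u w)) ∪ (S.filter (fun s => s ∈ Ioo w v))) := by
        ext x
        simp only [Finset.mem_filter, Finset.mem_insert, Finset.mem_union, mem_Ioo]
        constructor
        · rintro ⟨a, b, c⟩
          rcases lt_trichotomy x w with h | h | h
          · exact Or.inr (Or.inl ⟨a, b, h⟩)
          · exact Or.inl h
          · exact Or.inr (Or.inr ⟨a, h, c⟩)
        · rintro (rfl | ⟨a, b, c⟩ | ⟨a, b, c⟩)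
          · exact ⟨hwS, hw1, hw2⟩
          · exact ⟨a, b, by linarith⟩
          · exact ⟨a, by linarith, c⟩
      have hd : Disjoint (S.filter (fun s => s ∈ Ioo u w)) (S.filter (fun s => s ∈ Ioo w v)) := by
        rw [Finset.disjoint_left]
        intro x hx hx'
        simp only [Finset.mem_filter, mem_Ioo] at hx hx'
        linarith [hx.2.2, hx'.2.1]
      have hc : N = (S.filter (fun s => s ∈ Ioo u w)).card
          + (S.filter (fun s => s ∈ Ioo w v)).card + 1 := by
        rw [← hN, e, Finset.card_insert_of_notMem, Finset.card_union_of_disjoint hd]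
        simp
      rw [hc]
      exact hs _ _ u w v hu hw1.le hw2.le hv
        (ih _ (by omega) u w hu hw1.le (by linarith) rfl)
        (ih _ (by omega) w v (by linarith) hw2.le hv rfl)

lemma PW_s10.affine {S : Finset ℝ} {β : ℝ} {f : ℝ → ℝ} (h : PW_s10 S β f) {u v : ℝ}
    (hβ : 0 < β) (hu : 0 ≤ u) (huv : u ≤ v) (hv : v ≤ 1) (hS : ∀ s ∈ S, s ∉ Ioo u v) :
    ∃ c d : ℝ, |c| = β ∧ ∀ x ∈ Icc u v, f x = c * x + d := by
  have h1 : ∀ x ∈ Icc u v, |f u - f x| = β * (x - u) := fun x hx =>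
    h u x hu hx.1 (hx.2.trans hv) (fun s hs hx' => hS s hs ⟨hx'.1, hx'.2.trans_le hx.2⟩)
  have h2 : ∀ x ∈ Icc u v, |f x - f v| = β * (v - x) := fun x hx =>
    h x v (hu.trans hx.1) hx.2 hv (fun s hs hx' => hS s hs ⟨hx.1.trans_lt hx'.1, hx'.2⟩)
  have h3 := h u v hu huv hv hS
  rcases abs_cases (f u - f v) with ⟨h4, h5⟩ | ⟨h4, h5⟩
  · refine ⟨-β, f u + β * u, by rw [abs_neg, abs_of_pos hβ], fun x hx => ?_⟩
    have a1 := le_abs_self (f u - f x)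
    have a2 := le_abs_self (f x - f v)
    rw [h1 x hx] at a1; rw [h2 x hx] at a2
    nlinarith
  · refine ⟨β, f u - β * u, by rw [abs_of_pos hβ], fun x hx => ?_⟩
    have a1 := neg_abs_le (f u - f x)
    have a2 := neg_abs_le (f x - f v)
    rw [h1 x hx] at a1; rw [h2 x hx] at a2
    nlinarith

lemma PW_s10.lip {S : Finset ℝ} {β : ℝ} {f : ℝ → ℝ} (h : PW_s10 S β f) :
    ∀ u v, 0 ≤ u → u ≤ v → v ≤ 1 → |f u - f v| ≤ β * (v - u) := by
  intro u v hu huv hv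
  refine split_ind S (fun _ u v => |f u - f v| ≤ β * (v - u)) ?_ ?_ _ u v hu huv hv rfl
  · intro u v hu huv hv hS
    exact (h u v hu huv hv hS).le
  · intro m n u w v _ _ _ _ h1 h2
    have := abs_sub_le (f u) (f w) (f v)
    linarith

lemma PW_s10.finite {S : Finset ℝ} {β : ℝ} {f : ℝ → ℝ} (h : PW_s10 S β f) (hβ : 0 < β) (T : Finset ℝ) :
    (Icc 0 1 ∩ f ⁻¹' T).Finite := by
  refine split_ind S (fun _ u v => (Icc u v ∩ f ⁻¹' T).Finite) ?_ ?_ _ 0 1 le_rfl zero_le_one le_rfl rfl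
  · intro u v hu huv hv hS
    obtain ⟨c, d, hc, hx⟩ := h.affine hβ hu huv hv hS
    have hc0 : c ≠ 0 := by rintro rfl; simp at hc; linarith
    refine (Finset.finite_toSet (T.image (fun t => (t - d) / c))).subset ?_
    rintro x ⟨hxI, hxT⟩
    simp only [Finset.coe_image, mem_image]
    refine ⟨f x, hxT, ?_⟩
    rw [hx x hxI]; field_simp; ring
  · intro m n u w v _ h1 h2 _ h3 h4
    refine (h3.union h4).subset ?_
    rintro x ⟨hx, hT⟩
    rcases le_total x w with h | h
    · exact Or.inl ⟨⟨hx.1, h⟩, hT⟩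
    · exact Or.inr ⟨⟨h, hx.2⟩, hT⟩

lemma PW_s10.comp {S S' : Finset ℝ} {β γ : ℝ} {f h : ℝ → ℝ} (hf : PW_s10 S β f) (hh : PW_s10 S' γ h)
    (hβ : 0 < β) (hm : ∀ x, f x ∈ Icc (0:ℝ) 1) : ∃ S'', PW_s10 S'' (γ * β) (h ∘ f) := by
  classical
  refine ⟨S ∪ (hf.finite hβ S').toFinset, fun u v hu huv hv hS => ?_⟩
  have hS1 : ∀ s ∈ S, s ∉ Ioo u v := fun s hs => hS s (Finset.mem_union_left _ hs)
  have hS2 : ∀ x ∈ Ioo u v, f x ∉ S' := by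
    intro x hx hfx
    refine hS x (Finset.mem_union_right _ ?_) hx
    simp only [Finite.mem_toFinset]
    exact ⟨⟨hu.trans hx.1.le, hx.2.le.trans hv⟩, hfx⟩
  have e := hf u v hu huv hv hS1
  obtain ⟨c, d, hc, hx⟩ := hf.affine hβ hu huv hv hS1
  have hc0 : c ≠ 0 := by rintro rfl; simp at hc; linarith
  have eu := hx u ⟨le_rfl, huv⟩
  have ev := hx v ⟨huv, le_rfl⟩
  have key : ∀ s ∈ S', ∀ x, s = c * x + d → x ∉ Ioo u v := by
    intro s hs x hsx hxI
    refine hS2 x hxI ?_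
    rw [hx x ⟨hxI.1.le, hxI.2.le⟩, ← hsx]; exact hs
  have inv : ∀ s, s = c * ((s - d) / c) + d := by intro s; field_simp; ring
  simp only [Function.comp]
  rcases lt_or_gt_of_ne hc0 with hneg | hpos
  · have hcv : c = -β := by rw [abs_of_neg hneg] at hc; linarith
    have hle : f v ≤ f u := by rw [eu, ev]; nlinarith
    have := hh (f v) (f u) (hm v).1 hle (hm u).2 (by
      intro s hs hsI
      refine key s hs _ (inv s) ⟨?_, ?_⟩
      · rw [lt_div_iff_of_neg hneg]; rw [eu, ev] at hsI; linarith [hsI.2]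
      · rw [div_lt_iff_of_neg hneg]; rw [eu, ev] at hsI; linarith [hsI.1])
    rw [abs_sub_comm, this, eu, ev, hcv]; ring
  · have hcv : c = β := by rw [abs_of_pos hpos] at hc; linarith
    have hle : f u ≤ f v := by rw [eu, ev]; nlinarith
    have := hh (f u) (f v) (hm u).1 hle (hm v).2 (by
      intro s hs hsI
      refine key s hs _ (inv s) ⟨?_, ?_⟩
      · rw [lt_div_iff₀ hpos]; rw [eu, ev] at hsI; linarith [hsI.1]
      · rw [div_lt_iff₀ hpos]; rw [eu, ev] at hsI; linarith [hsI.2])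
    rw [this, eu, ev, hcv]; ring

lemma PW_s10.iterate {S : Finset ℝ} {β : ℝ} {f : ℝ → ℝ} (hf : PW_s10 S β f)
    (hβ : 0 < β) (hm : ∀ x, f x ∈ Icc (0:ℝ) 1) (n : ℕ) : ∃ S', PW_s10 S' (β ^ n) (f^[n]) := by
  induction n with
  | zero =>
    refine ⟨∅, fun u v hu huv hv _ => ?_⟩
    simp only [Function.iterate_zero, id, pow_zero, one_mul]
    rw [abs_sub_comm, abs_of_nonneg (by linarith)]
  | succ n ih =>
    obtain ⟨S', h⟩ := ih
    rw [Function.iterate_succ, pow_succ]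
    exact hf.comp h hβ hm

lemma sep_card (δ u : ℝ) (hδ : 0 < δ) (T : Finset ℝ) :
    ∀ v, (∀ s ∈ T, ∀ t ∈ T, s < t → δ ≤ t - s) → (∀ t ∈ T, u ≤ t ∧ t ≤ v) → u ≤ v + δ →
    (T.card : ℝ) ≤ 1 + (v - u) / δ := by
  induction T using Finset.induction_on_max with
  | empty =>
    intro v _ _ h
    have : 1 + (v - u) / δ = (v + δ - u) / δ := by field_simp; ring
    rw [this]; simp only [Finset.card_empty, Nat.cast_zero]
    exact div_nonneg (by linarith) hδ.le
  | insert x T hx ih =>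
    intro v hs hT _
    have hxv := hT x (Finset.mem_insert_self _ _)
    have := ih (x - δ) (fun s a t b => hs s (Finset.mem_insert_of_mem a) t (Finset.mem_insert_of_mem b))
      (fun t ht => ⟨(hT t (Finset.mem_insert_of_mem ht)).1, by
        have := hs t (Finset.mem_insert_of_mem ht) x (Finset.mem_insert_self _ _) (hx t ht)
        linarith⟩) (by linarith)
    rw [Finset.card_insert_of_notMem (fun h => lt_irrefl _ (hx x h))]
    push_cast
    have e : (x - δ - u) / δ = (x - u) / δ - 1 := by field_simp; ring
    have : (x - u) / δ ≤ (v - u) / δ := by gcongr; exact hxv.2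
    linarith

lemma exists_sep (S : Finset ℝ) : ∃ δ > 0, ∀ s ∈ S, ∀ t ∈ S, s < t → δ ≤ t - s := by
  classical
  let P := (S ×ˢ S).filter (fun p => p.1 < p.2)
  rcases P.eq_empty_or_nonempty with h | h
  · refine ⟨1, one_pos, fun s hs t ht hst => ?_⟩
    have : (s, t) ∈ P := by simp [P, hs, ht, hst]
    rw [h] at this; simp at this
  · obtain ⟨p, hp, hmin⟩ := Finset.exists_min_image P (fun p => p.2 - p.1) h
    refine ⟨p.2 - p.1, ?_, fun s hs t ht hst => hmin (s, t) (by simp [P, hs, ht, hst])⟩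
    simp only [P, Finset.mem_filter] at hp
    linarith [hp.2]

lemma vol_affine (c d : ℝ) (hc : c ≠ 0) (A : Set ℝ) :
    volume ((fun x => c * x + d) ⁻¹' A) = ENNReal.ofReal (|c|⁻¹) * volume A := by
  have : (fun x => c * x + d) ⁻¹' A = (fun x => c * x) ⁻¹' ((fun x => x + d) ⁻¹' A) := rfl
  rw [this, Real.volume_preimage_mul_left hc, measure_preimage_add_right, abs_inv]

lemma PW_s10.step {S : Finset ℝ} {β : ℝ} {f : ℝ → ℝ} (h : PW_s10 S β f) (hβ : 0 < β)
    (hm : ∀ x, f x ∈ Icc (0:ℝ) 1) {δ : ℝ} (hδ : 0 < δ)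
    (hsep : ∀ s ∈ S, ∀ t ∈ S, s < t → δ ≤ t - s) (B : Set ℝ) {a b : ℝ} (ha : 0 ≤ a) (hb : 0 ≤ b)
    (hB : ∀ u v, 0 ≤ u → u ≤ v → v ≤ 1 → volume (Icc u v ∩ B) ≤ ENNReal.ofReal (a * (v - u) + b)) :
    ∀ u v, 0 ≤ u → u ≤ v → v ≤ 1 →
      volume (Icc u v ∩ f ⁻¹' B) ≤ ENNReal.ofReal ((a + b / (δ * β)) * (v - u) + 2 * b / β) := by
  intro u v hu huv hv
  have key := split_ind S (fun N u v => volume (Icc u v ∩ f ⁻¹' B) ≤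
      ENNReal.ofReal (a * (v - u) + (N + 1) * (b / β))) ?_ ?_ _ u v hu huv hv rfl
  · refine key.trans (ENNReal.ofReal_le_ofReal ?_)
    have hc := sep_card δ u hδ (S.filter (fun s => s ∈ Ioo u v)) v
      (fun s hs t ht => hsep s (Finset.mem_filter.1 hs).1 t (Finset.mem_filter.1 ht).1)
      (fun t ht => ⟨(Finset.mem_filter.1 ht).2.1.le, (Finset.mem_filter.1 ht).2.2.le⟩) (by linarith)
    have hbβ : 0 ≤ b / β := by positivity
    have := mul_le_mul_of_nonneg_right hc hbβ
    have e : (a + b / (δ * β)) * (v - u) + 2 * b / β =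
      a * (v - u) + (1 + (v - u) / δ) * (b / β) + b / β := by field_simp; ring
    rw [e]; linarith
  · intro u v hu huv hv hS
    obtain ⟨c, d, hc, hx⟩ := h.affine hβ hu huv hv hS
    have hc0 : c ≠ 0 := by rintro rfl; simp at hc; linarith
    have eu := hx u ⟨le_rfl, huv⟩
    have ev := hx v ⟨huv, le_rfl⟩
    have hsub : Icc u v ∩ f ⁻¹' B ⊆ (fun x => c * x + d) ⁻¹'
        (Icc (min (f u) (f v)) (max (f u) (f v)) ∩ B) := by
      rintro x ⟨hxI, hxB⟩
      have hxB' : f x ∈ B := hxB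
      rw [hx x hxI] at hxB'
      refine ⟨⟨?_, ?_⟩, hxB'⟩
      · rw [min_le_iff, eu, ev]
        rcases lt_or_gt_of_ne hc0 with h | h
        · right; nlinarith [hxI.2]
        · left; nlinarith [hxI.1]
      · rw [le_max_iff, eu, ev]
        rcases lt_or_gt_of_ne hc0 with h | h
        · left; nlinarith [hxI.1]
        · right; nlinarith [hxI.2]
    have hlen : max (f u) (f v) - min (f u) (f v) = β * (v - u) := by
      rw [max_sub_min_eq_abs, abs_sub_comm]
      exact h u v hu huv hv hS
    calc volume (Icc u v ∩ f ⁻¹' B) ≤ _ := measure_mono hsub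
      _ = ENNReal.ofReal (|c|⁻¹) * volume (Icc (min (f u) (f v)) (max (f u) (f v)) ∩ B) :=
        vol_affine c d hc0 _
      _ ≤ ENNReal.ofReal (|c|⁻¹) * ENNReal.ofReal (a * (β * (v - u)) + b) := by
        gcongr
        rw [← hlen]
        exact hB _ _ (le_min (hm u).1 (hm v).1) min_le_max (max_le (hm u).2 (hm v).2)
      _ = _ := by
        rw [← ENNReal.ofReal_mul (by positivity), hc]
        congr 1
        push_cast
        field_simp; ring
  · intro m n u w v hu h1 h2 hv h3 h4
    have hsub : Icc u v ∩ f ⁻¹' B ⊆ (Icc u w ∩ f ⁻¹' B) ∪ (Icc w v ∩ f ⁻¹' B) := by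
      rw [← union_inter_distrib_right, Icc_union_Icc_eq_Icc h1 h2]
    refine (measure_mono hsub).trans ((measure_union_le _ _).trans ((add_le_add h3 h4).trans ?_))
    have hbβ : 0 ≤ b / β := by positivity
    rw [← ENNReal.ofReal_add]
    · apply ENNReal.ofReal_le_ofReal
      push_cast
      nlinarith
    · have := mul_nonneg ha (sub_nonneg.2 h1)
      positivity
    · have := mul_nonneg ha (sub_nonneg.2 h2)
      positivity

lemma PW_s10.growth {S : Finset ℝ} {β : ℝ} {f : ℝ → ℝ} (h : PW_s10 S β f) (hβ : 2 < β)
    (hm : ∀ x, f x ∈ Icc (0:ℝ) 1) {δ : ℝ} (hδ : 0 < δ)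
    (hsep : ∀ s ∈ S, ∀ t ∈ S, s < t → δ ≤ t - s) (B : Set ℝ) {a b : ℝ} (ha : 0 ≤ a) (hb : 0 ≤ b)
    (hB : ∀ u v, 0 ≤ u → u ≤ v → v ≤ 1 → volume (Icc u v ∩ B) ≤ ENNReal.ofReal (a * (v - u) + b)) 
    (n : ℕ) :
    ∀ u v, 0 ≤ u → u ≤ v → v ≤ 1 →
      volume (Icc u v ∩ f^[n] ⁻¹' B) ≤
        ENNReal.ofReal ((a + b / (δ * (β - 2)) * (1 - (2 / β) ^ n)) * (v - u) + b * (2 / β) ^ n) := by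
  induction n with
  | zero => simpa using hB
  | succ n ih =>
    intro u v hu huv hv
    have hβ2 : 0 < β - 2 := by linarith
    have hr : (2 / β) ^ n ≤ 1 := pow_le_one₀ (by positivity) (by rw [div_le_one] <;> linarith)
    have := h.step (by linarith) hm hδ hsep _ (a := a + b / (δ * (β - 2)) * (1 - (2 / β) ^ n))
      (b := b * (2 / β) ^ n) (by have : 0 ≤ 1 - (2 / β) ^ n := by linarith
                                 positivity) (by positivity) ih u v hu huv hv
    rw [Function.iterate_succ', ← Function.iterate_succ', Function.iterate_succ, preimage_comp]
    refine this.trans (le_of_eq ?_)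
    congr 1
    have hβ0 : β ≠ 0 := by linarith
    have hβ20 : β - 2 ≠ 0 := hβ2.ne'
    rw [pow_succ]
    generalize (2 / β) ^ n = r
    field_simp
    ring

lemma exists_invariant {α : Type*} [MeasurableSpace α] (l : Measure α) [IsProbabilityMeasure l]
    (f : α → α) (hf : Measurable f) (C : ℝ≥0∞) (hC : C ≠ ⊤)
    (hb : ∀ n B, MeasurableSet B → l (f^[n] ⁻¹' B) ≤ C * l B) :
    ∃ μ : Measure α, IsProbabilityMeasure μ ∧ μ ≪ l ∧
      ∀ B, MeasurableSet B → μ (f ⁻¹' B) = μ B := by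
  classical
  let a : Set α → ℕ → ℝ≥0∞ := fun B k => l (f^[k] ⁻¹' B)
  let ν : ℕ → Set α → ℝ≥0∞ := fun n B => (∑ k ∈ Finset.range (n + 1), a B k) * ((n : ℝ≥0∞) + 1)⁻¹
  let U : Ultrafilter ℕ := hyperfilter ℕ
  have hU : (U : Filter ℕ) ≤ atTop := by
    rw [← Nat.cofinite_eq_atTop]; exact hyperfilter_le_cofinite
  let L : Set α → ℝ≥0∞ := fun B => (U.map (fun n => ν n B)).lim
  have hL : ∀ B, Tendsto (fun n => ν n B) U (𝓝 (L B)) := fun B =>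
    (U.map (fun n => ν n B)).le_nhds_lim
  have n0 : ∀ n : ℕ, (n : ℝ≥0∞) + 1 ≠ 0 := fun n => by simp
  have nt : ∀ n : ℕ, (n : ℝ≥0∞) + 1 ≠ ⊤ := fun n => by finiteness
  have avg : ∀ (n : ℕ) (x : ℝ≥0∞), (∑ k ∈ Finset.range (n + 1), x) * ((n : ℝ≥0∞) + 1)⁻¹ = x := by
    intro n x
    rw [Finset.sum_const, Finset.card_range, nsmul_eq_mul]
    push_cast
    rw [mul_comm, ← mul_assoc, ENNReal.inv_mul_cancel (n0 n) (nt n), one_mul]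
  have hLle : ∀ B, MeasurableSet B → L B ≤ C * l B := by
    intro B hB
    refine le_of_tendsto (hL B) (Eventually.of_forall fun n => ?_)
    calc ν n B ≤ (∑ k ∈ Finset.range (n + 1), C * l B) * ((n : ℝ≥0∞) + 1)⁻¹ := by
          simp only [ν]
          gcongr with k hk
          exact hb k B hB
      _ = _ := avg n _
  have hempty : L ∅ = 0 := by
    have := hLle ∅ MeasurableSet.empty
    simpa using this
  have huniv : L univ = 1 := by
    refine tendsto_nhds_unique (hL univ) ?_
    refine tendsto_const_nhds.congr fun n => ?_
    simp only [ν, a, preimage_univ, measure_univ]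
    rw [avg]
  have hadd : ∀ A B, MeasurableSet B → Disjoint A B → L (A ∪ B) = L A + L B := by
    intro A B hB hd
    refine tendsto_nhds_unique (hL _) (((hL A).add (hL B)).congr fun n => ?_)
    simp only [ν]
    rw [← add_mul, ← Finset.sum_add_distrib]
    congr 1
    refine Finset.sum_congr rfl fun k _ => ?_
    simp only [a, preimage_union]
    rw [measure_union (hd.preimage _) (hf.iterate k hB)]
  have hinv : ∀ B, MeasurableSet B → L (f ⁻¹' B) = L B := by
    intro B hB
    have hz : ∀ c : ℕ → ℝ≥0∞, (∀ n, c n ≤ 1) →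
        Tendsto (fun n : ℕ => c n * ((n : ℝ≥0∞) + 1)⁻¹) U (𝓝 0) := by
      intro c hc
      have h1 : Tendsto (fun n : ℕ => ((n : ℝ≥0∞) + 1)⁻¹) atTop (𝓝 0) := by
        have := (ENNReal.tendsto_inv_nat_nhds_zero).comp (tendsto_add_atTop_nat 1)
        refine this.congr fun n => ?_
        simp
      refine tendsto_of_tendsto_of_tendsto_of_le_of_le tendsto_const_nhds (h1.mono_left hU)
        (fun n => bot_le) (fun n => ?_)
      calc c n * ((n : ℝ≥0∞) + 1)⁻¹ ≤ 1 * ((n : ℝ≥0∞) + 1)⁻¹ := by gcongr; exact hc n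
        _ = _ := one_mul _
    have t1 := (hL (f ⁻¹' B)).add (hz (fun n => a B 0) (fun n => prob_le_one))
    have t2 := (hL B).add (hz (fun n => a B (n + 1)) (fun n => prob_le_one))
    rw [add_zero] at t1 t2
    refine tendsto_nhds_unique t1 (t2.congr fun n => ?_)
    simp only [ν]
    rw [← add_mul, ← add_mul]
    congr 1
    rw [← Finset.sum_range_succ, Finset.sum_range_succ']
    congr 1
    refine Finset.sum_congr rfl fun k _ => ?_
    simp only [a, Function.iterate_succ', preimage_comp]
  let μ : Measure α := Measure.ofMeasurable (fun B _ => L B) hempty (by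
    intro A hA hd
    have hT := tendsto_measure_biUnion_Ici_zero_of_pairwise_disjoint (μ := l)
      (fun i => (hA i).nullMeasurableSet) hd
    have hT2 : Tendsto (fun N => L (⋃ i ≥ N, A i)) atTop (𝓝 0) := by
      have h3 : Tendsto (fun N => C * l (⋃ i ≥ N, A i)) atTop (𝓝 0) := by
        have := ENNReal.Tendsto.const_mul (a := C) hT (Or.inr hC)
        simpa using this
      exact tendsto_of_tendsto_of_tendsto_of_le_of_le tendsto_const_nhds h3
        (fun n => bot_le) (fun N => hLle _ (by
          refine MeasurableSet.iUnion fun i => MeasurableSet.iUnion fun _ => hA i))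
    have hfin : ∀ N, L (⋃ i, A i) = ∑ i ∈ Finset.range N, L (A i) + L (⋃ i ≥ N, A i) := by
      intro N
      induction N with
      | zero => simp
      | succ N ih =>
        rw [ih, Finset.sum_range_succ, add_assoc]
        congr 1
        rw [← hadd]
        · congr 1
          ext x
          simp only [mem_iUnion, mem_union, exists_prop]
          constructor
          · rintro ⟨i, hi, hx⟩
            rcases eq_or_lt_of_le hi with h | h
            · subst h; exact Or.inl hx
            · exact Or.inr ⟨i, h, hx⟩
          · rintro (hx | ⟨i, hi, hx⟩)
            · exact ⟨N, le_rfl, hx⟩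
            · exact ⟨i, (Nat.le_succ N).trans hi, hx⟩
        · refine MeasurableSet.iUnion fun i => MeasurableSet.iUnion fun _ => hA i
        · simp only [disjoint_iUnion_right]
          intro i hi
          exact hd (by have : N + 1 ≤ i := hi
                       omega)
    have hS : Tendsto (fun N => ∑ i ∈ Finset.range N, L (A i) + L (⋃ i ≥ N, A i)) atTop
        (𝓝 (∑' i, L (A i) + 0)) := (ENNReal.summable.hasSum.tendsto_sum_nat).add hT2
    rw [add_zero] at hS
    refine tendsto_nhds_unique (tendsto_const_nhds.congr hfin) hS)
  have hμ : ∀ B, MeasurableSet B → μ B = L B := fun B hB => Measure.ofMeasurable_apply B hB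
  refine ⟨μ, ⟨by rw [hμ _ MeasurableSet.univ, huniv]⟩, ?_, ?_⟩
  · refine Measure.AbsolutelyContinuous.mk fun B hB h0 => ?_
    rw [hμ B hB]
    have := hLle B hB
    simpa [h0] using this
  · intro B hB
    rw [hμ B hB, hμ _ (hf hB), hinv B hB]

lemma bound_all {S : Finset ℝ} {β : ℝ} {f : ℝ → ℝ} (h : PW_s10 S β f) (hβ : 1 < β)
    (hm : ∀ x, f x ∈ Icc (0:ℝ) 1) :
    ∃ C : ℝ≥0∞, C ≠ ⊤ ∧ ∀ n B, MeasurableSet B →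
      volume.restrict (Icc (0:ℝ) 1) (f^[n] ⁻¹' B) ≤ C * volume.restrict (Icc (0:ℝ) 1) B := by
  obtain ⟨k, hk⟩ := pow_unbounded_of_one_lt 2 hβ
  have hβ0 : 0 < β := by linarith
  have hk0 : k ≠ 0 := by rintro rfl; norm_num at hk
  have hmk : ∀ j, j ≠ 0 → ∀ x, f^[j] x ∈ Icc (0:ℝ) 1 := by
    intro j hj x
    obtain ⟨i, rfl⟩ := Nat.exists_eq_succ_of_ne_zero hj
    rw [Function.iterate_succ_apply']; exact hm _
  -- general reduction
  have red : ∀ (F : ℝ → ℝ), (∀ x, F x ∈ Icc (0:ℝ) 1) → ∀ K : ℝ, 0 ≤ K →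
      (∀ (B : Set ℝ) (b : ℝ), 0 ≤ b → (∀ u v, 0 ≤ u → u ≤ v → v ≤ 1 →
        volume (Icc u v ∩ B) ≤ ENNReal.ofReal (0 * (v - u) + b)) →
        volume (Icc 0 1 ∩ F ⁻¹' B) ≤ ENNReal.ofReal (K * b)) →
      ∀ B, volume (Icc 0 1 ∩ F ⁻¹' B) ≤ ENNReal.ofReal K * volume (Icc 0 1 ∩ B) := by
    intro F _ K hK hh B
    have hfin : volume (Icc (0:ℝ) 1 ∩ B) ≠ ⊤ :=
      ((measure_mono inter_subset_left).trans_lt (by simp)).ne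
    have := hh B (volume (Icc (0:ℝ) 1 ∩ B)).toReal ENNReal.toReal_nonneg (by
      intro u v hu huv hv
      rw [zero_mul, zero_add, ENNReal.ofReal_toReal hfin]
      exact measure_mono (inter_subset_inter_left _ (Icc_subset_Icc hu hv)))
    rwa [ENNReal.ofReal_mul hK, ENNReal.ofReal_toReal hfin] at this
  obtain ⟨S', hS'⟩ := h.iterate hβ0 hm k
  obtain ⟨δ, hδ, hsep⟩ := exists_sep S'
  obtain ⟨δ₁, hδ₁, hsep₁⟩ := exists_sep S
  have hκ : 0 < β ^ k - 2 := by linarith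
  set K₁ : ℝ := 1 / (δ₁ * β) + 2 / β with hK₁
  set K : ℝ := 1 / (δ * (β ^ k - 2)) + 1 with hK
  have one : ∀ B, volume (Icc 0 1 ∩ f ⁻¹' B) ≤ ENNReal.ofReal K₁ * volume (Icc 0 1 ∩ B) := by
    refine red f hm K₁ (by positivity) fun B b hb hB => ?_
    refine (h.step hβ0 hm hδ₁ hsep₁ B le_rfl hb hB 0 1 le_rfl zero_le_one le_rfl).trans ?_
    apply ENNReal.ofReal_le_ofReal
    rw [hK₁]; apply le_of_eq; ring
  have big : ∀ n B, volume (Icc 0 1 ∩ (f^[k])^[n] ⁻¹' B) ≤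
      ENNReal.ofReal K * volume (Icc 0 1 ∩ B) := by
    intro n
    rcases Nat.eq_zero_or_pos n with rfl | hn
    · intro B
      simp only [Function.iterate_zero, preimage_id]
      refine le_mul_of_one_le_left bot_le ?_
      rw [ENNReal.one_le_ofReal, hK]
      have : 0 ≤ 1 / (δ * (β ^ k - 2)) := by positivity
      linarith
    refine red _ ?_ K (by positivity) fun B b hb hB => ?_
    · rw [← Function.iterate_mul]; exact hmk _ (by positivity)
    refine (hS'.growth hk (hmk k hk0) hδ hsep B le_rfl hb hB n 0 1 le_rfl zero_le_one le_rfl).trans ?_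
    apply ENNReal.ofReal_le_ofReal
    have r0 : 0 ≤ (2 / β ^ k) ^ n := by positivity
    have r1 : (2 / β ^ k) ^ n ≤ 1 := pow_le_one₀ (by positivity) (by rw [div_le_one] <;> linarith)
    have c0 : 0 ≤ b / (δ * (β ^ k - 2)) := by positivity
    have e : K * b = b / (δ * (β ^ k - 2)) + b := by rw [hK]; ring
    rw [e]
    nlinarith
  have ones : ∀ r B, volume (Icc 0 1 ∩ f^[r] ⁻¹' B) ≤
      ENNReal.ofReal K₁ ^ r * volume (Icc 0 1 ∩ B) := by
    intro r
    induction r with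
    | zero => intro B; simp
    | succ r ih =>
      intro B
      rw [Function.iterate_succ', preimage_comp]
      refine (ih _).trans ?_
      rw [pow_succ, mul_assoc]
      gcongr
      exact one B
  refine ⟨ENNReal.ofReal K * ∑ r ∈ Finset.range k, ENNReal.ofReal K₁ ^ r, ?_, ?_⟩
  · refine ENNReal.mul_ne_top ENNReal.ofReal_ne_top ?_
    exact (ENNReal.sum_lt_top.2 fun r _ => ENNReal.pow_lt_top ENNReal.ofReal_lt_top).ne
  · intro n B hB
    rw [Measure.restrict_apply' measurableSet_Icc, Measure.restrict_apply' measurableSet_Icc,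
      inter_comm, inter_comm B]
    have hr : n % k < k := Nat.mod_lt _ (Nat.pos_of_ne_zero hk0)
    have en : f^[n] = f^[n % k] ∘ (f^[k])^[n / k] := by
      rw [← Function.iterate_mul, ← Function.iterate_add, Nat.mod_add_div]
    rw [en, preimage_comp]
    refine (big _ _).trans ?_
    rw [mul_assoc]
    gcongr
    refine (ones _ _).trans ?_
    gcongr
    exact Finset.single_le_sum (f := fun r => ENNReal.ofReal K₁ ^ r) (fun _ _ => bot_le)
      (Finset.mem_range.2 hr)

lemma exists_interval {S : Finset ℝ} {β : ℝ} {f : ℝ → ℝ} (h : PW_s10 S β f) (hβ : 1 < β)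
    (hm : ∀ x, f x ∈ Icc (0:ℝ) 1) (hfm : Measurable f) (E : Set ℝ) (hE : MeasurableSet E)
    (hinv : volume.restrict (Icc (0:ℝ) 1) (E \ f ⁻¹' E) = 0)
    (hpos : volume.restrict (Icc (0:ℝ) 1) E ≠ 0) :
    ∃ u v, 0 ≤ u ∧ u < v ∧ v ≤ 1 ∧ volume (Icc u v \ E) = 0 := by
  by_contra! hcon
  obtain ⟨C, hC, hbd⟩ := bound_all h hβ hm
  obtain ⟨k, hk⟩ := pow_unbounded_of_one_lt 2 hβ
  have hβ0 : 0 < β := by linarith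
  have hk0 : k ≠ 0 := by rintro rfl; norm_num at hk
  have hmk : ∀ x, f^[k] x ∈ Icc (0:ℝ) 1 := by
    intro x
    obtain ⟨i, rfl⟩ := Nat.exists_eq_succ_of_ne_zero hk0
    rw [Function.iterate_succ_apply']; exact hm _
  have hinvn : ∀ n, volume.restrict (Icc (0:ℝ) 1) (E \ f^[n] ⁻¹' E) = 0 := by
    intro n
    induction n with
    | zero => simp
    | succ n ih =>
      have hsub : E \ f^[n + 1] ⁻¹' E ⊆ (E \ f ⁻¹' E) ∪ f^[1] ⁻¹' (E \ f^[n] ⁻¹' E) := by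
        rintro x ⟨hx, hx'⟩
        by_cases hfx : f x ∈ E
        · right; exact ⟨hfx, hx'⟩
        · left; exact ⟨hx, hfx⟩
      refine measure_mono_null hsub (measure_union_null hinv ?_)
      have := hbd 1 (E \ f^[n] ⁻¹' E) (hE.diff (hfm.iterate n hE))
      simpa [ih] using this
  obtain ⟨S', hS'⟩ := h.iterate hβ0 hm k
  obtain ⟨δ, hδ, hsep⟩ := exists_sep S'
  have hκ : 0 < β ^ k - 2 := by linarith
  set τ : ℝ := δ * (β ^ k - 2) / 2 with hτ
  have hτ0 : 0 < τ := by positivity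
  obtain ⟨N, hN⟩ := exists_nat_gt (2 / τ)
  have hN0 : 0 < (N : ℝ) := lt_trans (by positivity) hN
  have hNτ : 2 / (N : ℝ) ≤ τ := by
    rw [div_lt_iff₀ hτ0] at hN
    rw [div_le_iff₀ hN0]; linarith
  let cell : ℕ → ℝ := fun i => (volume (Icc ((i : ℝ) / N) (((i : ℝ) + 1) / N) \ E)).toReal
  have hcfin : ∀ u v : ℝ, volume (Icc u v \ E) ≠ ⊤ := fun u v =>
    ((measure_mono diff_subset).trans_lt (by simp)).ne
  have hcell : ∀ i < N, 0 < cell i := by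
    intro i hi
    have hi' : (i : ℝ) + 1 ≤ N := by exact_mod_cast hi
    refine ENNReal.toReal_pos (hcon _ _ (by positivity) ?_ ?_) (hcfin _ _)
    · gcongr; linarith
    · rw [div_le_one hN0]; exact hi'
  obtain ⟨c, hc0, hc1, hcc⟩ : ∃ c : ℝ, 0 < c ∧ c ≤ 1 ∧ ∀ i < N, c ≤ cell i := by
    have hne : (Finset.range N).Nonempty := by
      rw [Finset.nonempty_range_iff]; rintro rfl; simp at hN0
    obtain ⟨i, hi, hmin⟩ := Finset.exists_min_image (Finset.range N) cell hne
    refine ⟨min (cell i) 1, lt_min (hcell i (Finset.mem_range.1 hi)) one_pos, min_le_right _ _,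
      fun j hj => (min_le_left _ _).trans (hmin j (Finset.mem_range.2 hj))⟩
  have hbase : ∀ u v, 0 ≤ u → u ≤ v → v ≤ 1 →
      volume (Icc u v ∩ E) ≤ ENNReal.ofReal ((1 - c) * (v - u) + c * τ) := by
    intro u v hu huv hv
    by_cases hlt : v - u < τ
    · refine (measure_mono inter_subset_left).trans ?_
      rw [Real.volume_Icc]
      apply ENNReal.ofReal_le_ofReal
      nlinarith
    · push Not at hlt
      set i := ⌈u * N⌉₊ with hi
      have h1 : u * N ≤ i := Nat.le_ceil _
      have h2 : (i : ℝ) < u * N + 1 := Nat.ceil_lt_add_one (by positivity)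
      have h3 : (2 : ℝ) ≤ (v - u) * N := by
        rw [div_le_iff₀ hN0] at hNτ
        nlinarith
      have h4 : (i : ℝ) + 1 ≤ v * N := by nlinarith
      have hiN : i < N := by
        have : (i : ℝ) + 1 ≤ N := by nlinarith
        exact_mod_cast this
      have hsub : Icc ((i : ℝ) / N) (((i : ℝ) + 1) / N) ⊆ Icc u v := by
        apply Icc_subset_Icc
        · rwa [le_div_iff₀ hN0]
        · rwa [div_le_iff₀ hN0]
      have h5 : c ≤ (volume (Icc u v \ E)).toReal := (hcc i hiN).trans
        (ENNReal.toReal_mono (hcfin _ _) (measure_mono (diff_subset_diff_left hsub)))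
      have h6 := measure_inter_add_diff (μ := volume) (Icc u v) hE
      have hfin : volume (Icc u v ∩ E) ≠ ⊤ := 
        ((measure_mono inter_subset_left).trans_lt (by simp)).ne
      have h7 : (volume (Icc u v ∩ E)).toReal + (volume (Icc u v \ E)).toReal = v - u := by
        rw [← ENNReal.toReal_add hfin (hcfin _ _), h6, Real.volume_Icc,
          ENNReal.toReal_ofReal (by linarith)]
      rw [← ENNReal.ofReal_toReal hfin]
      apply ENNReal.ofReal_le_ofReal
      nlinarith
  have hlim : ∀ u v, 0 ≤ u → u ≤ v → v ≤ 1 →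
      volume (Icc u v ∩ E) ≤ ENNReal.ofReal ((1 - c / 2) * (v - u)) := by
    intro u v hu huv hv
    have hr0 : 0 ≤ 2 / β ^ k := by positivity
    have hr1 : 2 / β ^ k < 1 := by rw [div_lt_one] <;> linarith
    have ht : Tendsto (fun n : ℕ => ENNReal.ofReal ((1 - c / 2) * (v - u) + c * τ * (2 / β ^ k) ^ n))
        atTop (𝓝 (ENNReal.ofReal ((1 - c / 2) * (v - u)))) := by
      refine (ENNReal.continuous_ofReal.tendsto _).comp ?_
      have := ((tendsto_pow_atTop_nhds_zero_of_lt_one hr0 hr1).const_mul (c * τ)).const_add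
        ((1 - c / 2) * (v - u))
      simpa using this
    refine ge_of_tendsto ht (Eventually.of_forall fun n => ?_)
    have hg := hS'.growth hk hmk hδ hsep E (a := 1 - c) (b := c * τ) (by linarith) (by positivity)
      hbase n u v hu huv hv
    have h0 : volume ((Icc u v ∩ E) \ (Icc u v ∩ (f^[k])^[n] ⁻¹' E)) = 0 := by
      have := hinvn (k * n)
      rw [Measure.restrict_apply' measurableSet_Icc, Function.iterate_mul] at this
      refine measure_mono_null ?_ this
      rintro x ⟨⟨hx, hxE⟩, hx'⟩
      exact ⟨⟨hxE, fun h => hx' ⟨hx, h⟩⟩, hu.trans hx.1, hx.2.trans hv⟩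
    have h1 : volume (Icc u v ∩ E) ≤ volume (Icc u v ∩ (f^[k])^[n] ⁻¹' E) := by
      calc volume (Icc u v ∩ E) ≤ volume ((Icc u v ∩ (f^[k])^[n] ⁻¹' E) ∪
            ((Icc u v ∩ E) \ (Icc u v ∩ (f^[k])^[n] ⁻¹' E))) := by
            apply measure_mono; rw [union_diff_self]; exact subset_union_right
        _ ≤ _ := measure_union_le _ _
        _ = _ := by rw [h0, add_zero]
    refine h1.trans (hg.trans (ENNReal.ofReal_le_ofReal ?_))
    have e : c * τ / (δ * (β ^ k - 2)) = c / 2 := by rw [hτ]; field_simp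
    rw [e]
    have r0 : 0 ≤ (2 / β ^ k) ^ n := by positivity
    have : 0 ≤ (2 / β ^ k) ^ n * (v - u) := mul_nonneg r0 (by linarith)
    nlinarith
  set E' := E ∩ Ioo (0:ℝ) 1 with hE'
  have hE'm : MeasurableSet E' := hE.inter measurableSet_Ioo
  have hE'0 : volume E' ≠ 0 := by
    rw [hE', ← Measure.restrict_apply' measurableSet_Ioo, Measure.restrict_congr_set Ioo_ae_eq_Icc]
    exact hpos
  have hne : NeBot (ae (volume.restrict E')) := by
    rw [ae_neBot, Ne, Measure.restrict_eq_zero]; exact hE'0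
  obtain ⟨x, hx, hxE⟩ := ((Besicovitch.ae_tendsto_measure_inter_div volume E').and
    (ae_restrict_mem hE'm)).exists
  have hle : (1 : ℝ≥0∞) ≤ ENNReal.ofReal (1 - c / 2) := by
    refine le_of_tendsto hx ?_
    have hx0 : 0 < min x (1 - x) := lt_min hxE.2.1 (by linarith [hxE.2.2])
    filter_upwards [Ioo_mem_nhdsGT hx0] with r hr
    have hr2 := lt_min_iff.1 hr.2
    have hr1 := hr.1
    rw [Real.closedBall_eq_Icc, Real.volume_Icc]
    refine ENNReal.div_le_of_le_mul ?_
    rw [← ENNReal.ofReal_mul (by linarith)]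
    refine le_trans (measure_mono ?_) (hlim (x - r) (x + r) (by linarith) (by linarith) (by linarith))
    rintro y ⟨hy, hy'⟩
    exact ⟨hy', hy.1⟩
  rw [ENNReal.one_le_ofReal] at hle
  linarith

lemma image_null {S : Finset ℝ} {β : ℝ} {f : ℝ → ℝ} (h : PW_s10 S β f) (hβ : 0 < β) (X : Set ℝ)
    (hX : X ⊆ Icc 0 1) (h0 : volume X = 0) : volume (f '' X) = 0 := by
  have hl : LipschitzOnWith ⟨β, hβ.le⟩ f X := by
    apply LipschitzOnWith.of_dist_le_mul
    intro x hx y hy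
    rw [Real.dist_eq, Real.dist_eq]
    show _ ≤ β * _
    rcases le_total x y with hxy | hxy
    · rw [abs_sub_comm x y, abs_of_nonneg (sub_nonneg.2 hxy)]
      exact h.lip x y (hX hx).1 hxy (hX hy).2
    · rw [abs_sub_comm, abs_of_nonneg (sub_nonneg.2 hxy)]
      exact h.lip y x (hX hy).1 hxy (hX hx).2
  have := hl.hausdorffMeasure_image_le (d := 1) zero_le_one
  rw [hausdorffMeasure_real, h0] at this
  simpa using this

lemma tail_dense {f : ℝ → ℝ} {x₀ : ℝ}
    (ht : Icc (0 : ℝ) 1 ⊆ closure (Set.range fun n : ℕ => f^[n] x₀)) (k : ℕ) :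
    Icc (0 : ℝ) 1 ⊆ ((fun n => f^[n] x₀) '' Iio k) ∪ closure (Set.range fun n : ℕ => f^[n + k] x₀) := by
  have hfin : ((fun n => f^[n] x₀) '' Iio k).Finite := (finite_Iio k).image _
  refine ht.trans ?_
  rw [← hfin.isClosed.closure_eq, ← closure_union]
  apply closure_mono
  rintro _ ⟨n, rfl⟩
  rcases lt_or_ge n k with h | h
  · exact Or.inl ⟨n, h, rfl⟩
  · exact Or.inr ⟨n - k, by simp [Nat.sub_add_cancel h]⟩

lemma full_of_interval {S : Finset ℝ} {β : ℝ} {f : ℝ → ℝ} (h : PW_s10 S β f) (hβ : 0 < β)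
    (hm : ∀ x, f x ∈ Icc (0:ℝ) 1) (hfc : Continuous f) (E : Set ℝ)
    (hinv : volume.restrict (Icc (0:ℝ) 1) (E \ f ⁻¹' E) = 0)
    {x₀ : ℝ} (ht : Icc (0 : ℝ) 1 ⊆ closure (Set.range fun n : ℕ => f^[n] x₀))
    {u v : ℝ} (hu : 0 ≤ u) (huv : u < v) (hv : v ≤ 1) (hEuv : volume (Icc u v \ E) = 0) :
    volume (Icc 0 1 \ E) = 0 := by
  set U := Ioo u v with hUdef
  have hU01 : U ⊆ Icc 0 1 := fun x hx => ⟨hu.trans hx.1.le, hx.2.le.trans hv⟩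
  have himg : ∀ j, f^[j] '' U ⊆ Icc 0 1 := by
    intro j
    cases j with
    | zero => simpa using hU01
    | succ j =>
      rintro _ ⟨x, _, rfl⟩
      rw [Function.iterate_succ_apply']; exact hm _
  have hnull : ∀ j, volume (f^[j] '' U \ E) = 0 := by
    intro j
    induction j with
    | zero =>
      simp only [Function.iterate_zero, image_id]
      exact measure_mono_null (diff_subset_diff_left Ioo_subset_Icc_self) hEuv
    | succ j ih =>
      have hsub : f^[j + 1] '' U \ E ⊆ f '' (f^[j] '' U \ f ⁻¹' E) := by
        rintro _ ⟨⟨x, hx, rfl⟩, hxE⟩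
        rw [Function.iterate_succ_apply'] at hxE ⊢
        exact ⟨_, ⟨⟨x, hx, rfl⟩, hxE⟩, rfl⟩
      refine measure_mono_null hsub (image_null h hβ _ (diff_subset.trans (himg j)) ?_)
      rw [Measure.restrict_apply' measurableSet_Icc] at hinv
      refine measure_mono_null ?_ (measure_union_null ih hinv)
      rintro x ⟨hx, hxE⟩
      by_cases hh : x ∈ E
      · exact Or.inr ⟨⟨hh, hxE⟩, himg j hx⟩
      · exact Or.inl ⟨hx, hh⟩
  -- first visit
  have visit : ∀ k, ∃ j, f^[j + k] x₀ ∈ U := by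
    intro k
    have hfin : ((fun n => f^[n] x₀) '' Iio k).Finite := (finite_Iio k).image _
    obtain ⟨p, hpU, hp⟩ := ((Ioo_infinite huv).diff hfin).nonempty
    have := (tail_dense ht k (hU01 hpU)).resolve_left hp
    rw [mem_closure_iff] at this
    obtain ⟨_, hy, ⟨j, rfl⟩⟩ := this U isOpen_Ioo hpU
    exact ⟨j, hy⟩
  obtain ⟨k, hk⟩ := visit 0
  rw [add_zero] at hk
  obtain ⟨j, hj⟩ := visit (k + 1)
  set n := j + 1 with hn
  have hn0 : 0 < n := by omega
  set y := f^[k] x₀ with hy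
  have hret : f^[n] y ∈ U := by
    rw [hy, ← Function.iterate_add_apply, hn, show j + 1 + k = j + (k + 1) by ring]; exact hj
  let W : Set ℝ := ⋃ q : ℕ, (f^[n])^[q] '' U
  have hcont : ∀ q, Continuous (f^[q]) := fun q => hfc.iterate q
  have hW : IsPreconnected W := by
    apply IsPreconnected.iUnion_of_chain
    · intro q
      exact isPreconnected_Ioo.image _ ((hcont n).iterate q).continuousOn
    · intro q
      refine ⟨(f^[n])^[q] (f^[n] y), ⟨_, hret, rfl⟩, ⟨y, hk, ?_⟩⟩
      exact Function.iterate_succ_apply _ _ _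
  have hWi : ∀ i, volume (closure (f^[i] '' W) \ E) = 0 := by
    intro i
    have hc : IsPreconnected (f^[i] '' W) := hW.image _ (hcont i).continuousOn
    have hfr : volume (frontier (f^[i] '' W)) = 0 := by
      apply Convex.addHaar_frontier
      exact hc.ordConnected.convex
    have hin : volume (f^[i] '' W \ E) = 0 := by
      have : f^[i] '' W \ E ⊆ ⋃ q : ℕ, (f^[i + n * q] '' U \ E) := by
        rintro _ ⟨⟨w, hw, rfl⟩, hE⟩
        obtain ⟨q, x, hx, rfl⟩ := mem_iUnion.1 hw
        refine mem_iUnion.2 ⟨q, ⟨x, hx, ?_⟩, hE⟩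
        rw [Function.iterate_add_apply, Function.iterate_mul]
      exact measure_mono_null this (measure_iUnion_null fun q => hnull _)
    refine measure_mono_null ?_ (measure_union_null hin hfr)
    rw [closure_eq_self_union_frontier, union_diff_distrib]
    exact union_subset_union_right _ diff_subset
  have hcov : Icc (0:ℝ) 1 \ E ⊆ ((fun n => f^[n] x₀) '' Iio k) ∪
      ⋃ i ∈ Iio n, (closure (f^[i] '' W) \ E) := by
    rintro x ⟨hx, hxE⟩
    rcases tail_dense ht k hx with h1 | h1
    · exact Or.inl h1
    · right
      have hsub : (Set.range fun q : ℕ => f^[q + k] x₀) ⊆ ⋃ i ∈ Iio n, f^[i] '' W := by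
        rintro _ ⟨q, rfl⟩
        simp only [mem_iUnion]
        refine ⟨q % n, Nat.mod_lt _ hn0, (f^[n])^[q / n] y, mem_iUnion.2 ⟨_, y, hk, rfl⟩, ?_⟩
        rw [← Function.iterate_mul, ← Function.iterate_add_apply, Nat.mod_add_div,
          Function.iterate_add_apply]
      have h2 := closure_mono hsub h1
      rw [(finite_Iio n).closure_biUnion] at h2
      simp only [mem_iUnion] at h2 ⊢
      obtain ⟨i, hi, h3⟩ := h2
      exact ⟨i, hi, h3, hxE⟩
  refine measure_mono_null hcov (measure_union_null ?_ ?_)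
  · exact ((finite_Iio k).image _).measure_zero _
  · exact (measure_biUnion_null_iff (finite_Iio n).countable).2 fun i _ => hWi i

lemma one_lt_slope {S : Finset ℝ} {β : ℝ} {f : ℝ → ℝ} (h : PW_s10 S β f)
    (hm : ∀ x, f x ∈ Icc (0:ℝ) 1) (hfc : Continuous f)
    {x₀ : ℝ} (hx₀ : x₀ ∈ Icc (0 : ℝ) 1)
    (ht : Icc (0 : ℝ) 1 ⊆ closure (Set.range fun n : ℕ => f^[n] x₀)) : 1 < β := by
  by_contra! hβ
  obtain ⟨p, hp, hfp⟩ := exists_mem_Icc_isFixedPt_of_mapsTo (f := f) (a := 0) (b := 1)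
    hfc.continuousOn zero_le_one (fun x _ => hm x)
  have hdec : ∀ x ∈ Icc (0:ℝ) 1, |f x - p| ≤ |x - p| := by
    intro x hx
    have e : f p = p := hfp
    rcases le_total x p with hxp | hxp
    · have := h.lip x p hx.1 hxp hp.2
      rw [e] at this
      rw [abs_sub_comm x p, abs_of_nonneg (sub_nonneg.2 hxp)]
      nlinarith
    · have := h.lip p x hp.1 hxp hx.2
      rw [e, abs_sub_comm] at this
      rw [abs_of_nonneg (sub_nonneg.2 hxp)]
      nlinarith
  have hmem : ∀ n, f^[n] x₀ ∈ Icc (0:ℝ) 1 := by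
    intro n
    cases n with
    | zero => exact hx₀
    | succ n => rw [Function.iterate_succ_apply']; exact hm _
  have h1 := ht hp
  rw [Metric.mem_closure_iff] at h1
  obtain ⟨_, ⟨k, rfl⟩, hk⟩ := h1 (1/8) (by norm_num)
  have hball : ∀ n, f^[n + k] x₀ ∈ Metric.closedBall p (1/8) := by
    intro n
    rw [Metric.mem_closedBall, Real.dist_eq]
    induction n with
    | zero => rw [zero_add, ← Real.dist_eq, dist_comm]; exact hk.le
    | succ n ih =>
      rw [show n + 1 + k = (n + k) + 1 by ring, Function.iterate_succ_apply']
      exact (hdec _ (hmem _)).trans ih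
  have hsub : Icc (0:ℝ) 1 ⊆ ((fun n => f^[n] x₀) '' Iio k) ∪ Metric.closedBall p (1/8) := by
    refine (tail_dense ht k).trans (union_subset_union_right _ ?_)
    apply closure_minimal _ Metric.isClosed_closedBall
    rintro _ ⟨n, rfl⟩
    exact hball n
  have h2 := (measure_mono hsub).trans (measure_union_le (μ := volume) _ _)
  rw [((finite_Iio k).image _).measure_zero, Real.volume_closedBall, Real.volume_Icc, zero_add,
    ENNReal.ofReal_le_ofReal_iff (by norm_num)] at h2
  norm_num at h2

lemma PW_of_slope (f : ℝ → ℝ) {β : ℝ}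
    (hslope : ∃ (m : ℕ) (s : ℕ → ℝ), 0 < m ∧ s 0 = 0 ∧ s m = 1 ∧
      (∀ j < m, s j < s (j + 1)) ∧
      ∀ j < m, ∀ u ∈ Icc (s j) (s (j + 1)), ∀ v ∈ Icc (s j) (s (j + 1)),
        |f u - f v| = β * |u - v|) : ∃ S, PW_s10 S β f := by
  classical
  obtain ⟨m, s, hm, h0, h1, hlt, hs⟩ := hslope
  refine ⟨(Finset.range (m + 1)).image s, fun u v hu huv hv hS => ?_⟩
  rcases huv.eq_or_lt with rfl | huv'
  · simp
  have hex : ∃ k, u < s k := ⟨m, by rw [h1]; linarith⟩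
  have hk := Nat.find_spec hex
  have hkm : Nat.find hex ≤ m := Nat.find_min' hex (by rw [h1]; linarith)
  have hk0 : Nat.find hex ≠ 0 := by
    intro h
    rw [h, h0] at hk; linarith
  obtain ⟨j, hj⟩ := Nat.exists_eq_succ_of_ne_zero hk0
  have hju : s j ≤ u := not_lt.1 (Nat.find_min hex (by omega))
  rw [hj] at hk hkm
  have hvj : v ≤ s (j + 1) := by
    by_contra! hlt
    exact hS (s (j + 1)) (Finset.mem_image_of_mem _ (Finset.mem_range.2 (by omega))) ⟨hk, hlt⟩
  rw [hs j (by omega) u ⟨hju, by linarith⟩ v ⟨by linarith, hvj⟩, abs_sub_comm,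
    abs_of_nonneg (by linarith)]

/-- a continuous, transitive, piecewise monotone map `g : [0,1] → [0,1]` of
constant slope `β > 0` admits an ergodic `g`-invariant Borel probability measure `μ` on
`[0,1]` which is equivalent to Lebesgue measure on `[0,1]`. -/
theorem stmt_10 (g : ℝ → ℝ) {β : ℝ} (hβ : 0 < β)
    (hg : MapsTo g (Icc 0 1) (Icc 0 1))
    (hgc : ContinuousOn g (Icc 0 1))
    -- `g` is piecewise monotone of constant slope `β`
    (hslope : ∃ (m : ℕ) (s : ℕ → ℝ), 0 < m ∧ s 0 = 0 ∧ s m = 1 ∧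
      (∀ j < m, s j < s (j + 1)) ∧
      ∀ j < m, ∀ u ∈ Icc (s j) (s (j + 1)), ∀ v ∈ Icc (s j) (s (j + 1)),
        |g u - g v| = β * |u - v|)
    -- `g` is transitive: some point has dense forward orbit in `[0,1]`
    (htrans : ∃ x₀ ∈ Icc (0 : ℝ) 1,
      Icc (0 : ℝ) 1 ⊆ closure (Set.range fun n : ℕ => g^[n] x₀)) :
    ∃ μ : Measure ℝ, IsProbabilityMeasure μ ∧
      -- `μ` is a measure on `[0,1]`
      μ (Icc (0 : ℝ) 1)ᶜ = 0 ∧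
      -- `μ` is `g`-invariant
      (∀ A : Set ℝ, MeasurableSet A → μ (g ⁻¹' A ∩ Icc 0 1) = μ (A ∩ Icc 0 1)) ∧
      -- `μ` is ergodic
      (∀ A : Set ℝ, MeasurableSet A → g ⁻¹' A ∩ Icc 0 1 = A ∩ Icc 0 1 →
        μ A = 0 ∨ μ A = 1) ∧
      -- `μ` and Lebesgue measure on `[0,1]` are mutually absolutely continuous
      μ ≪ volume.restrict (Icc (0 : ℝ) 1) ∧ volume.restrict (Icc (0 : ℝ) 1) ≪ μ := by
  classical
  obtain ⟨x₀, hx₀, htr⟩ := htrans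
  let f : ℝ → ℝ := IccExtend (zero_le_one' ℝ) ((Icc (0:ℝ) 1).restrict g)
  have hfg : ∀ x ∈ Icc (0:ℝ) 1, f x = g x := fun x hx => by
    simp only [f]; rw [IccExtend_of_mem _ _ hx]; rfl
  have hfc : Continuous f := (continuousOn_iff_continuous_restrict.1 hgc).Icc_extend'
  have hm : ∀ x, f x ∈ Icc (0:ℝ) 1 := fun x => by
    simp only [f, IccExtend, Function.comp, restrict_apply]
    exact hg (projIcc 0 1 zero_le_one x).2
  have hfm : Measurable f := hfc.measurable
  have hit : ∀ n, f^[n] x₀ = g^[n] x₀ ∧ g^[n] x₀ ∈ Icc (0:ℝ) 1 := by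
    intro n
    induction n with
    | zero => exact ⟨rfl, hx₀⟩
    | succ n ih =>
      rw [Function.iterate_succ_apply', Function.iterate_succ_apply', ih.1]
      exact ⟨hfg _ ih.2, hg ih.2⟩
  have ht : Icc (0 : ℝ) 1 ⊆ closure (Set.range fun n : ℕ => f^[n] x₀) := by
    simp only [fun n => (hit n).1]; exact htr
  obtain ⟨S, hS'⟩ := PW_of_slope g hslope
  have hS : PW_s10 S β f := by
    intro u v hu huv hv h
    rw [hfg u ⟨hu, huv.trans hv⟩, hfg v ⟨hu.trans huv, hv⟩]
    exact hS' u v hu huv hv h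
  have hβ1 : 1 < β := one_lt_slope hS hm hfc hx₀ ht
  set l : Measure ℝ := volume.restrict (Icc (0 : ℝ) 1) with hl
  have hlp : IsProbabilityMeasure l := ⟨by simp [hl]⟩
  have full : ∀ E, MeasurableSet E → l (E \ f ⁻¹' E) = 0 → l E ≠ 0 → l Eᶜ = 0 := by
    intro E hE h1 h2
    obtain ⟨u, v, hu, huv, hv, h3⟩ := exists_interval hS hβ1 hm hfm E hE h1 h2
    have := full_of_interval hS hβ hm hfc E h1 ht hu huv hv h3
    rw [hl, Measure.restrict_apply' measurableSet_Icc]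
    refine measure_mono_null ?_ this
    rintro x ⟨a, b⟩
    exact ⟨b, a⟩
  obtain ⟨C, hC, hbd⟩ := bound_all hS hβ1 hm
  obtain ⟨μ, hμp, hμl, hμi⟩ := exists_invariant l f hfm C hC hbd
  have hsupp : μ (Icc (0 : ℝ) 1)ᶜ = 0 := hμl (by simp [hl])
  have hI : ∀ A, μ (A ∩ Icc 0 1) = μ A := fun A =>
    measure_inter_conull hsupp
  have hpre : ∀ A, g ⁻¹' A ∩ Icc 0 1 = f ⁻¹' A ∩ Icc 0 1 := by
    intro A
    ext x
    constructor
    · rintro ⟨a, b⟩; exact ⟨by rw [mem_preimage, hfg x b]; exact a, b⟩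
    · rintro ⟨a, b⟩; exact ⟨by rw [mem_preimage, hfg x b] at a; exact a, b⟩
  refine ⟨μ, hμp, hsupp, ?_, ?_, hμl, ?_⟩
  · intro A hA
    rw [hpre, hI, hI, hμi A hA]
  · intro A hA hinv
    by_cases h0 : l A = 0
    · exact Or.inl (hμl h0)
    · right
      have := full A hA (by
        rw [hl, Measure.restrict_apply' measurableSet_Icc]
        convert measure_empty (μ := (volume : Measure ℝ))
        rw [eq_empty_iff_forall_notMem]
        rintro x ⟨⟨hx, hx'⟩, hxI⟩
        have : x ∈ f ⁻¹' A ∩ Icc 0 1 := by rw [← hpre, hinv]; exact ⟨hx, hxI⟩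
        exact hx' this.1) h0
      exact (prob_compl_eq_zero_iff hA).1 (hμl this)
  · set r := μ.rnDeriv l with hr
    have hrm : Measurable r := Measure.measurable_rnDeriv _ _
    have hwd : l.withDensity r = μ := Measure.withDensity_rnDeriv_eq _ _ hμl
    set E : Set ℝ := {x | r x ≠ 0} with hE
    have hEm : MeasurableSet E := hrm (measurableSet_singleton 0).compl
    have hz : ∀ X, μ X = 0 ↔ l (E ∩ X) = 0 := by
      intro X
      rw [← hwd]
      exact withDensity_apply_eq_zero hrm
    have hEc : μ Eᶜ = 0 := by rw [hz]; simp
    have h1 : l (E \ f ⁻¹' E) = 0 := by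
      have : μ (f ⁻¹' E)ᶜ = 0 := by
        rw [← preimage_compl, hμi _ hEm.compl, hEc]
      rw [hz] at this
      exact this
    have h2 : l E ≠ 0 := by
      intro h
      have h3 : μ E = 0 := hμl h
      have h4 := measure_union_null h3 hEc
      rw [union_compl_self, measure_univ] at h4
      exact one_ne_zero h4
    have h3 := full E hEm h1 h2
    intro X hX
    rw [hz] at hX
    refine measure_mono_null ?_ (measure_union_null hX h3)
    intro x hx
    by_cases hh : x ∈ E
    · exact Or.inl ⟨hh, hx⟩
    · exact Or.inr hh
end
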